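/- Let 1 ≤ k ≤ n and let λ^1, …, λ^m be partitions contained in a k×(n−k) rectangle with Σ_j |λ^j| = k(n−k). Let N be the iterated Littlewood–Richardson number N = Σ c^{ν^{(2)}}_{λ^1,λ^2} · c^{ν^{(3)}}_{ν^{(2)},λ^3} ⋯ c^{ρ}_{ν^{(m−1)},λ^m}, the sum running over all sequences ν^{(2)}, …, ν^{(m−1)} of partitions contained in the k×(n−k) rectangle, where ρ = ((n−k), …, (n−k)) is the full k×(n−k) rectangle. Then there exist complete flags F^1_•, …, F^m_• of ℝ^n such that the set { V : V a k-dimensional subspace of ℝ^n with dim(V ∩ F^j_{n−k+i−λ^j_i}) ≥ i for all i = 1,…,k and j = 1,…,m } is finite and has exactly N elements. -/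

import Mathlib

/-!  All Schubert problems on Grassmannians are enumerative over the real
numbers: there exist complete flags of `ℝⁿ` such that the corresponding
zero-dimensional Schubert problem has exactly the expected number `N` of
solutions, `N` being the iterated Littlewood–Richardson number. -/

open scoped Classical
open Module

/-- The cell `(i, j)` lies in the skew Young diagram `ν/λ`. -/
def InSkew (lam nu : ℕ → ℕ) (x : ℕ × ℕ) : Prop :=
  lam x.1 ≤ x.2 ∧ x.2 < nu x.1

/-- Reading order: rows top to bottom, each row right to left. -/
def ReadBefore (r c : ℕ) (x : ℕ × ℕ) : Prop :=
  x.1 < r ∨ (x.1 = r ∧ c ≤ x.2)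

/-- `T` is a Littlewood–Richardson skew tableau of shape `ν/λ` and content `μ`. -/
def IsLRSkewTableau (lam mu nu : ℕ → ℕ) (T : ℕ × ℕ → ℕ) : Prop :=
  (∀ x : ℕ × ℕ, 0 < T x ↔ InSkew lam nu x) ∧
  (∀ i j j', lam i ≤ j → j ≤ j' → j' < nu i → T (i, j) ≤ T (i, j')) ∧
  (∀ i i' j, i < i' → InSkew lam nu (i, j) → InSkew lam nu (i', j) →
    T (i, j) < T (i', j)) ∧
  (∀ m, 0 < m →
    Nat.card {x : ℕ × ℕ // InSkew lam nu x ∧ T x = m} = mu (m - 1)) ∧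
  (∀ m, 0 < m → ∀ r c : ℕ,
    Nat.card {x : ℕ × ℕ // ReadBefore r c x ∧ InSkew lam nu x ∧ T x = m + 1} ≤
      Nat.card {x : ℕ × ℕ // ReadBefore r c x ∧ InSkew lam nu x ∧ T x = m})

/-- `lam` is a partition contained in a `k × (n-k)` rectangle. -/
def IsRectPartition (n k : ℕ) (lam : ℕ → ℕ) : Prop :=
  Antitone lam ∧ (∀ i, lam i ≤ n - k) ∧ (∀ i, k ≤ i → lam i = 0)

/-- The full `k × (n-k)` rectangle `ρ = ((n-k), …, (n-k))`. -/
def rectFull (n k : ℕ) : ℕ → ℕ := fun i => if i < k then n - k else 0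

/-- The iterated Littlewood–Richardson number
`N = Σ c^{ν⁽²⁾}_{λ¹,λ²} · c^{ν⁽³⁾}_{ν⁽²⁾,λ³} ⋯ c^{ρ}_{ν⁽ᵐ⁻¹⁾,λᵐ}`,
the sum running over all sequences `ν⁽²⁾, …, ν⁽ᵐ⁻¹⁾` of partitions contained in
the `k × (n-k)` rectangle and `ρ` the full rectangle.  It is expressed as the
number of pairs `(c, T)` where `c` is the chain
`λ¹ = ν⁽¹⁾ ⊆ ν⁽²⁾ ⊆ … ⊆ ν⁽ᵐ⁾ = ρ` (recorded as `c (j-1) = ν⁽ʲ⁾`, constant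
beyond index `m-1`) and `T j` is a Littlewood–Richardson skew tableau of shape
`ν⁽ʲ⁺¹⁾/ν⁽ʲ⁾` and content `λ^{j+1}` for `1 ≤ j ≤ m-1` (with all unused values
of `T` pinned to the zero filling, so that `Nat.card` counts exactly the
iterated sum of Littlewood–Richardson coefficients). -/
noncomputable def iteratedLRNumber (n k m : ℕ) (lams : ℕ → ℕ → ℕ) : ℕ :=
  Nat.card { p : (ℕ → ℕ → ℕ) × (ℕ → ℕ × ℕ → ℕ) //
    p.1 0 = lams 0 ∧
    (∀ j, m - 1 ≤ j → p.1 j = rectFull n k) ∧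
    (∀ j, IsRectPartition n k (p.1 j)) ∧
    p.2 0 = (fun _ => 0) ∧
    (∀ j, m ≤ j → p.2 j = fun _ => 0) ∧
    (∀ j, 1 ≤ j → j ≤ m - 1 →
      (∀ i, p.1 (j - 1) i ≤ p.1 j i) ∧
      IsLRSkewTableau (p.1 (j - 1)) (lams j) (p.1 j) (p.2 j)) }

/-- The linearization of the system `x m r = const` for `Z m r`, `(A l * Ψ l x) j r = 0` for
`S l j r`, in the unknowns `x` and `A`, is surjective. -/
def RegAt {κ ν ι : Type*} [Fintype κ] (Z : κ → ν → Prop) (S : ι → κ → ν → Prop)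
    (Ψ : ι → Matrix κ ν ℝ →ₗ[ℝ] Matrix κ ν ℝ) (x : Matrix κ ν ℝ) (A : ι → Matrix κ κ ℝ) : Prop :=
  ∀ (c0 : Matrix κ ν ℝ) (c : ι → Matrix κ ν ℝ), ∃ (x' : Matrix κ ν ℝ) (A' : ι → Matrix κ κ ℝ),
    (∀ m r, Z m r → x' m r = c0 m r) ∧
    ∀ l j r, S l j r → (A' l * Ψ l x + A l * Ψ l x') j r = c l j r

/-- A surjective linear map onto a finite-dimensional space stays surjective under small
perturbations. -/
theorem eventually_surjective_of_tendsto {α E F : Type*} [NormedAddCommGroup F] [NormedSpace ℝ F]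
    [FiniteDimensional ℝ F] [AddCommGroup E] [Module ℝ E] {f : Filter α}
    (L : α → E →ₗ[ℝ] F) (L0 : E →ₗ[ℝ] F) (h : ∀ e, Filter.Tendsto (fun a => L a e) f (nhds (L0 e)))
    (hs : Function.Surjective L0) : ∀ᶠ a in f, Function.Surjective (L a) := by
  let b := Module.finBasis ℝ F
  choose R hR using hs
  have hli : LinearIndependent ℝ (fun i => L0 (R (b i))) := by
    simpa [hR] using b.linearIndependent
  have ht : Filter.Tendsto (fun a i => L a (R (b i))) f (nhds (fun i => L0 (R (b i)))) :=
    tendsto_pi_nhds.2 fun i => h _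
  filter_upwards [ht.eventually hli.eventually] with a ha
  have htop := ha.span_eq_top_of_card_eq_finrank' (by simp)
  rw [← LinearMap.range_eq_top, eq_top_iff, ← htop, Submodule.span_le]
  rintro _ ⟨i, rfl⟩
  exact ⟨_, rfl⟩

section ImplicitSystem

variable {κ ν ι : Type*} [Fintype κ] [Fintype ν]

/-- The coefficient array of a family of linear operators. -/
noncomputable def coeffArr (Ψ : ι → Matrix κ ν ℝ →ₗ[ℝ] Matrix κ ν ℝ) :
    ι → κ → ν → κ → ν → ℝ := fun l i r a b => Ψ l (Matrix.single a b 1) i r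

theorem sum_coeffArr (Ψ : ι → Matrix κ ν ℝ →ₗ[ℝ] Matrix κ ν ℝ) (l : ι) (i : κ) (r : ν)
    (x : Matrix κ ν ℝ) : ∑ a, ∑ b, coeffArr Ψ l i r a b * x a b = Ψ l x i r := by
  conv_rhs => rw [Matrix.matrix_eq_sum_single x]
  simp only [map_sum, Matrix.sum_apply, coeffArr]
  refine Finset.sum_congr rfl fun a _ => Finset.sum_congr rfl fun b _ => ?_
  have : Matrix.single a b (x a b) = x a b • Matrix.single a b (1 : ℝ) := by simp
  rw [this, map_smul, Matrix.smul_apply, smul_eq_mul, mul_comm]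

/-- The left-hand sides of the system, in coordinates. -/
noncomputable def sysMap (Z : κ → ν → Prop) (S : ι → κ → ν → Prop)
    (p : ((κ → ν → ℝ) × (ι → κ → κ → ℝ)) × (ι → κ → ν → κ → ν → ℝ)) :
    ({q : κ × ν // Z q.1 q.2} → ℝ) × ({q : ι × κ × ν // S q.1 q.2.1 q.2.2} → ℝ) :=
  (fun q => p.1.1 q.1.1 q.1.2, fun q => ∑ i, p.1.2 q.1.1 q.1.2.1 i *
    ∑ a, ∑ b, p.2 q.1.1 i q.1.2.2 a b * p.1.1 a b)

noncomputable def sysLin (Z : κ → ν → Prop) (S : ι → κ → ν → Prop)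
    (p : ((κ → ν → ℝ) × (ι → κ → κ → ℝ)) × (ι → κ → ν → κ → ν → ℝ)) :
    ((κ → ν → ℝ) × (ι → κ → κ → ℝ)) →ₗ[ℝ]
    ({q : κ × ν // Z q.1 q.2} → ℝ) × ({q : ι × κ × ν // S q.1 q.2.1 q.2.2} → ℝ) where
  toFun y := (fun q => y.1 q.1.1 q.1.2, fun q => ∑ i, (y.2 q.1.1 q.1.2.1 i *
    ∑ a, ∑ b, p.2 q.1.1 i q.1.2.2 a b * p.1.1 a b) + ∑ i, (p.1.2 q.1.1 q.1.2.1 i *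
    ∑ a, ∑ b, p.2 q.1.1 i q.1.2.2 a b * y.1 a b))
  map_add' y z := by
    ext q
    · rfl
    · simp only [Prod.fst_add, Prod.snd_add, Pi.add_apply, add_mul, mul_add,
        Finset.sum_add_distrib]
      ring
  map_smul' c y := by
    ext q
    · rfl
    · simp only [Prod.smul_fst, Prod.smul_snd, Pi.smul_apply, smul_eq_mul, RingHom.id_apply,
        mul_add, Finset.mul_sum]
      congr 1
      · exact Finset.sum_congr rfl fun i _ => Finset.sum_congr rfl fun a _ =>
          Finset.sum_congr rfl fun b _ => by ring
      · exact Finset.sum_congr rfl fun i _ => Finset.sum_congr rfl fun a _ =>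
          Finset.sum_congr rfl fun b _ => by ring

theorem regAt_iff (Z : κ → ν → Prop) (S : ι → κ → ν → Prop)
    (Ψ : ι → Matrix κ ν ℝ →ₗ[ℝ] Matrix κ ν ℝ) (x : Matrix κ ν ℝ) (A : ι → Matrix κ κ ℝ) :
    RegAt Z S Ψ x A ↔ Function.Surjective (sysLin Z S ((x, A), coeffArr Ψ)) := by
  have key : ∀ (x' : Matrix κ ν ℝ) (A' : ι → Matrix κ κ ℝ)
      (q : {q : ι × κ × ν // S q.1 q.2.1 q.2.2}),
      (sysLin Z S ((x, A), coeffArr Ψ) (x', A')).2 q =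
        (A' q.1.1 * Ψ q.1.1 x + A q.1.1 * Ψ q.1.1 x') q.1.2.1 q.1.2.2 := by
    intro x' A' q
    simp only [sysLin, LinearMap.coe_mk, AddHom.coe_mk, Matrix.add_apply, Matrix.mul_apply]
    congr 1
    · exact Finset.sum_congr rfl fun i _ => by rw [← sum_coeffArr]
    · exact Finset.sum_congr rfl fun i _ => by rw [← sum_coeffArr]
  constructor
  · rintro h ⟨w1, w2⟩
    obtain ⟨x', A', h1, h2⟩ := h
      (Matrix.of fun m r => if hz : Z m r then w1 ⟨(m, r), hz⟩ else 0)
      (fun l => Matrix.of fun j r => if hz : S l j r then w2 ⟨(l, j, r), hz⟩ else 0)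
    refine ⟨(x', A'), Prod.ext (funext fun q => ?_) (funext fun q => ?_)⟩
    · have := h1 _ _ q.2
      simpa [q.2, sysLin] using this
    · rw [key]
      have := h2 _ _ _ q.2
      simpa [q.2] using this
  · intro h c0 c
    obtain ⟨⟨x', A'⟩, hy⟩ := h (fun q => c0 q.1.1 q.1.2, fun q => c q.1.1 q.1.2.1 q.1.2.2)
    refine ⟨x', A', fun m r hz => ?_, fun l j r hs => ?_⟩
    · exact congrFun (congrArg Prod.fst hy) ⟨(m, r), hz⟩
    · exact (key x' A' ⟨(l, j, r), hs⟩).symm.trans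
        (congrFun (congrArg Prod.snd hy) ⟨(l, j, r), hs⟩)

variable [Fintype ι]

theorem sysMap_contDiff (Z : κ → ν → Prop) (S : ι → κ → ν → Prop) :
    ContDiff ℝ 1 (sysMap Z S) := by
  unfold sysMap
  fun_prop

theorem sysMap_fderiv (Z : κ → ν → Prop) (S : ι → κ → ν → Prop)
    (p : ((κ → ν → ℝ) × (ι → κ → κ → ℝ)) × (ι → κ → ν → κ → ν → ℝ))
    (y : (κ → ν → ℝ) × (ι → κ → κ → ℝ)) :
    fderiv ℝ (sysMap Z S) p (y, 0) = sysLin Z S p y := by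
  have h1 : HasDerivAt (fun s : ℝ => p + s • (y, (0 : ι → κ → ν → κ → ν → ℝ))) (y, 0) 0 := by
    simpa using ((hasDerivAt_id (0 : ℝ)).smul_const
      (y, (0 : ι → κ → ν → κ → ν → ℝ))).const_add p
  have hd : DifferentiableAt ℝ (sysMap Z S) (p + (0 : ℝ) • (y, (0 : ι → κ → ν → κ → ν → ℝ))) :=
    (sysMap_contDiff Z S).differentiable (by norm_num) _
  have h2 := hd.hasFDerivAt.comp_hasDerivAt (0 : ℝ) h1
  simp only [zero_smul, add_zero] at h2
  refine h2.unique ?_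
  refine HasDerivAt.prodMk ?_ ?_
  · refine hasDerivAt_pi.2 fun q => ?_
    have := ((hasDerivAt_id (0 : ℝ)).mul_const (y.1 q.1.1 q.1.2)).const_add (p.1.1 q.1.1 q.1.2)
    simpa [sysMap, sysLin] using this
  · refine hasDerivAt_pi.2 fun q => ?_
    have h3 : ∀ i, HasDerivAt (fun s : ℝ => (p.1.2 q.1.1 q.1.2.1 i + s * y.2 q.1.1 q.1.2.1 i) *
        ∑ a, ∑ b, p.2 q.1.1 i q.1.2.2 a b * (p.1.1 a b + s * y.1 a b))
        (y.2 q.1.1 q.1.2.1 i * (∑ a, ∑ b, p.2 q.1.1 i q.1.2.2 a b * p.1.1 a b) +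
        p.1.2 q.1.1 q.1.2.1 i * ∑ a, ∑ b, p.2 q.1.1 i q.1.2.2 a b * y.1 a b) 0 := by
      intro i
      have ha : HasDerivAt (fun s : ℝ => p.1.2 q.1.1 q.1.2.1 i + s * y.2 q.1.1 q.1.2.1 i)
          (y.2 q.1.1 q.1.2.1 i) 0 := by
        simpa using ((hasDerivAt_id (0 : ℝ)).mul_const (y.2 q.1.1 q.1.2.1 i)).const_add
          (p.1.2 q.1.1 q.1.2.1 i)
      have hb : HasDerivAt (fun s : ℝ => ∑ a, ∑ b, p.2 q.1.1 i q.1.2.2 a b *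
          (p.1.1 a b + s * y.1 a b)) (∑ a, ∑ b, p.2 q.1.1 i q.1.2.2 a b * y.1 a b) 0 := by
        refine HasDerivAt.fun_sum fun a _ => HasDerivAt.fun_sum fun b _ => ?_
        simpa using (((hasDerivAt_id (0 : ℝ)).mul_const (y.1 a b)).const_add
          (p.1.1 a b)).const_mul (p.2 q.1.1 i q.1.2.2 a b)
      simpa using ha.fun_mul hb
    have h4 := HasDerivAt.fun_sum (u := Finset.univ) fun i _ => h3 i
    simpa [sysMap, sysLin, Finset.sum_add_distrib] using h4

theorem sys_local {Z : κ → ν → Prop} {S : ι → κ → ν → Prop}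
    {p : ((κ → ν → ℝ) × (ι → κ → κ → ℝ)) × (ι → κ → ν → κ → ν → ℝ)}
    (hp : Function.Surjective (sysLin Z S p))
    {U : Set ((κ → ν → ℝ) × (ι → κ → κ → ℝ))} (hU : U ∈ nhds p.1) :
    ∀ᶠ Θ in nhds p.2, ∃ y ∈ U, sysMap Z S (y, Θ) = sysMap Z S p ∧
      Function.Surjective (sysLin Z S (y, Θ)) := by
  have hreg : ∀ᶠ q in nhds p, Function.Surjective (sysLin Z S q) := by
    refine eventually_surjective_of_tendsto _ _ (fun y => ?_) hp
    have : Continuous fun q => sysLin Z S q y := by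
      simp only [sysLin, LinearMap.coe_mk, AddHom.coe_mk]
      fun_prop
    exact this.tendsto p
  have hs : HasStrictFDerivAt (fun q => (sysMap Z S q, q.2))
      ((fderiv ℝ (sysMap Z S) p).prod (ContinuousLinearMap.snd ℝ _ _)) p :=
    ((sysMap_contDiff Z S).contDiffAt.hasStrictFDerivAt (by norm_num)).prodMk
      hasStrictFDerivAt_snd
  have hsurj : ((fderiv ℝ (sysMap Z S) p).prod
      (ContinuousLinearMap.snd ℝ ((κ → ν → ℝ) × (ι → κ → κ → ℝ))
        (ι → κ → ν → κ → ν → ℝ))).range = ⊤ := by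
    rw [LinearMap.range_eq_top]
    rintro ⟨w, Θ⟩
    obtain ⟨y, hy⟩ := hp (w - fderiv ℝ (sysMap Z S) p (0, Θ))
    refine ⟨(y, Θ), ?_⟩
    have hsplit : ((y, Θ) : ((κ → ν → ℝ) × (ι → κ → κ → ℝ)) × (ι → κ → ν → κ → ν → ℝ)) =
        (y, 0) + (0, Θ) := by simp
    refine Prod.ext ?_ rfl
    change fderiv ℝ (sysMap Z S) p (y, Θ) = w
    rw [hsplit, map_add, sysMap_fderiv, hy]
    simp
  have hmap := hs.map_nhds_eq_of_surj hsurj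
  have hmem : {q : ((κ → ν → ℝ) × (ι → κ → κ → ℝ)) × (ι → κ → ν → κ → ν → ℝ) |
      q.1 ∈ U ∧ Function.Surjective (sysLin Z S q)} ∈ nhds p :=
    Filter.inter_mem (continuous_fst.continuousAt.preimage_mem_nhds hU) hreg
  have himg := Filter.image_mem_map (m := fun q => (sysMap Z S q, q.2)) hmem
  rw [hmap] at himg
  have hc : Filter.Tendsto (fun Θ : ι → κ → ν → κ → ν → ℝ => (sysMap Z S p, Θ)) (nhds p.2)
      (nhds (sysMap Z S p, p.2)) := by
    refine Continuous.tendsto' (by fun_prop) _ _ rfl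
  filter_upwards [hc himg] with Θ hΘ
  obtain ⟨⟨y, Θ'⟩, ⟨hyU, hys⟩, hy⟩ := hΘ
  simp only [Prod.mk.injEq] at hy
  obtain ⟨hy1, rfl⟩ := hy
  exact ⟨y, hyU, hy1, hys⟩

/-- Solutions of a regular system persist, and stay regular, when the operators `Ψ l` are
slightly perturbed. -/
theorem RegAt.persist {α : Type*} {f : Filter α} {Z : κ → ν → Prop} {S : ι → κ → ν → Prop}
    (Ψ : α → ι → Matrix κ ν ℝ →ₗ[ℝ] Matrix κ ν ℝ) {Ψ0 : ι → Matrix κ ν ℝ →ₗ[ℝ] Matrix κ ν ℝ}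
    (hΨ : ∀ l x i r, Filter.Tendsto (fun a => Ψ a l x i r) f (nhds (Ψ0 l x i r)))
    {x0 : Matrix κ ν ℝ} {A0 : ι → Matrix κ κ ℝ} (hreg : RegAt Z S Ψ0 x0 A0)
    (h0 : ∀ l j r, S l j r → (A0 l * Ψ0 l x0) j r = 0)
    {U : Set (Matrix κ ν ℝ × (ι → Matrix κ κ ℝ))} (hU : U ∈ nhds (x0, A0)) :
    ∀ᶠ a in f, ∃ p ∈ U, (∀ m r, Z m r → p.1 m r = x0 m r) ∧
      (∀ l j r, S l j r → (p.2 l * Ψ a l p.1) j r = 0) ∧ RegAt Z S (Ψ a) p.1 p.2 := by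
  have hsys := sys_local (p := ((x0, A0), coeffArr Ψ0)) ((regAt_iff _ _ _ _ _).1 hreg) hU
  have ht : Filter.Tendsto (fun a => coeffArr (Ψ a)) f (nhds (coeffArr Ψ0)) := by
    simp only [tendsto_pi_nhds]
    intro l i r a b
    exact hΨ _ _ _ _
  have key : ∀ (Φ : ι → Matrix κ ν ℝ →ₗ[ℝ] Matrix κ ν ℝ) (x : Matrix κ ν ℝ)
      (A : ι → Matrix κ κ ℝ) (q : {q : ι × κ × ν // S q.1 q.2.1 q.2.2}),
      (sysMap Z S ((x, A), coeffArr Φ)).2 q = (A q.1.1 * Φ q.1.1 x) q.1.2.1 q.1.2.2 := by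
    intro Φ x A q
    simp only [sysMap, Matrix.mul_apply]
    exact Finset.sum_congr rfl fun i _ => by rw [← sum_coeffArr]
  filter_upwards [ht.eventually hsys] with a ha
  obtain ⟨⟨x, A⟩, hU', heq, hs⟩ := ha
  refine ⟨(x, A), hU', fun m r hz => ?_, fun l j r hs' => ?_, (regAt_iff _ _ _ _ _).2 hs⟩
  · exact congrFun (congrArg Prod.fst heq) ⟨(m, r), hz⟩
  · have h2 := congrFun (congrArg Prod.snd heq) ⟨(l, j, r), hs'⟩
    exact (key (Ψ a) x A ⟨(l, j, r), hs'⟩).symm.trans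
      (h2.trans ((key Ψ0 x0 A0 ⟨(l, j, r), hs'⟩).trans (h0 l j r hs')))

end ImplicitSystem

theorem natCast_le_encard_iff {α : Type*} (s : Set α) (q : ℕ) :
    (q : ℕ∞) ≤ s.encard ↔ ∃ v : Fin q → α, Function.Injective v ∧ ∀ i, v i ∈ s := by
  constructor
  · intro h
    obtain ⟨t, hts, ht⟩ := Set.exists_subset_encard_eq h
    have hfin : t.Finite := Set.finite_of_encard_eq_coe ht
    have hcard : Nat.card t = q := by
      have := hfin.cast_ncard_eq
      rw [ht] at this
      exact_mod_cast this
    have := hfin.to_subtype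
    let e := Finite.equivFinOfCardEq hcard
    exact ⟨fun i => (e.symm i : α), fun i j hij => e.symm.injective (Subtype.ext hij),
      fun i => hts (e.symm i).2⟩
  · rintro ⟨v, hv, hs⟩
    have h1 : (Set.range v).encard = q := by
      rw [← Set.image_univ, hv.encard_image]
      simp
    rw [← h1]
    exact Set.encard_le_encard (Set.range_subset_iff.2 hs)

section RowSpace

variable {k n : ℕ}

/-- Right multiplication by a square matrix. -/
def rightMul (G : Matrix (Fin n) (Fin n) ℝ) :
    Matrix (Fin k) (Fin n) ℝ →ₗ[ℝ] Matrix (Fin k) (Fin n) ℝ where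
  toFun x := x * G
  map_add' x y := Matrix.add_mul x y G
  map_smul' c x := Matrix.smul_mul c x G

@[simp]
theorem rightMul_apply (G : Matrix (Fin n) (Fin n) ℝ) (x : Matrix (Fin k) (Fin n) ℝ) :
    rightMul G x = x * G := rfl

/-- The row space of a matrix. -/
def rowSp (x : Matrix (Fin k) (Fin n) ℝ) : Submodule ℝ (Fin n → ℝ) :=
  LinearMap.range x.vecMulLinear

theorem mem_rowSp {x : Matrix (Fin k) (Fin n) ℝ} {w : Fin n → ℝ} :
    w ∈ rowSp x ↔ ∃ c, Matrix.vecMul c x = w := Iff.rfl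

theorem rowSp_eq_span (x : Matrix (Fin k) (Fin n) ℝ) :
    rowSp x = Submodule.span ℝ (Set.range x.row) := range_vecMulLinear x

theorem rowSp_mul_le (A : Matrix (Fin k) (Fin k) ℝ) (x : Matrix (Fin k) (Fin n) ℝ) :
    rowSp (A * x) ≤ rowSp x := by
  rintro w ⟨c, rfl⟩
  exact ⟨Matrix.vecMul c A, by simp [Matrix.vecMul_vecMul]⟩

theorem rowSp_mul {A : Matrix (Fin k) (Fin k) ℝ} (hA : IsUnit A) (x : Matrix (Fin k) (Fin n) ℝ) :
    rowSp (A * x) = rowSp x := by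
  refine le_antisymm (rowSp_mul_le A x) ?_
  have h := rowSp_mul_le A⁻¹ (A * x)
  rwa [← Matrix.mul_assoc, Matrix.nonsing_inv_mul _ ((Matrix.isUnit_iff_isUnit_det A).1 hA),
    Matrix.one_mul] at h

theorem rowSp_mul_right (x : Matrix (Fin k) (Fin n) ℝ) (D : Matrix (Fin n) (Fin n) ℝ) :
    rowSp (x * D) = (rowSp x).map D.vecMulLinear := by
  ext w
  simp only [mem_rowSp, Submodule.mem_map, exists_exists_eq_and, Matrix.vecMulLinear_apply,
    Matrix.vecMul_vecMul]

theorem rowSp_mul_right_inj {D : Matrix (Fin n) (Fin n) ℝ} (hD : IsUnit D)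
    {x y : Matrix (Fin k) (Fin n) ℝ} : rowSp (x * D) = rowSp (y * D) ↔ rowSp x = rowSp y := by
  refine ⟨fun h => ?_, fun h => by rw [rowSp_mul_right, rowSp_mul_right, h]⟩
  have h2 : rowSp (x * D * D⁻¹) = rowSp (y * D * D⁻¹) := by
    rw [rowSp_mul_right, h, ← rowSp_mul_right]
  simpa [Matrix.mul_assoc, Matrix.mul_nonsing_inv _ ((Matrix.isUnit_iff_isUnit_det D).1 hD)]
    using h2

theorem finrank_rowSp {x : Matrix (Fin k) (Fin n) ℝ} (hx : LinearIndependent ℝ x.row) :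
    finrank ℝ (rowSp x) = k := by
  rw [rowSp_eq_span, finrank_span_eq_card hx, Fintype.card_fin]

/-- Distinct row spaces of the same dimension stay distinct under small perturbations. -/
theorem rowSp_ne_persist {x y : Matrix (Fin k) (Fin n) ℝ} (hx : LinearIndependent ℝ x.row)
    (hy : LinearIndependent ℝ y.row) (h : rowSp x ≠ rowSp y) :
    ∀ᶠ p in nhds (x, y), rowSp p.1 ≠ rowSp p.2 := by
  obtain ⟨j, hj⟩ : ∃ j, y.row j ∉ rowSp x := by
    by_contra! hcon
    have hle : rowSp y ≤ rowSp x := by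
      rw [rowSp_eq_span y, Submodule.span_le]
      rintro _ ⟨j, rfl⟩
      exact hcon j
    exact h (Submodule.eq_of_le_of_finrank_eq hle (by rw [finrank_rowSp hx, finrank_rowSp hy])).symm
  have hli : LinearIndependent ℝ (fun o : Option (Fin k) => Option.elim o (y.row j) x.row) := by
    rw [linearIndependent_option]
    refine ⟨hx, ?_⟩
    rw [rowSp_eq_span] at hj
    exact hj
  have hc : Continuous fun (p : Matrix (Fin k) (Fin n) ℝ × Matrix (Fin k) (Fin n) ℝ)
      (o : Option (Fin k)) => Option.elim o (p.2.row j) p.1.row := by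
    refine continuous_pi fun o => ?_
    cases o with
    | none =>
      exact continuous_pi fun r => (continuous_snd.matrix_elem j r)
    | some i =>
      exact continuous_pi fun r => (continuous_fst.matrix_elem i r)
  filter_upwards [(hc.tendsto (x, y)).eventually hli.eventually] with p hp heq
  rw [linearIndependent_option] at hp
  apply hp.2
  change p.2.row j ∈ Submodule.span ℝ (Set.range p.1.row)
  rw [← rowSp_eq_span, heq, rowSp_eq_span]
  exact Submodule.subset_span ⟨j, rfl⟩

theorem exists_separating_nhds {Ω : Type*} [Finite Ω] (x : Ω → Matrix (Fin k) (Fin n) ℝ)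
    (hx : ∀ w, LinearIndependent ℝ (x w).row) :
    ∃ U : Ω → Set (Matrix (Fin k) (Fin n) ℝ), (∀ w, U w ∈ nhds (x w)) ∧
      ∀ w w', rowSp (x w) ≠ rowSp (x w') → ∀ y ∈ U w, ∀ y' ∈ U w', rowSp y ≠ rowSp y' := by
  have h : ∀ w w', ∃ U ∈ nhds (x w), ∃ U' ∈ nhds (x w'), rowSp (x w) ≠ rowSp (x w') →
      ∀ y ∈ U, ∀ y' ∈ U', rowSp y ≠ rowSp y' := by
    intro w w'
    by_cases hne : rowSp (x w) = rowSp (x w')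
    · exact ⟨_, Filter.univ_mem, _, Filter.univ_mem, fun h => absurd hne h⟩
    · have := rowSp_ne_persist (hx w) (hx w') hne
      rw [nhds_prod_eq, Filter.eventually_prod_iff] at this
      obtain ⟨p, hp, q, hq, hpq⟩ := this
      exact ⟨_, hp, _, hq, fun _ y hy y' hy' => hpq hy hy'⟩
  choose U hU U' hU' hsep using h
  refine ⟨fun w => ⋂ w', (U w w' ∩ U' w' w), fun w => ?_, fun w w' hne y hy y' hy' => ?_⟩
  · exact Filter.iInter_mem.2 fun w' => Filter.inter_mem (hU _ _) (hU' _ _)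
  · exact hsep w w' hne y (Set.mem_iInter.1 hy w').1 y' (Set.mem_iInter.1 hy' w).2

end RowSpace

section LeadingTerms

variable {k n : ℕ}

/-- Rows with distinct leading positions (with respect to `rk`) have a nontrivial combination with
leading position among the given ones. -/
theorem exists_leading {rk : Fin n → ℕ} {π : Fin k → Fin n}
    (hinj : Function.Injective fun m => rk (π m))
    {y : Matrix (Fin k) (Fin n) ℝ} (hz : ∀ m r, rk (π m) < rk r → y m r = 0)
    (hp : ∀ m, y m (π m) ≠ 0) {c : Fin k → ℝ} (hc : c ≠ 0) :
    ∃ m, Matrix.vecMul c y (π m) ≠ 0 ∧ ∀ r, rk (π m) < rk r → Matrix.vecMul c y r = 0 := by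
  have hne : (Finset.univ.filter fun m => c m ≠ 0).Nonempty := by
    obtain ⟨m, hm⟩ := Function.ne_iff.1 hc
    exact ⟨m, by simpa using hm⟩
  obtain ⟨m, hm, hmax⟩ := Finset.exists_max_image _ (fun m => rk (π m)) hne
  simp only [Finset.mem_filter, Finset.mem_univ, true_and] at hm hmax
  refine ⟨m, ?_, fun r hr => ?_⟩
  · rw [Matrix.vecMul, dotProduct, Finset.sum_eq_single m]
    · exact mul_ne_zero hm (hp m)
    · intro m' _ hne'
      by_cases h0 : c m' = 0
      · rw [h0, zero_mul]
      · have hlt : rk (π m') < rk (π m) :=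
          lt_of_le_of_ne (hmax m' h0) fun h => hne' (hinj h)
        rw [hz m' _ hlt, mul_zero]
    · simp
  · rw [Matrix.vecMul, dotProduct]
    refine Finset.sum_eq_zero fun m' _ => ?_
    by_cases h0 : c m' = 0
    · rw [h0, zero_mul]
    · rw [hz m' r (lt_of_le_of_lt (hmax m' h0) hr), mul_zero]

theorem vecMul_eq_zero_of_leading {rk : Fin n → ℕ} {π : Fin k → Fin n}
    (hinj : Function.Injective fun m => rk (π m))
    {y : Matrix (Fin k) (Fin n) ℝ} (hz : ∀ m r, rk (π m) < rk r → y m r = 0)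
    (hp : ∀ m, y m (π m) ≠ 0) {c : Fin k → ℝ} (hc : Matrix.vecMul c y = 0) : c = 0 := by
  by_contra h
  obtain ⟨m, hm, -⟩ := exists_leading hinj hz hp h
  exact hm (congrFun hc _)

theorem linearIndependent_of_leading {rk : Fin n → ℕ} {π : Fin k → Fin n}
    (hinj : Function.Injective fun m => rk (π m))
    {y : Matrix (Fin k) (Fin n) ℝ} (hz : ∀ m r, rk (π m) < rk r → y m r = 0)
    (hp : ∀ m, y m (π m) ≠ 0) : LinearIndependent ℝ y.row := by
  rw [← Matrix.vecMul_injective_iff]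
  intro c c' h
  have h2 : Matrix.vecMul (c - c') y = 0 := by
    rw [Matrix.sub_vecMul, sub_eq_zero]; exact h
  exact sub_eq_zero.1 (vecMul_eq_zero_of_leading hinj hz hp h2)

/-- The set of leading positions is determined by the row space. -/
theorem range_leading_subset {rk : Fin n → ℕ} (hrk : Function.Injective rk)
    {π π' : Fin k → Fin n} (hinj' : Function.Injective π')
    {y y' : Matrix (Fin k) (Fin n) ℝ} (hz : ∀ m r, rk (π m) < rk r → y m r = 0)
    (hp : ∀ m, y m (π m) ≠ 0) (hz' : ∀ m r, rk (π' m) < rk r → y' m r = 0)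
    (hp' : ∀ m, y' m (π' m) ≠ 0) (h : rowSp y ≤ rowSp y') : Set.range π ⊆ Set.range π' := by
  rintro _ ⟨m, rfl⟩
  obtain ⟨c, hc⟩ : y.row m ∈ rowSp y' := h ⟨Pi.single m 1, by simp⟩
  have hc' : ∀ r, Matrix.vecMul c y' r = y m r := fun r => congrFun hc r
  have hc0 : c ≠ 0 := by
    rintro rfl
    have := hc' (π m)
    rw [Matrix.zero_vecMul] at this
    exact hp m this.symm
  obtain ⟨m', h1, h2⟩ := exists_leading (rk := rk) (hrk.comp hinj') hz' hp' hc0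
  refine ⟨m', hrk (le_antisymm ?_ ?_)⟩
  · by_contra! hlt
    exact h1 ((hc' _).trans (hz m _ hlt))
  · by_contra! hlt
    exact hp m ((hc' _).symm.trans (h2 _ hlt))

theorem isUnit_of_mul_leading {rk : Fin n → ℕ} {π : Fin k → Fin n}
    (hinj : Function.Injective fun m => rk (π m)) {B : Matrix (Fin k) (Fin k) ℝ}
    {x y : Matrix (Fin k) (Fin n) ℝ} (hy : B * x = y) (hz : ∀ m r, rk (π m) < rk r → y m r = 0)
    (hp : ∀ m, y m (π m) ≠ 0) : IsUnit B := by
  rw [← Matrix.linearIndependent_rows_iff_isUnit, ← Matrix.vecMul_injective_iff]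
  intro c c' h
  have h1 : Matrix.vecMul (c - c') B = 0 := by
    rw [Matrix.sub_vecMul, sub_eq_zero]; exact h
  have h2 : Matrix.vecMul (c - c') y = 0 := by
    rw [← hy, ← Matrix.vecMul_vecMul, h1, Matrix.zero_vecMul]
  exact sub_eq_zero.1 (vecMul_eq_zero_of_leading hinj hz hp h2)

end LeadingTerms

section SchubertSolutions

variable {k n : ℕ} {ι : Type*}

/-- `x` is a frame of a transverse solution of the Schubert problem for the flags whose steps are
the spaces of `w` with `(w * H l) r = 0` for `r ≥ c`; the `j`-th row of `A l * x` spans, together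
with the previous ones, the relevant intersection, with leading position `P l j`. -/
structure IsSol (H : ι → Matrix (Fin n) (Fin n) ℝ) (P : ι → Fin k → Fin n)
    (x : Matrix (Fin k) (Fin n) ℝ) (A : ι → Matrix (Fin k) (Fin k) ℝ) : Prop where
  zero : ∀ l j r, P l j < r → (A l * x * H l) j r = 0
  piv : ∀ l j, (A l * x * H l) j (P l j) ≠ 0
  reg : ∀ c : ι → Matrix (Fin k) (Fin n) ℝ, ∃ (x' : Matrix (Fin k) (Fin n) ℝ)
    (A' : ι → Matrix (Fin k) (Fin k) ℝ), ∀ l j r, P l j < r →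
      (A' l * x * H l + A l * x' * H l) j r = c l j r

/-- The set of transverse solutions of a Schubert problem. -/
def Sol (H : ι → Matrix (Fin n) (Fin n) ℝ) (P : ι → Fin k → Fin n) :
    Set (Submodule ℝ (Fin n → ℝ)) :=
  {V | ∃ x A, IsSol H P x A ∧ rowSp x = V}

theorem Sol_comp_subset {ι' : Type*} {g : ι' → ι} (hg : Function.Injective g)
    (H : ι → Matrix (Fin n) (Fin n) ℝ) (P : ι → Fin k → Fin n) :
    Sol H P ⊆ Sol (fun l => H (g l)) (fun l => P (g l)) := by
  rintro V ⟨x, A, h, rfl⟩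
  refine ⟨x, fun l => A (g l), ⟨fun l => h.zero _, fun l => h.piv _, fun c => ?_⟩, rfl⟩
  obtain ⟨x', A', h'⟩ := h.reg (Function.extend g c 0)
  refine ⟨x', fun l => A' (g l), fun l j r hr => ?_⟩
  rw [h' (g l) j r hr, hg.extend_apply]

theorem IsSol.isUnit {H : ι → Matrix (Fin n) (Fin n) ℝ} {P : ι → Fin k → Fin n}
    {x : Matrix (Fin k) (Fin n) ℝ} {A : ι → Matrix (Fin k) (Fin k) ℝ} (h : IsSol H P x A)
    (l : ι) (hP : Function.Injective (P l)) : IsUnit (A l) :=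
  isUnit_of_mul_leading (rk := Fin.val) (Fin.val_injective.comp hP)
    (Matrix.mul_assoc _ _ _).symm (h.zero l) (h.piv l)

theorem IsSol.linearIndependent {H : ι → Matrix (Fin n) (Fin n) ℝ} {P : ι → Fin k → Fin n}
    {x : Matrix (Fin k) (Fin n) ℝ} {A : ι → Matrix (Fin k) (Fin k) ℝ} (h : IsSol H P x A)
    (l : ι) (hP : Function.Injective (P l)) : LinearIndependent ℝ x.row := by
  have hA := h.isUnit l hP
  rw [← Matrix.vecMul_injective_iff]
  intro c c' hcc
  have h1 : Matrix.vecMul (Matrix.vecMul (c - c') (A l)⁻¹) (A l * x * H l) = 0 := by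
    rw [Matrix.vecMul_vecMul, ← Matrix.mul_assoc, ← Matrix.mul_assoc,
      Matrix.nonsing_inv_mul _ ((Matrix.isUnit_iff_isUnit_det _).1 hA), Matrix.one_mul,
      ← Matrix.vecMul_vecMul, Matrix.sub_vecMul]
    simp only at hcc
    rw [hcc, sub_self, Matrix.zero_vecMul]
  have h2 := vecMul_eq_zero_of_leading (rk := Fin.val) (Fin.val_injective.comp hP) (h.zero l)
    (h.piv l) h1
  have h3 := congrArg (fun w => Matrix.vecMul w (A l)) h2
  simp only [Matrix.vecMul_vecMul, Matrix.zero_vecMul,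
    Matrix.nonsing_inv_mul _ ((Matrix.isUnit_iff_isUnit_det _).1 hA), Matrix.vecMul_one] at h3
  exact sub_eq_zero.1 h3

variable [Fintype ι]

/-- Finitely many transverse solutions persist for nearby flags. -/
theorem eventually_le_encard_Sol [Nonempty ι] {P : ι → Fin k → Fin n}
    (hP : ∀ l, Function.Injective (P l))
    {H0 : ι → Matrix (Fin n) (Fin n) ℝ} {q : ℕ} (hq : (q : ℕ∞) ≤ (Sol H0 P).encard) :
    ∀ᶠ H in nhds H0, (q : ℕ∞) ≤ (Sol H P).encard := by
  obtain ⟨v, hv, hmem⟩ := (natCast_le_encard_iff _ _).1 hq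
  choose x A hsol hrow using hmem
  obtain ⟨l0⟩ := ‹Nonempty ι›
  obtain ⟨U, hU, hsep⟩ := exists_separating_nhds x
    (fun i => (hsol i).linearIndependent l0 (hP l0))
  have h1 : ∀ i, ∀ᶠ H in nhds H0, ∃ y ∈ U i, ∃ B, IsSol H P y B := by
    intro i
    have hopen : {p : Matrix (Fin k) (Fin n) ℝ × (ι → Matrix (Fin k) (Fin k) ℝ) | p.1 ∈ U i} ∈
        nhds (x i, A i) := continuous_fst.continuousAt.preimage_mem_nhds (hU i)
    have hpivc : Continuous fun q : (Matrix (Fin k) (Fin n) ℝ × (ι → Matrix (Fin k) (Fin k) ℝ)) ×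
        (ι → Matrix (Fin n) (Fin n) ℝ) => fun l => q.1.2 l * q.1.1 * q.2 l := by fun_prop
    have hpiv : ∀ᶠ q in nhds ((x i, A i), H0), ∀ l j,
        (q.1.2 l * q.1.1 * q.2 l) j (P l j) ≠ 0 := by
      rw [Filter.eventually_all]
      intro l
      rw [Filter.eventually_all]
      intro j
      have hc : Continuous fun q : (Matrix (Fin k) (Fin n) ℝ × (ι → Matrix (Fin k) (Fin k) ℝ)) ×
        (ι → Matrix (Fin n) (Fin n) ℝ) => (q.1.2 l * q.1.1 * q.2 l) j (P l j) :=
        Continuous.matrix_elem (by fun_prop) _ _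
      exact hc.continuousAt.eventually_ne ((hsol i).piv l j)
    rw [nhds_prod_eq, Filter.eventually_prod_iff] at hpiv
    obtain ⟨p, hp, p', hp', hpp⟩ := hpiv
    have hreg : RegAt (fun _ _ => False) (fun l j r => P l j < r)
        (fun l => rightMul (H0 l)) (x i) (A i) := by
      intro c0 c
      obtain ⟨x', A', h'⟩ := (hsol i).reg c
      refine ⟨x', A', fun _ _ h => h.elim, fun l j r hr => ?_⟩
      simpa [Matrix.mul_assoc] using h' l j r hr
    have hpers := hreg.persist (f := nhds H0) (fun H l => rightMul (H l))
      (fun l y a r => by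
        have hc : Continuous fun H : ι → Matrix (Fin n) (Fin n) ℝ => (y * H l) a r :=
          Continuous.matrix_elem (by fun_prop) _ _
        exact hc.tendsto H0)
      (fun l j r hr => by simpa [Matrix.mul_assoc] using (hsol i).zero l j r hr)
      (Filter.inter_mem hopen hp)
    filter_upwards [hpers, hp'] with H hH hHp
    obtain ⟨⟨y, B⟩, ⟨hyU, hyp⟩, -, hz, hr⟩ := hH
    refine ⟨y, hyU, B, fun l j r hr' => ?_, fun l j => hpp hyp hHp l j, fun c => ?_⟩
    · simpa [Matrix.mul_assoc] using hz l j r hr'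
    · obtain ⟨x', A', -, h'⟩ := hr 0 c
      exact ⟨x', A', fun l j r hr' => by simpa [Matrix.mul_assoc] using h' l j r hr'⟩
  filter_upwards [Filter.eventually_all.2 h1] with H hH
  choose y hyU B hB using hH
  refine (natCast_le_encard_iff _ _).2 ⟨fun i => rowSp (y i), fun i j hij => ?_,
    fun i => ⟨y i, B i, hB i, rfl⟩⟩
  by_contra hne
  refine hsep i j ?_ _ (hyU i) _ (hyU j) hij
  rw [hrow, hrow]
  exact fun h => hne (hv h)

end SchubertSolutions

section States

variable {k n : ℕ} {ι : Type*}

/-- A frame `u` of a transverse solution of a system of Schubert conditions, whose entries vanish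
outside `Sup` and do not vanish on `NZ`. -/
structure IsState (Sup NZ : Fin k → Fin n → Prop) (G : ι → Matrix (Fin n) (Fin n) ℝ)
    (P : ι → Fin k → Fin n) (u : Matrix (Fin k) (Fin n) ℝ) (A : ι → Matrix (Fin k) (Fin k) ℝ) :
    Prop where
  sup : ∀ m r, ¬ Sup m r → u m r = 0
  nz : ∀ m r, NZ m r → u m r ≠ 0
  zero : ∀ l j r, P l j < r → (A l * u * G l) j r = 0
  piv : ∀ l j, (A l * u * G l) j (P l j) ≠ 0
  reg : RegAt (fun m r => ¬ Sup m r) (fun l j r => P l j < r) (fun l => rightMul (G l)) u A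

theorem diagonal_mul_diagonal_inv {d : Fin k → ℝ} (hd : ∀ m, d m ≠ 0) :
    Matrix.diagonal (fun m => (d m)⁻¹) * Matrix.diagonal d = 1 := by
  rw [Matrix.diagonal_mul_diagonal, ← Matrix.diagonal_one]
  congr 1
  ext m
  exact inv_mul_cancel₀ (hd m)

theorem isUnit_diagonal {d : Fin k → ℝ} (hd : ∀ m, d m ≠ 0) : IsUnit (Matrix.diagonal d) := by
  rw [Matrix.isUnit_diagonal, Pi.isUnit_iff]
  exact fun m => (hd m).isUnit

/-- The rows of the frame of a state can be rescaled. -/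
theorem IsState.rescale {Sup NZ : Fin k → Fin n → Prop} {G : ι → Matrix (Fin n) (Fin n) ℝ}
    {P : ι → Fin k → Fin n} {u : Matrix (Fin k) (Fin n) ℝ} {A : ι → Matrix (Fin k) (Fin k) ℝ}
    (h : IsState Sup NZ G P u A) {d : Fin k → ℝ} (hd : ∀ m, d m ≠ 0) :
    IsState Sup NZ G P (Matrix.diagonal (fun m => (d m)⁻¹) * u)
      (fun l => A l * Matrix.diagonal d) := by
  have e : Matrix.diagonal d * Matrix.diagonal (fun m => (d m)⁻¹) = 1 := by
    have := diagonal_mul_diagonal_inv (d := fun m => (d m)⁻¹) (fun m => inv_ne_zero (hd m))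
    simpa using this
  have key : ∀ l, A l * Matrix.diagonal d * (Matrix.diagonal (fun m => (d m)⁻¹) * u) = A l * u := by
    intro l
    rw [Matrix.mul_assoc, ← Matrix.mul_assoc (Matrix.diagonal d), e, Matrix.one_mul]
  refine ⟨fun m r hr => ?_, fun m r hr => ?_, fun l j r hr => ?_, fun l j => ?_, fun c0 c => ?_⟩
  · rw [Matrix.diagonal_mul, h.sup m r hr, mul_zero]
  · rw [Matrix.diagonal_mul]
    exact mul_ne_zero (inv_ne_zero (hd m)) (h.nz m r hr)
  · rw [key]; exact h.zero l j r hr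
  · rw [key]; exact h.piv l j
  · obtain ⟨x', A', h1, h2⟩ := h.reg (Matrix.diagonal d * c0) c
    refine ⟨Matrix.diagonal (fun m => (d m)⁻¹) * x', fun l => A' l * Matrix.diagonal d,
      fun m r hr => ?_, fun l j r hr => ?_⟩
    · rw [Matrix.diagonal_mul, h1 m r hr, Matrix.diagonal_mul, inv_mul_cancel_left₀ (hd m)]
    · rw [← h2 l j r hr]
      simp only [rightMul_apply]
      simp only [← Matrix.mul_assoc]
      rw [Matrix.mul_assoc (A' l), Matrix.mul_assoc (A l), e, Matrix.mul_one, Matrix.mul_one]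

/-- One entry in every row of the frame can be prescribed without losing regularity. -/
theorem IsState.reg_pivot {Sup NZ : Fin k → Fin n → Prop} {G : ι → Matrix (Fin n) (Fin n) ℝ}
    {P : ι → Fin k → Fin n} {u : Matrix (Fin k) (Fin n) ℝ} {A : ι → Matrix (Fin k) (Fin k) ℝ}
    (h : IsState Sup NZ G P u A) {π : Fin k → Fin n} (hπ : ∀ m, u m (π m) ≠ 0) :
    RegAt (fun m r => ¬ Sup m r ∨ r = π m) (fun l j r => P l j < r)
      (fun l => rightMul (G l)) u A := by
  intro c0 c
  obtain ⟨x', A', h1, h2⟩ := h.reg c0 c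
  let d : Fin k → ℝ := fun m => (c0 m (π m) - x' m (π m)) / u m (π m)
  refine ⟨x' + Matrix.diagonal d * u, fun l => A' l - A l * Matrix.diagonal d, ?_, ?_⟩
  · rintro m r (hr | rfl)
    · rw [Matrix.add_apply, Matrix.diagonal_mul, h.sup m r hr, mul_zero, add_zero, h1 m r hr]
    · rw [Matrix.add_apply, Matrix.diagonal_mul, div_mul_cancel₀ _ (hπ m)]
      ring
  · intro l j r hr
    rw [← h2 l j r hr]
    refine congrFun (congrFun ?_ j) r
    simp only [rightMul_apply]
    simp only [Matrix.sub_mul, Matrix.add_mul, Matrix.mul_add, Matrix.mul_assoc]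
    abel

end States

section Step

variable {k n : ℕ}

/-- The combinatorial data of one step of the deformation: `Same` relates the moved rows lying in a
common chain, `π` gives the pivots, and `y` is the coordinate that is moved. -/
structure IsStep (y : Fin n) (π : Fin k → Fin n) (Same : Fin k → Fin k → Prop)
    (Sup NZ Sup' NZ' : Fin k → Fin n → Prop) : Prop where
  symm : ∀ a b, Same a b → Same b a
  trans : ∀ a b c, Same a b → Same b c → Same a c
  mono : ∀ a b, Same a b → a < b → π a < π b
  le : ∀ a, Same a a → π a ≤ y
  bound : ∀ a x, Same a a → Sup a x → x ≤ y → x ≤ π a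
  fix_y : ∀ a, ¬ Same a a → ¬ Sup a y
  fix_sup : ∀ a x, ¬ Same a a → Sup a x → Sup' a x
  fix_nz : ∀ a x, ¬ Same a a → NZ' a x → NZ a x
  mv_sup : ∀ a x, Same a a → x < π a → Sup' a x
  st_y : ∀ a, Same a a → (∀ b < a, ¬ Same b a) → Sup' a y
  st_sup : ∀ a b x, Same a b → (∀ b < a, ¬ Same b a) → y < x → Sup b x → Sup' a x
  ns_sup : ∀ a b x, Same b a → b < a → y < x → Sup b x → Sup' a x
  st_nz : ∀ a x, Same a a → (∀ b < a, ¬ Same b a) → NZ' a x → x = y ∨ x.val + 1 = (π a).val ∨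
    (y < x ∧ ∃ b, Same a b ∧ NZ b x ∧ ∀ b', Same a b' → Sup b' x → b' = b)
  ns_nz : ∀ a b x, Same b a → b < a → NZ' a x → x.val + 1 = (π a).val

/-- `x` lies in the block of the row `a`. -/
def Blk (y : Fin n) (π : Fin k → Fin n) (Same : Fin k → Fin k → Prop) (a : Fin k) (x : Fin n) :
    Prop :=
  Same a a ∧ π a ≤ x ∧ x ≤ y ∧ ∀ b, a < b → Same a b → x < π b

/-- The perturbed frame. -/
noncomputable def twist (y : Fin n) (π : Fin k → Fin n) (Same : Fin k → Fin k → Prop) (t : ℝ) :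
    Matrix (Fin k) (Fin n) ℝ →ₗ[ℝ] Matrix (Fin k) (Fin n) ℝ where
  toFun u := Matrix.of fun a x => u a x + if Blk y π Same a x then
    (if x = π a then 0 else t ^ (x.val - (π a).val) * u a (π a)) -
      ∑ b, if Same a b ∧ a < b then t ^ ((π b).val - (π a).val) * u b x else 0 else 0
  map_add' u v := by
    ext a x
    simp only [Matrix.of_apply, Matrix.add_apply]
    split_ifs
    · have : ∀ b, (if Same a b ∧ a < b then t ^ ((π b).val - (π a).val) * (u b x + v b x) else 0)
        = (if Same a b ∧ a < b then t ^ ((π b).val - (π a).val) * u b x else 0) +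
          (if Same a b ∧ a < b then t ^ ((π b).val - (π a).val) * v b x else 0) := by
        intro b; split_ifs <;> ring
      simp only [this, Finset.sum_add_distrib]
      ring
    · have : ∀ b, (if Same a b ∧ a < b then t ^ ((π b).val - (π a).val) * (u b x + v b x) else 0)
        = (if Same a b ∧ a < b then t ^ ((π b).val - (π a).val) * u b x else 0) +
          (if Same a b ∧ a < b then t ^ ((π b).val - (π a).val) * v b x else 0) := by
        intro b; split_ifs <;> ring
      simp only [this, Finset.sum_add_distrib]
      ring
    · ring
  map_smul' c u := by
    ext a x
    simp only [Matrix.of_apply, Matrix.smul_apply, smul_eq_mul, RingHom.id_apply]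
    split_ifs
    · rw [mul_add, mul_sub, Finset.mul_sum]
      congr 2
      · ring
      · exact Finset.sum_congr rfl fun b _ => by split_ifs <;> ring
    · rw [mul_add, mul_sub, Finset.mul_sum]
      congr 2
      · ring
      · exact Finset.sum_congr rfl fun b _ => by split_ifs <;> ring
    · ring

theorem twist_apply (y : Fin n) (π : Fin k → Fin n) (Same : Fin k → Fin k → Prop) (t : ℝ)
    (u : Matrix (Fin k) (Fin n) ℝ) (a : Fin k) (x : Fin n) :
    twist y π Same t u a x = u a x + if Blk y π Same a x then
    (if x = π a then 0 else t ^ (x.val - (π a).val) * u a (π a)) -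
      ∑ b, if Same a b ∧ a < b then t ^ ((π b).val - (π a).val) * u b x else 0 else 0 := rfl

theorem twist_of_not_blk {y : Fin n} {π : Fin k → Fin n} {Same : Fin k → Fin k → Prop} (t : ℝ)
    (u : Matrix (Fin k) (Fin n) ℝ) {a : Fin k} {x : Fin n} (h : ¬ Blk y π Same a x) :
    twist y π Same t u a x = u a x := by
  rw [twist_apply, if_neg h, add_zero]

theorem continuous_twist (y : Fin n) (π : Fin k → Fin n) (Same : Fin k → Fin k → Prop) :
    Continuous fun p : ℝ × Matrix (Fin k) (Fin n) ℝ => twist y π Same p.1 p.2 := by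
  refine continuous_matrix fun a x => ?_
  simp only [twist_apply]
  have hu : ∀ a x, Continuous fun p : ℝ × Matrix (Fin k) (Fin n) ℝ => p.2 a x :=
    fun a x => continuous_snd.matrix_elem a x
  have hb : ∀ b, Continuous fun p : ℝ × Matrix (Fin k) (Fin n) ℝ =>
      if Same a b ∧ a < b then p.1 ^ ((π b).val - (π a).val) * p.2 b x else 0 := by
    intro b
    split_ifs <;> fun_prop
  split_ifs <;> fun_prop

theorem twist_zero {y : Fin n} {π : Fin k → Fin n} {Same : Fin k → Fin k → Prop}
    (hmono : ∀ a b, Same a b → a < b → π a < π b) (u : Matrix (Fin k) (Fin n) ℝ) :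
    twist y π Same 0 u = u := by
  ext a x
  rw [twist_apply]
  by_cases hb : Blk y π Same a x
  · have h1 : (∑ b, if Same a b ∧ a < b then (0 : ℝ) ^ ((π b).val - (π a).val) * u b x else 0) =
        0 := by
      refine Finset.sum_eq_zero fun b _ => ?_
      split_ifs with h
      · have := hmono a b h.1 h.2
        rw [Fin.lt_def] at this
        rw [zero_pow (by omega), zero_mul]
      · rfl
    rw [if_pos hb, h1]
    split_ifs with hx
    · simp
    · have := hb.2.1
      have hne : x.val ≠ (π a).val := fun h => hx (Fin.ext h)
      rw [Fin.le_def] at this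
      rw [zero_pow (by omega)]
      simp
  · rw [if_neg hb, add_zero]

/-- The rows of the new frame as combinations of the perturbed ones. -/
noncomputable def chainMat (π : Fin k → Fin n) (Same : Fin k → Fin k → Prop) (t : ℝ) :
    Matrix (Fin k) (Fin k) ℝ :=
  Matrix.of fun a b => if Same a a then
    (if Same a b ∧ ((∀ c < a, ¬ Same c a) ∨ b < a) then t ^ (π b).val else 0)
    else if a = b then 1 else 0

/-- The change of coordinates replacing the basis vector `y` by `∑ x ≤ y, t ^ x * e x`. -/
noncomputable def shearMat (y : Fin n) (t : ℝ) : Matrix (Fin n) (Fin n) ℝ :=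
  Matrix.of fun a x => if a = y then
    (if x < y then -(t ^ x.val / t ^ y.val) else if x = y then 1 / t ^ y.val else 0)
    else if a = x then 1 else 0

theorem mul_shearMat (y : Fin n) (t : ℝ) (w : Matrix (Fin k) (Fin n) ℝ) (a : Fin k) (x : Fin n) :
    (w * shearMat y t) a x = if x < y then w a x - w a y * (t ^ x.val / t ^ y.val) else
      if x = y then w a y / t ^ y.val else w a x := by
  rw [Matrix.mul_apply]
  have h : ∀ b, w a b * shearMat y t b x = (if b = y then w a y *
      (if x < y then -(t ^ x.val / t ^ y.val) else if x = y then 1 / t ^ y.val else 0) else 0) +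
      (if b = x then (if x = y then 0 else w a x) else 0) := by
    intro b
    simp only [shearMat, Matrix.of_apply]
    by_cases h1 : b = y
    · subst h1
      by_cases h2 : b = x
      · subst h2; simp
      · simp [h2]
    · by_cases h2 : b = x
      · subst h2; simp [h1]
      · simp [h1, h2]
  simp only [h, Finset.sum_add_distrib, Finset.sum_ite_eq', Finset.mem_univ, if_true]
  split_ifs with h1 h2 h3
  · exact absurd h2 (ne_of_lt h1)
  · ring
  · ring
  · ring

theorem isUnit_shearMat (y : Fin n) {t : ℝ} (ht : t ≠ 0) : IsUnit (shearMat y t) := by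
  rw [Matrix.isUnit_iff_isUnit_det, isUnit_iff_ne_zero, Matrix.det_of_isLowerTriangular]
  · refine Finset.prod_ne_zero_iff.2 fun a _ => ?_
    simp only [shearMat, Matrix.of_apply]
    split_ifs
    · exact absurd ‹a < y› (by simp [*])
    · positivity
    · exact one_ne_zero
  · intro a b hab
    simp only [OrderDual.toDual_lt_toDual] at hab
    simp only [shearMat, Matrix.of_apply]
    split_ifs with h1 h2 h3 h4
    · subst h1; exact absurd hab (not_lt.2 h2.le)
    · subst h1; exact absurd hab (by simp [h3])
    · rfl
    · subst h4; exact absurd hab (lt_irrefl _)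
    · rfl

variable {y : Fin n} {π : Fin k → Fin n} {Same : Fin k → Fin k → Prop}
  {Sup NZ Sup' NZ' : Fin k → Fin n → Prop}

theorem IsStep.refl_left (h : IsStep y π Same Sup NZ Sup' NZ') {a b : Fin k} (hab : Same a b) :
    Same a a := h.trans _ _ _ hab (h.symm _ _ hab)

theorem IsStep.refl_right (h : IsStep y π Same Sup NZ Sup' NZ') {a b : Fin k} (hab : Same a b) :
    Same b b := h.trans _ _ _ (h.symm _ _ hab) hab

theorem isUnit_chainMat (h : IsStep y π Same Sup NZ Sup' NZ') {t : ℝ} (ht : t ≠ 0) :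
    IsUnit (chainMat π Same t) := by
  rw [← Matrix.mulVec_injective_iff_isUnit]
  intro c c' hcc
  have h0 : Matrix.mulVec (chainMat π Same t) (c - c') = 0 := by
    rw [Matrix.mulVec_sub, sub_eq_zero]; exact hcc
  suffices hz : ∀ a, (c - c') a = 0 from sub_eq_zero.1 (funext hz)
  generalize c - c' = d at h0
  intro a
  induction a using WellFoundedLT.induction with
  | ind a ih =>
    by_cases ha : Same a a
    · have hrow : ∀ e, Same a e → (∀ b, Same a b → ((∀ c < e, ¬ Same c e) ∨ b < e) →
          ¬ b = a → b < a) → ((∀ c < e, ¬ Same c e) ∨ a < e) → d a = 0 := by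
        intro e hae hb hae'
        have := congrFun h0 e
        rw [Matrix.mulVec, dotProduct, Finset.sum_eq_single a] at this
        · simp only [chainMat, Matrix.of_apply, h.refl_right hae, if_true, h.symm _ _ hae,
            true_and, if_pos hae', Pi.zero_apply] at this
          exact (mul_eq_zero.1 this).resolve_left (pow_ne_zero _ ht)
        · intro b _ hba
          simp only [chainMat, Matrix.of_apply, h.refl_right hae, if_true]
          split_ifs with hc
          · rw [ih b (hb b (h.trans _ _ _ hae hc.1) hc.2 hba), mul_zero]
          · rw [zero_mul]
        · simp
      by_cases hlast : ∃ b, a < b ∧ Same a b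
      · have hne : (Finset.univ.filter fun b => a < b ∧ Same a b).Nonempty := by
          obtain ⟨b, hb⟩ := hlast
          exact ⟨b, by simpa using hb⟩
        obtain ⟨e, he, hmin⟩ := Finset.exists_min_image _ id hne
        simp only [Finset.mem_filter, Finset.mem_univ, true_and, id] at he hmin
        refine hrow e he.2 (fun b hb hbe hne => ?_) (Or.inr he.1)
        rcases hbe with hbe | hbe
        · exact absurd he.2 (hbe a he.1)
        · by_contra hnl
          have hab : a < b := lt_of_le_of_ne (not_lt.1 hnl) (Ne.symm hne)
          exact absurd hbe (not_lt.2 (hmin b ⟨hab, hb⟩))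
      · push Not at hlast
        have hne : (Finset.univ.filter fun b => Same a b).Nonempty := ⟨a, by simpa using ha⟩
        obtain ⟨e, he, hmin⟩ := Finset.exists_min_image _ id hne
        simp only [Finset.mem_filter, Finset.mem_univ, true_and, id] at he hmin
        refine hrow e he (fun b hb _ hne => ?_) (Or.inl fun c hce hc => ?_)
        · by_contra hnl
          exact hlast b (lt_of_le_of_ne (not_lt.1 hnl) (Ne.symm hne)) hb
        · exact absurd hce (not_lt.2 (hmin c (h.trans _ _ _ he (h.symm _ _ hc))))
    · have := congrFun h0 a
      simpa [Matrix.mulVec, dotProduct, chainMat, ha] using this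

end Step

section StepSums

variable {k n : ℕ} {y : Fin n} {π : Fin k → Fin n} {Same : Fin k → Fin k → Prop}
  {Sup NZ Sup' NZ' : Fin k → Fin n → Prop}

theorem IsStep.exists_blk (h : IsStep y π Same Sup NZ Sup' NZ') {a : Fin k} {x : Fin n}
    (ha : Same a a) (hx : π a ≤ x) (hxy : x ≤ y) :
    ∃ e, a ≤ e ∧ Same a e ∧ Blk y π Same e x := by
  have hne : (Finset.univ.filter fun b => Same a b ∧ π b ≤ x).Nonempty :=
    ⟨a, by simpa using ⟨ha, hx⟩⟩
  obtain ⟨e, he, hmax⟩ := Finset.exists_max_image _ id hne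
  simp only [Finset.mem_filter, Finset.mem_univ, true_and, id] at he hmax
  refine ⟨e, hmax a ⟨ha, hx⟩, he.1, h.refl_right he.1, he.2, hxy, fun b hb hs => ?_⟩
  by_contra hcon
  exact absurd hb (not_lt.2 (hmax b ⟨h.trans _ _ _ he.1 hs, not_lt.1 hcon⟩))

variable {u : Matrix (Fin k) (Fin n) ℝ} {τ : ℝ} (t : ℝ)

theorem IsStep.twist_eq_zero (h : IsStep y π Same Sup NZ Sup' NZ')
    (hu : ∀ m r, ¬ Sup m r → u m r = 0) {b : Fin k} {x : Fin n} (hb : Same b b) (hx : π b ≤ x)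
    (hxy : x ≤ y) (hn : ¬ Blk y π Same b x) : twist y π Same t u b x = 0 := by
  rw [twist_of_not_blk t u hn]
  apply hu
  intro hs
  have hxe : x = π b := le_antisymm (h.bound b x hb hs hxy) hx
  refine hn ⟨hb, hx, hxy, fun c hc hs' => ?_⟩
  rw [hxe]
  exact h.mono _ _ hs' hc

theorem IsStep.twist_blk (h : IsStep y π Same Sup NZ Sup' NZ')
    (hu : ∀ m r, ¬ Sup m r → u m r = 0) (hτ : ∀ m, u m (π m) = τ) {b : Fin k} {x : Fin n}
    (hb : Blk y π Same b x) : t ^ (π b).val * twist y π Same t u b x =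
      τ * t ^ x.val - ∑ c, if Same b c ∧ b < c then t ^ (π c).val * u c x else 0 := by
  have h1 : t ^ (π b).val * (u b x + if x = π b then 0 else
      t ^ (x.val - (π b).val) * u b (π b)) = τ * t ^ x.val := by
    split_ifs with hx
    · rw [hx, hτ, add_zero, mul_comm]
    · have h0 : u b x = 0 := by
        apply hu
        intro hs
        exact hx (le_antisymm (h.bound b x hb.1 hs hb.2.2.1) hb.2.1)
      have hle := hb.2.1
      rw [Fin.le_def] at hle
      rw [h0, zero_add, ← mul_assoc, ← pow_add, hτ, Nat.add_sub_cancel' hle, mul_comm]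
  have h2 : t ^ (π b).val * (∑ c, if Same b c ∧ b < c then
      t ^ ((π c).val - (π b).val) * u c x else 0) =
      ∑ c, if Same b c ∧ b < c then t ^ (π c).val * u c x else 0 := by
    rw [Finset.mul_sum]
    refine Finset.sum_congr rfl fun c _ => ?_
    split_ifs with hc
    · have hle := (h.mono _ _ hc.1 hc.2).le
      rw [Fin.le_def] at hle
      rw [← mul_assoc, ← pow_add, Nat.add_sub_cancel' hle]
    · rw [mul_zero]
  rw [twist_apply, if_pos hb, ← add_sub_assoc, mul_sub, h1, h2]

/-- The sum of an initial part of a chain that contains the block of `x`. -/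
theorem IsStep.sum_chain (h : IsStep y π Same Sup NZ Sup' NZ')
    (hu : ∀ m r, ¬ Sup m r → u m r = 0) (hτ : ∀ m, u m (π m) = τ) {a e : Fin k} {x : Fin n}
    (hae : Same a e) (he : Blk y π Same e x) (Q : Fin k → Prop) (hQ : ∀ b c, b ≤ c → Q c → Q b)
    (hQe : Q e) :
    (∑ b, if Same a b ∧ Q b then t ^ (π b).val * twist y π Same t u b x else 0) =
      τ * t ^ x.val - ∑ c, if Same a c ∧ ¬ Q c then t ^ (π c).val * u c x else 0 := by
  have hterm : ∀ b, (if Same a b ∧ Q b then t ^ (π b).val * twist y π Same t u b x else 0) =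
      (if b = e then t ^ (π e).val * twist y π Same t u e x else 0) +
      (if Same e b ∧ e < b then t ^ (π b).val * u b x else 0) -
      (if Same a b ∧ ¬ Q b then t ^ (π b).val * u b x else 0) := by
    intro b
    by_cases hab : Same a b
    · have heb : Same e b := h.trans _ _ _ (h.symm _ _ hae) hab
      rcases lt_trichotomy b e with hlt | rfl | hlt
      · have hbx : π b ≤ x := (h.mono _ _ (h.symm _ _ heb) hlt).le.trans he.2.1
        have hz : twist y π Same t u b x = 0 :=
          h.twist_eq_zero t hu (h.refl_right hab) hbx he.2.2.1
            fun hb => absurd he.2.1 (not_le.2 (hb.2.2.2 e hlt (h.symm _ _ heb)))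
        simp [hab, heb, hlt.ne, not_lt.2 hlt.le, hQ b e hlt.le hQe, hz]
      · simp [hab, hQe]
      · have hxb : x < π b := he.2.2.2 b hlt heb
        have hz : twist y π Same t u b x = u b x :=
          twist_of_not_blk t u fun hb => absurd hb.2.1 (not_le.2 hxb)
        by_cases hq : Q b <;> simp [hab, heb, hlt.ne', hlt, hq, hz]
    · have heb : ¬ Same e b := fun hs => hab (h.trans _ _ _ hae hs)
      have hbe : b ≠ e := fun hs => hab (hs ▸ hae)
      simp [hab, heb, hbe]
  rw [Finset.sum_congr rfl fun b _ => hterm b, Finset.sum_sub_distrib, Finset.sum_add_distrib,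
    Finset.sum_ite_eq' Finset.univ e, if_pos (Finset.mem_univ _), h.twist_blk t hu hτ he]
  ring

/-- Rows of the product of `chainMat` with the perturbed frame. -/
theorem chain_start {a : Fin k} (ha : Same a a)
    (hst : ∀ b < a, ¬ Same b a) (w : Matrix (Fin k) (Fin n) ℝ) (x : Fin n) :
    (chainMat π Same t * w) a x =
      ∑ b, if Same a b ∧ True then t ^ (π b).val * w b x else 0 := by
  rw [Matrix.mul_apply]
  refine Finset.sum_congr rfl fun b _ => ?_
  simp only [chainMat, Matrix.of_apply, if_pos ha]
  by_cases hab : Same a b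
  · rw [if_pos ⟨hab, Or.inl hst⟩, if_pos ⟨hab, trivial⟩]
  · rw [if_neg fun hh => hab hh.1, if_neg fun hh => hab hh.1, zero_mul]

theorem IsStep.chain_nonstart (h : IsStep y π Same Sup NZ Sup' NZ') {a c : Fin k} (hca : Same c a)
    (hlt : c < a) (w : Matrix (Fin k) (Fin n) ℝ) (x : Fin n) :
    (chainMat π Same t * w) a x =
      ∑ b, if Same a b ∧ b < a then t ^ (π b).val * w b x else 0 := by
  rw [Matrix.mul_apply]
  refine Finset.sum_congr rfl fun b _ => ?_
  simp only [chainMat, Matrix.of_apply, if_pos (h.refl_right hca)]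
  have hst : ¬ ∀ c < a, ¬ Same c a := fun hh => hh c hlt hca
  simp only [hst, false_or, ite_mul, zero_mul]

theorem chain_fixed {a : Fin k} (ha : ¬ Same a a) (w : Matrix (Fin k) (Fin n) ℝ) (x : Fin n) :
    (chainMat π Same t * w) a x = w a x := by
  rw [Matrix.mul_apply]
  simp [chainMat, ha]

theorem IsStep.start_high (hu : ∀ m r, ¬ Sup m r → u m r = 0) (hτ : ∀ m, u m (π m) = τ)
    (h : IsStep y π Same Sup NZ Sup' NZ') {a : Fin k} (ha : Same a a)
    (hst : ∀ b < a, ¬ Same b a) {x : Fin n} (hx : π a ≤ x) (hxy : x ≤ y) :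
    (chainMat π Same t * twist y π Same t u) a x = τ * t ^ x.val := by
  obtain ⟨e, -, hae, he⟩ := h.exists_blk ha hx hxy
  rw [chain_start t ha hst]
  simpa using h.sum_chain t hu hτ hae he (fun _ => True) (fun _ _ _ h => h) trivial

theorem IsStep.start_low (h : IsStep y π Same Sup NZ Sup' NZ') {a : Fin k} (ha : Same a a)
    (hst : ∀ b < a, ¬ Same b a) {x : Fin n} (hx : x < π a) :
    (chainMat π Same t * twist y π Same t u) a x =
      ∑ b, if Same a b then t ^ (π b).val * u b x else 0 := by
  rw [chain_start t ha hst]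
  refine Finset.sum_congr rfl fun b _ => ?_
  simp only [and_true]
  split_ifs with hab
  · rw [twist_of_not_blk]
    intro hb
    have hle : π a ≤ π b := by
      rcases lt_trichotomy a b with hlt | rfl | hlt
      · exact (h.mono _ _ hab hlt).le
      · exact le_rfl
      · exact absurd (h.symm _ _ hab) (hst b hlt)
    exact absurd (hle.trans hb.2.1) (not_le.2 hx)
  · rfl

theorem IsStep.nonstart_high (hu : ∀ m r, ¬ Sup m r → u m r = 0)
    (h : IsStep y π Same Sup NZ Sup' NZ') {a c : Fin k} (hca : Same c a)
    (hlt : c < a) {x : Fin n} (hx : π a ≤ x) (hxy : x ≤ y) :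
    (chainMat π Same t * twist y π Same t u) a x = 0 := by
  rw [h.chain_nonstart t hca hlt]
  refine Finset.sum_eq_zero fun b _ => ?_
  split_ifs with hb
  · have hba := h.mono _ _ (h.symm _ _ hb.1) hb.2
    rw [h.twist_eq_zero t hu (h.refl_right hb.1) (hba.le.trans hx) hxy, mul_zero]
    exact fun hblk => absurd (hblk.2.2.2 a hb.2 (h.symm _ _ hb.1)) (not_lt.2 hx)
  · rfl

theorem IsStep.nonstart_pivot (hu : ∀ m r, ¬ Sup m r → u m r = 0) (hτ : ∀ m, u m (π m) = τ)
    (h : IsStep y π Same Sup NZ Sup' NZ') {a c : Fin k} (hca : Same c a)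
    (hlt : c < a) {x : Fin n} (hx : x.val + 1 = (π a).val) :
    (chainMat π Same t * twist y π Same t u) a x = τ * t ^ x.val -
      ∑ b, if Same a b ∧ ¬ b < a then t ^ (π b).val * u b x else 0 := by
  have haa := h.refl_right hca
  have hca' := h.mono _ _ hca hlt
  have hay := h.le a haa
  rw [Fin.lt_def] at hca'
  rw [Fin.le_def] at hay
  obtain ⟨e, -, hce, he⟩ := h.exists_blk (h.refl_left hca) (x := x)
    (by rw [Fin.le_def]; omega) (by rw [Fin.le_def]; omega)
  have hea : e < a := by
    by_contra hcon
    have hle : π a ≤ π e := by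
      rcases (not_lt.1 hcon).lt_or_eq with h1 | h1
      · exact (h.mono _ _ (h.trans _ _ _ (h.symm _ _ hca) hce) h1).le
      · rw [h1]
    have := hle.trans he.2.1
    rw [Fin.le_def] at this
    omega
  rw [h.chain_nonstart t hca hlt]
  convert h.sum_chain t hu hτ (h.trans _ _ _ (h.symm _ _ hca) hce) he
    (fun b => b < a) (fun b c hbc hc => lt_of_le_of_lt hbc hc) hea

theorem twist_high {b : Fin k} {x : Fin n} (hx : y < x) : twist y π Same t u b x = u b x :=
  twist_of_not_blk t u fun hb => absurd hb.2.2.1 (not_le.2 hx)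

/-- The new frame has the expected support. -/
theorem IsStep.support (hu : ∀ m r, ¬ Sup m r → u m r = 0) (hτ : ∀ m, u m (π m) = τ)
    (h : IsStep y π Same Sup NZ Sup' NZ') (ht : t ≠ 0) {a : Fin k} {x : Fin n}
    (hx : ¬ Sup' a x) : (chainMat π Same t * twist y π Same t u * shearMat y t) a x = 0 := by
  rw [mul_shearMat]
  by_cases ha : Same a a
  · have hxa : π a ≤ x := by
      by_contra hcon
      exact hx (h.mv_sup a x ha (not_le.1 hcon))
    by_cases hst : ∀ b < a, ¬ Same b a
    · have hxy : x ≠ y := fun hxy => hx (hxy ▸ h.st_y a ha hst)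
      rw [h.start_high t hu hτ ha hst (h.le a ha) le_rfl]
      rcases lt_or_gt_of_ne hxy with hlt | hgt
      · rw [if_pos hlt, h.start_high t hu hτ ha hst hxa hlt.le]
        field_simp
        ring
      · rw [if_neg hgt.not_gt, if_neg hxy, chain_start t ha hst]
        refine Finset.sum_eq_zero fun b _ => ?_
        split_ifs with hb
        · rw [twist_high t hgt, hu b x fun hs => hx (h.st_sup a b x hb.1 hst hgt hs), mul_zero]
        · rfl
    · push Not at hst
      obtain ⟨c, hca, hs⟩ := hst
      rw [h.nonstart_high t hu hs hca (h.le a ha) le_rfl]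
      rcases lt_trichotomy x y with hlt | heq | hgt
      · rw [if_pos hlt, h.nonstart_high t hu hs hca hxa hlt.le]
        ring
      · rw [if_neg (by simp [heq]), if_pos heq, zero_div]
      · rw [if_neg hgt.not_gt, if_neg hgt.ne', h.chain_nonstart t hs hca]
        refine Finset.sum_eq_zero fun b _ => ?_
        split_ifs with hb
        · rw [twist_high t hgt,
            hu b x fun hs' => hx (h.ns_sup a b x (h.symm _ _ hb.1) hb.2 hgt hs'), mul_zero]
        · rfl
  · have hnb : ∀ z, ¬ Blk y π Same a z := fun z hz => ha hz.1
    simp only [chain_fixed t ha, twist_of_not_blk t u (hnb _)]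
    rw [hu a y (h.fix_y a ha), hu a x fun hs => hx (h.fix_sup a x ha hs)]
    simp

end StepSums

section Deform

variable {k n : ℕ} {ι : Type*} {y : Fin n} {π : Fin k → Fin n} {Same : Fin k → Fin k → Prop}
  {Sup NZ Sup' NZ' : Fin k → Fin n → Prop}

/-- The coefficient `∑ t ^ (π c - x) * u c x` over the rows of the chain with pivot beyond `x`. -/
noncomputable def tailSum (π : Fin k → Fin n) (Same : Fin k → Fin k → Prop) (t : ℝ)
    (u : Matrix (Fin k) (Fin n) ℝ) (a : Fin k) (x : Fin n) : ℝ :=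
  ∑ c, if Same a c ∧ x < π c then t ^ ((π c).val - x.val) * u c x else 0

theorem continuous_tailSum (π : Fin k → Fin n) (Same : Fin k → Fin k → Prop) (a : Fin k)
    (x : Fin n) :
    Continuous fun p : ℝ × Matrix (Fin k) (Fin n) ℝ => tailSum π Same p.1 p.2 a x := by
  unfold tailSum
  have hu : ∀ a x, Continuous fun p : ℝ × Matrix (Fin k) (Fin n) ℝ => p.2 a x :=
    fun a x => continuous_snd.matrix_elem a x
  refine continuous_finsetSum _ fun c _ => ?_
  split_ifs <;> fun_prop

theorem tailSum_zero (u : Matrix (Fin k) (Fin n) ℝ) (a : Fin k) (x : Fin n) :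
    tailSum π Same 0 u a x = 0 := by
  refine Finset.sum_eq_zero fun c _ => ?_
  split_ifs with h
  · have := h.2
    rw [Fin.lt_def] at this
    rw [zero_pow (by omega), zero_mul]
  · rfl

theorem pow_mul_tailSum (t : ℝ) (u : Matrix (Fin k) (Fin n) ℝ) (a : Fin k) (x : Fin n) :
    t ^ x.val * tailSum π Same t u a x =
      ∑ c, if Same a c ∧ x < π c then t ^ (π c).val * u c x else 0 := by
  rw [tailSum, Finset.mul_sum]
  refine Finset.sum_congr rfl fun c _ => ?_
  split_ifs with h
  · have := h.2.le
    rw [Fin.le_def] at this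
    rw [← mul_assoc, ← pow_add, Nat.add_sub_cancel' this]
  · rw [mul_zero]

/-- The new frame does not vanish where it should not. -/
theorem IsStep.nonvanishing (h : IsStep y π Same Sup NZ Sup' NZ') {u : Matrix (Fin k) (Fin n) ℝ}
    {t : ℝ} (ht : t ≠ 0) (hu : ∀ m r, ¬ Sup m r → u m r = 0) (hτ : ∀ m, u m (π m) = 1)
    (hnz : ∀ m r, NZ m r → u m r ≠ 0) (hsm : ∀ a x, |tailSum π Same t u a x| < 1)
    {a : Fin k} {x : Fin n} (hx : NZ' a x) :
    (chainMat π Same t * twist y π Same t u * shearMat y t) a x ≠ 0 := by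
  rw [mul_shearMat]
  have htx : ∀ z : ℕ, t ^ z ≠ 0 := fun z => pow_ne_zero _ ht
  by_cases ha : Same a a
  · by_cases hst : ∀ b < a, ¬ Same b a
    · have hyy := h.start_high t hu hτ ha hst (h.le a ha) le_rfl
      rcases h.st_nz a x ha hst hx with rfl | hxp | ⟨hyx, b, hab, hb, hun⟩
      · rw [if_neg (lt_irrefl _), if_pos rfl, hyy, one_mul, div_self (htx _)]
        exact one_ne_zero
      · have hxy : x < y := by
          have := h.le a ha
          rw [Fin.le_def] at this
          rw [Fin.lt_def]; omega
        have hxa : x < π a := by rw [Fin.lt_def]; omega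
        rw [if_pos hxy, hyy, h.start_low t ha hst hxa]
        have e : (∑ b, if Same a b then t ^ (π b).val * u b x else 0) =
            t ^ x.val * tailSum π Same t u a x := by
          rw [pow_mul_tailSum]
          refine Finset.sum_congr rfl fun b _ => ?_
          by_cases hab : Same a b
          · have hle : π a ≤ π b := by
              rcases lt_trichotomy a b with hlt | rfl | hlt
              · exact (h.mono _ _ hab hlt).le
              · exact le_rfl
              · exact absurd (h.symm _ _ hab) (hst b hlt)
            rw [if_pos hab, if_pos ⟨hab, hxa.trans_le hle⟩]
          · rw [if_neg hab, if_neg fun hh => hab hh.1]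
        rw [e, one_mul, mul_div_cancel₀ _ (htx _)]
        intro h0
        have h1 : t ^ x.val * (tailSum π Same t u a x - 1) = 0 := by linear_combination h0
        have h2 := (mul_eq_zero.1 h1).resolve_left (htx _)
        have h3 := (abs_lt.1 (hsm a x)).2
        linarith
      · rw [if_neg hyx.not_gt, if_neg hyx.ne', chain_start t ha hst, Finset.sum_eq_single b]
        · rw [if_pos ⟨hab, trivial⟩, twist_high t hyx]
          exact mul_ne_zero (htx _) (hnz b x hb)
        · intro b' _ hb'
          split_ifs with hab'
          · rw [twist_high t hyx, hu b' x fun hs => hb' (hun b' hab'.1 hs), mul_zero]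
          · rfl
        · simp
    · push Not at hst
      obtain ⟨c, hca, hs⟩ := hst
      have hxp := h.ns_nz a c x hs hca hx
      have hle := h.le a ha
      rw [Fin.le_def] at hle
      have hxy : x < y := by rw [Fin.lt_def]; omega
      rw [if_pos hxy, h.nonstart_high t hu hs hca (h.le a ha) le_rfl,
        h.nonstart_pivot t hu hτ hs hca hxp]
      have e : (∑ b, if Same a b ∧ ¬ b < a then t ^ (π b).val * u b x else 0) =
          t ^ x.val * tailSum π Same t u a x := by
        rw [pow_mul_tailSum]
        refine Finset.sum_congr rfl fun b _ => ?_
        by_cases hab : Same a b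
        · have hiff : ¬ b < a ↔ x < π b := by
            rw [Fin.lt_def (b := π b)]
            rcases lt_trichotomy a b with hlt | rfl | hlt
            · have := h.mono _ _ hab hlt
              rw [Fin.lt_def] at this
              simp only [not_lt.2 hlt.le, not_false_eq_true, true_iff]; omega
            · simp only [lt_irrefl, not_false_eq_true, true_iff]; omega
            · have := h.mono _ _ (h.symm _ _ hab) hlt
              rw [Fin.lt_def] at this
              simp only [hlt, not_true_eq_false, false_iff]; omega
          simp only [hab, true_and, hiff]
        · rw [if_neg fun hh => hab hh.1, if_neg fun hh => hab hh.1]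
      rw [e]
      intro h0
      have h1 : t ^ x.val * (1 - tailSum π Same t u a x) = 0 := by linear_combination h0
      have h2 := (mul_eq_zero.1 h1).resolve_left (htx _)
      have h3 := (abs_lt.1 (hsm a x)).2
      linarith
  · have hnb : ∀ z, ¬ Blk y π Same a z := fun z hz => ha hz.1
    simp only [chain_fixed t ha, twist_of_not_blk t u (hnb _)]
    have hy := hu a y (h.fix_y a ha)
    have hn := hnz a x (h.fix_nz a x ha hx)
    have hxy : x ≠ y := fun hxy => hn (hxy ▸ hy)
    rw [hy, if_neg hxy]
    simpa using hn

/-- One step of the deformation, for small positive values of the parameter. -/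
theorem IsStep.deform [Fintype ι] (h : IsStep y π Same Sup NZ Sup' NZ')
    {G : ι → Matrix (Fin n) (Fin n) ℝ} {P : ι → Fin k → Fin n}
    {u0 : Matrix (Fin k) (Fin n) ℝ} {A0 : ι → Matrix (Fin k) (Fin k) ℝ}
    (hs : IsState Sup NZ G P u0 A0) (hπ : ∀ m, u0 m (π m) = 1)
    {U : Set (Matrix (Fin k) (Fin n) ℝ)} (hU : U ∈ nhds u0) :
    ∀ᶠ t in nhdsWithin (0 : ℝ) (Set.Ioi 0), ∃ w ∈ U, ∃ v A',
      IsState Sup' NZ' (fun l => (shearMat y t)⁻¹ * G l) P v A' ∧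
      rowSp v = rowSp (w * shearMat y t) := by
  have hreg := hs.reg_pivot (π := π) fun m => by rw [hπ m]; exact one_ne_zero
  have hct := continuous_twist y π Same
  have htu : Continuous fun p : ℝ × (Matrix (Fin k) (Fin n) ℝ × (ι → Matrix (Fin k) (Fin k) ℝ)) =>
      twist y π Same p.1 p.2.1 :=
        hct.comp (continuous_fst.prodMk (continuous_fst.comp continuous_snd))
  let p0 : ℝ × (Matrix (Fin k) (Fin n) ℝ × (ι → Matrix (Fin k) (Fin k) ℝ)) := (0, (u0, A0))
  have htw0 : twist y π Same p0.1 p0.2.1 = u0 := twist_zero h.mono u0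
  have e1 : ∀ᶠ p in nhds p0, twist y π Same p.1 p.2.1 ∈ U :=
    htu.continuousAt.eventually_mem (by rw [htw0]; exact hU)
  have e2 : ∀ᶠ p in nhds p0, ∀ l j,
      (p.2.2 l * twist y π Same p.1 p.2.1 * G l) j (P l j) ≠ 0 := by
    refine Filter.eventually_all.2 fun l => Filter.eventually_all.2 fun j => ?_
    have hA : Continuous fun p : ℝ × (Matrix (Fin k) (Fin n) ℝ ×
        (ι → Matrix (Fin k) (Fin k) ℝ)) => p.2.2 l :=
      (continuous_apply l).comp (continuous_snd.comp continuous_snd)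
    have hc := (((hA.matrix_mul htu).matrix_mul
      (continuous_const (y := G l))).matrix_elem j (P l j)).continuousAt (x := p0)
    refine hc.eventually_ne ?_
    rw [htw0]
    exact hs.piv l j
  have e3 : ∀ᶠ p in nhds p0, ∀ m r, NZ m r → p.2.1 m r ≠ 0 := by
    refine Filter.eventually_all.2 fun m => Filter.eventually_all.2 fun r => ?_
    by_cases hmr : NZ m r
    · have hA : Continuous fun p : ℝ × (Matrix (Fin k) (Fin n) ℝ ×
        (ι → Matrix (Fin k) (Fin k) ℝ)) => p.2.1 m r :=
        (continuous_fst.comp continuous_snd).matrix_elem m r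
      filter_upwards [hA.continuousAt.eventually_ne (hs.nz m r hmr)] with p hp _ using hp
    · exact Filter.Eventually.of_forall fun p hh => absurd hh hmr
  have e4 : ∀ᶠ p in nhds p0, ∀ a x, |tailSum π Same p.1 p.2.1 a x| < 1 := by
    refine Filter.eventually_all.2 fun a => Filter.eventually_all.2 fun x => ?_
    have hA : Continuous fun p : ℝ × (Matrix (Fin k) (Fin n) ℝ ×
        (ι → Matrix (Fin k) (Fin k) ℝ)) => |tailSum π Same p.1 p.2.1 a x| :=
      ((continuous_tailSum π Same a x).comp
        (continuous_fst.prodMk (continuous_fst.comp continuous_snd))).abs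
    refine hA.continuousAt.eventually_lt_const ?_
    simp [p0, tailSum_zero]
  have eall := (e1.and (e2.and (e3.and e4)))
  rw [nhds_prod_eq, Filter.eventually_prod_iff] at eall
  obtain ⟨pa, hpa, pb, hpb, hall⟩ := eall
  have hper := RegAt.persist (f := nhdsWithin (0 : ℝ) (Set.Ioi 0))
    (fun t l => rightMul (G l) ∘ₗ twist y π Same t) (Ψ0 := fun l => rightMul (G l))
    (fun l x i r => by
      have hc : Continuous fun t : ℝ => (twist y π Same t x * G l) i r :=
        ((hct.comp (continuous_id.prodMk continuous_const)).matrix_mul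
          continuous_const).matrix_elem i r
      have := (hc.tendsto 0).mono_left (nhdsWithin_le_nhds (s := Set.Ioi 0))
      rw [twist_zero h.mono] at this
      exact this) hreg (fun l j r hr => by
        rw [rightMul_apply, ← Matrix.mul_assoc]; exact hs.zero l j r hr) hpb
  filter_upwards [hper, nhdsWithin_le_nhds hpa, self_mem_nhdsWithin] with t hpt hat ht0
  obtain ⟨⟨u, A⟩, hp, hfix, hzero, hr⟩ := hpt
  obtain ⟨h1, h2, h3, h4⟩ := hall hat hp
  simp only at h1 h2 h3 h4 hfix hzero hr
  have ht : t ≠ 0 := ne_of_gt ht0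
  have hC := (Matrix.isUnit_iff_isUnit_det _).1 (isUnit_chainMat h ht)
  have hS := (Matrix.isUnit_iff_isUnit_det _).1 (isUnit_shearMat y ht)
  have hu : ∀ m r, ¬ Sup m r → u m r = 0 := fun m r hmr => by
    rw [hfix m r (Or.inl hmr), hs.sup m r hmr]
  have hτ : ∀ m, u m (π m) = 1 := fun m => by rw [hfix m _ (Or.inr rfl), hπ m]
  have key : ∀ l (B : Matrix (Fin k) (Fin k) ℝ) (w : Matrix (Fin k) (Fin n) ℝ),
      B * (chainMat π Same t)⁻¹ * (chainMat π Same t * w * shearMat y t) *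
        ((shearMat y t)⁻¹ * G l) = B * w * G l := by
    intro l B w
    simp only [Matrix.mul_assoc]
    rw [Matrix.mul_nonsing_inv_cancel_left _ _ hS, Matrix.nonsing_inv_mul_cancel_left _ _ hC]
  refine ⟨_, h1, chainMat π Same t * twist y π Same t u * shearMat y t,
    fun l => A l * (chainMat π Same t)⁻¹, ⟨fun m r hmr => h.support t hu hτ ht hmr,
      fun m r hmr => h.nonvanishing ht hu hτ h3 h4 hmr, fun l j r hlr => ?_, fun l j => ?_, ?_⟩, ?_⟩
  · rw [key]
    have := hzero l j r hlr
    rwa [LinearMap.comp_apply, rightMul_apply, ← Matrix.mul_assoc] at this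
  · rw [key]
    exact h2 l j
  · intro c0 c
    obtain ⟨x', A', hx', hA'⟩ := hr 0 fun l =>
      c l - A l * (chainMat π Same t)⁻¹ * c0 * ((shearMat y t)⁻¹ * G l)
    have hx0 : ∀ m r, ¬ Sup m r → x' m r = 0 := fun m r hmr => hx' m r (Or.inl hmr)
    have hx1 : ∀ m, x' m (π m) = 0 := fun m => hx' m _ (Or.inr rfl)
    refine ⟨c0 + chainMat π Same t * twist y π Same t x' * shearMat y t,
      fun l => A' l * (chainMat π Same t)⁻¹, fun m r hmr => ?_, fun l j r hlr => ?_⟩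
    · rw [Matrix.add_apply, h.support t hx0 hx1 ht hmr, add_zero]
    · have h5 := hA' l j r hlr
      simp only [LinearMap.comp_apply, rightMul_apply, ← Matrix.mul_assoc] at h5
      have h6 := key l (A' l) (twist y π Same t u)
      have h7 := key l (A l) (twist y π Same t x')
      simp only [rightMul_apply, Matrix.mul_add, Matrix.add_mul, ← Matrix.mul_assoc] at h5 h6 h7 ⊢
      rw [h6, h7]
      simp only [Matrix.add_apply, Matrix.sub_apply] at h5 ⊢
      linarith
  · rw [Matrix.mul_assoc, rowSp_mul (isUnit_chainMat h ht)]

end Deform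

section Pattern

/-- Triangular patterns, recording the times at which the labels pass between the rows. -/
structure IsPattern (n k : ℕ) (T : ℕ → ℕ → ℕ) : Prop where
  weak : ∀ r m, r ≤ m → m < k → T r m ≤ T r (m + 1)
  strict : ∀ r m, r ≤ m → m < k → r + 1 < k → T (r + 1) (m + 1) < T r m
  lt : ∀ r m, r < k → r ≤ m → m ≤ k → T r m < n
  sum_le : ∀ r m, r ≤ m → m + 1 < k →
    ∑ q ∈ Finset.Ico r (m + 1), ((T (q + 1) (m + 1) : ℤ) + T q (m + 1)) ≤
      ∑ q ∈ Finset.Ico r (m + 1), ((T (q + 1) (m + 2) : ℤ) + T q m)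

/-- The number of times before `Y` at which the row `m` moves. -/
def moveCount (T : ℕ → ℕ → ℕ) (m Y : ℕ) : ℕ :=
  ∑ r ∈ Finset.range (m + 1), (min Y (T r (m + 1) + 1) - min Y (T r m))

/-- The row `m` moves at time `y`, with label `r`. -/
def MovesWith (T : ℕ → ℕ → ℕ) (y r m : ℕ) : Prop :=
  r ≤ m ∧ T r m ≤ y ∧ y ≤ T r (m + 1)

/-- The row `m` carries the label `r` at time `Y`. -/
def Labelled (T : ℕ → ℕ → ℕ) (Y r m : ℕ) : Prop :=
  r ≤ m ∧ (T r m < Y ∨ r = m) ∧ Y ≤ T r (m + 1)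

/-- The leading coordinate of the row `m` at time `Y`. -/
def leadPos (T : ℕ → ℕ → ℕ) (Y m : ℕ) : ℕ :=
  if Y ≤ T m m then T m m else moveCount T m Y - 1

/-- The coordinates that may occur in the row `m` at time `Y`. -/
def SupAt (T : ℕ → ℕ → ℕ) (n k Y : ℕ) (m : Fin k) (x : Fin n) : Prop :=
  x.val < moveCount T m Y ∨ ∃ r, Labelled T Y r m ∧ Y ≤ x.val ∧ T r r ≤ x.val ∧ x.val ≤ T r k

/-- The coordinates that must occur in the row `m` at time `Y`. -/
def NZAt (T : ℕ → ℕ → ℕ) (n k Y : ℕ) (m : Fin k) (x : Fin n) : Prop :=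
  x.val = leadPos T Y m ∨ ∃ r, Labelled T Y r m ∧ x.val = T r k

variable {n k : ℕ} {T : ℕ → ℕ → ℕ}

theorem IsPattern.mono (h : IsPattern n k T) {r m m' : ℕ} (hr : r ≤ m) (hm : m ≤ m') (hk : m' ≤ k) :
    T r m ≤ T r m' := by
  induction m', hm using Nat.le_induction with
  | base => exact le_rfl
  | succ q hq ih => exact (ih (by omega)).trans (h.weak r q (by omega) (by omega))

theorem IsPattern.strict_lt (h : IsPattern n k T) {r r' m : ℕ} (hr : r < r') (hm : r' ≤ m)
    (hk : m < k) : T r' (m + 1) < T r m := by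
  induction r', hr using Nat.le_induction with
  | base => exact h.strict r m (by omega) hk (by omega)
  | succ q hq ih =>
    have h1 := h.strict q m (by omega) hk (by omega)
    have h2 := h.weak q m (by omega) hk
    have := ih (by omega)
    omega

theorem IsPattern.diag_lt (h : IsPattern n k T) {m m' : ℕ} (hm : m < m') (hk : m' < k) :
    T m' m' < T m m := by
  induction m', hm using Nat.le_induction with
  | base => exact h.strict m m le_rfl (by omega) (by omega)
  | succ q hq ih =>
    have h1 := h.strict q q le_rfl (by omega) (by omega)
    have := ih (by omega)
    omega

theorem IsPattern.diag_le (h : IsPattern n k T) {r m : ℕ} (hr : r ≤ m) (hk : m < k) :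
    T m m ≤ T r m := by
  rcases hr.lt_or_eq with hlt | rfl
  · have := h.strict_lt hlt le_rfl hk
    have := h.weak m m le_rfl hk
    omega
  · exact le_rfl

theorem MovesWith.unique (h : IsPattern n k T) {y r r' m : ℕ} (hk : m < k)
    (h1 : MovesWith T y r m) (h2 : MovesWith T y r' m) : r = r' := by
  obtain ⟨a1, b1, c1⟩ := h1
  obtain ⟨a2, b2, c2⟩ := h2
  rcases lt_trichotomy r r' with hlt | heq | hlt
  · have := h.strict_lt hlt a2 hk
    omega
  · exact heq
  · have := h.strict_lt hlt a1 hk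
    omega

theorem moveCount_zero (m : ℕ) : moveCount T m 0 = 0 := by
  simp [moveCount]

theorem IsPattern.moveCount_succ_of_moves (h : IsPattern n k T) {y r m : ℕ} (hk : m < k)
    (hr : MovesWith T y r m) : moveCount T m (y + 1) = moveCount T m y + 1 := by
  have e : ∀ q ∈ Finset.range (m + 1), min (y + 1) (T q (m + 1) + 1) - min (y + 1) (T q m) =
      (min y (T q (m + 1) + 1) - min y (T q m)) + if q = r then 1 else 0 := by
    intro q hq
    have hqm : q ≤ m := by simpa [Nat.lt_succ_iff] using hq
    have hw := h.weak q m hqm hk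
    split_ifs with hqr
    · subst hqr
      have := hr.2
      omega
    · have : ¬ (T q m ≤ y ∧ y ≤ T q (m + 1)) := fun hc =>
        hqr (MovesWith.unique h hk ⟨hqm, hc.1, hc.2⟩ hr)
      omega
  rw [moveCount, Finset.sum_congr rfl e, Finset.sum_add_distrib, ← moveCount,
    Finset.sum_ite_eq', if_pos (by have := hr.1; simp; omega)]

theorem IsPattern.moveCount_succ_of_not (h : IsPattern n k T) {y m : ℕ} (hk : m < k)
    (hr : ∀ r, ¬ MovesWith T y r m) : moveCount T m (y + 1) = moveCount T m y := by
  refine Finset.sum_congr rfl fun q hq => ?_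
  have hqm : q ≤ m := by simpa [Nat.lt_succ_iff] using hq
  have hw := h.weak q m hqm hk
  have : ¬ (T q m ≤ y ∧ y ≤ T q (m + 1)) := fun hc => hr q ⟨hqm, hc.1, hc.2⟩
  omega

theorem IsPattern.moveCount_le (h : IsPattern n k T) {m : ℕ} (hk : m < k) (Y : ℕ) :
    moveCount T m Y ≤ Y := by
  induction Y with
  | zero => simp [moveCount_zero]
  | succ y ih =>
    by_cases hc : ∃ r, MovesWith T y r m
    · obtain ⟨r, hr⟩ := hc
      rw [h.moveCount_succ_of_moves hk hr]; omega
    · rw [h.moveCount_succ_of_not hk (not_exists.1 hc)]; omega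

theorem moveCount_mono {m Y Y' : ℕ} (h : IsPattern n k T) (hk : m < k) (hY : Y ≤ Y') :
    moveCount T m Y ≤ moveCount T m Y' := by
  induction Y', hY using Nat.le_induction with
  | base => exact le_rfl
  | succ q hq ih =>
    by_cases hc : ∃ r, MovesWith T q r m
    · obtain ⟨r, hr⟩ := hc
      rw [h.moveCount_succ_of_moves hk hr]; omega
    · rw [h.moveCount_succ_of_not hk (not_exists.1 hc)]; omega

theorem IsPattern.moveCount_eq_zero (h : IsPattern n k T) {m Y : ℕ} (hk : m < k) (hY : Y ≤ T m m) :
    moveCount T m Y = 0 := by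
  refine Finset.sum_eq_zero fun q hq => ?_
  have hqm : q ≤ m := by simpa [Nat.lt_succ_iff] using hq
  have := h.diag_le hqm hk
  omega

theorem IsPattern.moveCount_pos (h : IsPattern n k T) {m Y : ℕ} (hk : m < k) (hY : T m m < Y) :
    0 < moveCount T m Y := by
  have h1 := h.moveCount_succ_of_moves (y := T m m) hk ⟨le_rfl, le_rfl, h.weak m m le_rfl hk⟩
  have := moveCount_mono h hk (Nat.succ_le_of_lt hY)
  rw [Nat.succ_eq_add_one] at this
  omega

theorem IsPattern.moveCount_lt_succ (h : IsPattern n k T) {m Y : ℕ} (hk : m + 1 < k)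
    (hY : T m m < Y) : moveCount T m Y < moveCount T (m + 1) Y := by
  have hex : ∃ r, T r m < Y := ⟨m, hY⟩
  obtain ⟨r, hr, hmin⟩ : ∃ r, T r m < Y ∧ ∀ q < r, ¬ T q m < Y :=
    ⟨Nat.find hex, Nat.find_spec hex, fun q hq => Nat.find_min hex hq⟩
  have hrm : r ≤ m := by
    by_contra hcon
    exact hmin m (not_le.1 hcon) hY
  let f : ℕ → ℤ := fun q => (min Y (T q (m + 1) + 1) : ℤ) - min Y (T q m)
  let g : ℕ → ℤ := fun q => (min Y (T q (m + 2) + 1) : ℤ) - min Y (T q (m + 1))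
  have e1 : (moveCount T m Y : ℤ) = ∑ q ∈ Finset.Ico r (m + 1), f q := by
    have hz : ∑ q ∈ Finset.range r, f q = 0 := by
      refine Finset.sum_eq_zero fun q hq => ?_
      have h1 := hmin q (Finset.mem_range.1 hq)
      have h2 := h.weak q m (by have := Finset.mem_range.1 hq; omega) (by omega)
      simp only [f]
      omega
    have hc : (moveCount T m Y : ℤ) = ∑ q ∈ Finset.range (m + 1), f q := by
      rw [moveCount, Nat.cast_sum]
      refine Finset.sum_congr rfl fun q hq => ?_
      have hqm : q ≤ m := by simpa [Nat.lt_succ_iff] using hq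
      have := h.weak q m hqm (by omega)
      simp only [f]
      omega
    rw [hc, ← Finset.sum_range_add_sum_Ico f (show r ≤ m + 1 by omega), hz, zero_add]
  have e2 : g r + ∑ q ∈ Finset.Ico r (m + 1), g (q + 1) ≤ (moveCount T (m + 1) Y : ℤ) := by
    have hc : (moveCount T (m + 1) Y : ℤ) = ∑ q ∈ Finset.range (m + 2), g q := by
      rw [moveCount, Nat.cast_sum]
      refine Finset.sum_congr rfl fun q hq => ?_
      have hqm : q ≤ m + 1 := by simpa [Nat.lt_succ_iff] using hq
      have : T q (m + 1) ≤ T q (m + 2) := h.weak q (m + 1) hqm (by omega)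
      simp only [g, add_assoc, Nat.reduceAdd]
      omega
    have hnn : 0 ≤ ∑ q ∈ Finset.range r, g q := by
      refine Finset.sum_nonneg fun q hq => ?_
      have : T q (m + 1) ≤ T q (m + 2) :=
        h.weak q (m + 1) (by have := Finset.mem_range.1 hq; omega) (by omega)
      simp only [g]
      omega
    rw [hc, ← Finset.sum_range_add_sum_Ico g (show r ≤ m + 2 by omega),
      Finset.sum_eq_sum_Ico_succ_bot (show r < m + 2 by omega),
      ← Finset.sum_Ico_add' g r (m + 1) 1]
    linarith
  have hsum := h.sum_le r m hrm hk
  rw [Finset.sum_eq_sum_Ico_succ_bot (show r < m + 1 by omega),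
    Finset.sum_eq_sum_Ico_succ_bot (show r < m + 1 by omega)] at hsum
  rw [Finset.sum_eq_sum_Ico_succ_bot (show r < m + 1 by omega)] at e1 e2
  have e3 : ∑ q ∈ Finset.Ico (r + 1) (m + 1), f q - ∑ q ∈ Finset.Ico (r + 1) (m + 1), g (q + 1) =
      ∑ q ∈ Finset.Ico (r + 1) (m + 1), ((T (q + 1) (m + 1) : ℤ) + T q (m + 1)) -
      ∑ q ∈ Finset.Ico (r + 1) (m + 1), ((T (q + 1) (m + 2) : ℤ) + T q m) := by
    rw [← Finset.sum_sub_distrib, ← Finset.sum_sub_distrib]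
    refine Finset.sum_congr rfl fun q hq => ?_
    rw [Finset.mem_Ico] at hq
    have h1 := h.strict_lt (r := r) (r' := q) (m := m) (by omega) (by omega) (by omega)
    have h2 : T (q + 1) (m + 2) < T q (m + 1) := h.strict q (m + 1) (by omega) (by omega) (by omega)
    have h3 := h.strict q m (by omega) (by omega) (by omega)
    have h4 := h.weak q m (by omega) (by omega)
    have h5 : T (q + 1) (m + 1) ≤ T (q + 1) (m + 2) := h.weak (q + 1) (m + 1) (by omega) (by omega)
    simp only [f, g]
    omega
  have h1 : T (r + 1) (m + 2) < T r (m + 1) := h.strict r (m + 1) (by omega) (by omega) (by omega)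
  have h2 : T r (m + 1) ≤ T r (m + 2) := h.weak r (m + 1) (by omega) (by omega)
  have h3 := h.weak r m (by omega) (by omega)
  have h4 := h.strict r m (by omega) (by omega) (by omega)
  have h5 : T (r + 1) (m + 1) ≤ T (r + 1) (m + 2) := h.weak (r + 1) (m + 1) (by omega) (by omega)
  have hfg : f r - g r - g (r + 1) < ((T (r + 1) (m + 1) : ℤ) + T r (m + 1)) -
      ((T (r + 1) (m + 2) : ℤ) + T r m) := by
    simp only [f, g]
    omega
  have : (moveCount T m Y : ℤ) < moveCount T (m + 1) Y := by linarith
  exact_mod_cast this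

theorem IsPattern.moveCount_lt (h : IsPattern n k T) {m m' Y : ℕ} (hm : m < m') (hk : m' < k)
    (hY : T m m < Y) : moveCount T m Y < moveCount T m' Y := by
  induction m', hm using Nat.le_induction with
  | base => exact h.moveCount_lt_succ hk hY
  | succ q hq ih =>
    refine (ih (by omega)).trans (h.moveCount_lt_succ hk ?_)
    exact (h.diag_lt (show m < q by omega) (by omega)).trans hY

theorem IsPattern.leadPos_lt (h : IsPattern n k T) {m Y : ℕ} (hk : m < k) (hY : Y ≤ n) :
    leadPos T Y m < n := by
  have h1 := h.lt m m hk le_rfl hk.le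
  have h2 := h.moveCount_le hk Y
  rw [leadPos]
  split_ifs <;> omega

theorem IsPattern.leadPos_injective (h : IsPattern n k T) {m m' Y : ℕ} (hk : m < k) (hk' : m' < k)
    (he : leadPos T Y m = leadPos T Y m') : m = m' := by
  wlog hlt : m < m' generalizing m m'
  · rcases lt_trichotomy m m' with h1 | h1 | h1
    · exact absurd h1 hlt
    · exact h1
    · exact (this hk' hk he.symm h1).symm
  exfalso
  have h1 := h.diag_lt hlt hk'
  have h2 := h.moveCount_le hk Y
  have h2' := h.moveCount_le hk' Y
  simp only [leadPos] at he
  split_ifs at he with ha hb hb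
  · omega
  · have := h.moveCount_pos hk' (not_le.1 hb)
    omega
  · omega
  · have := h.moveCount_pos hk (not_le.1 ha)
    have := h.moveCount_lt hlt hk' (not_le.1 ha)
    omega

end Pattern

section PatternStep

variable {n k : ℕ} {T : ℕ → ℕ → ℕ}

/-- The leading coordinates at time `Y`. -/
def IsPattern.lead (h : IsPattern n k T) (Y : ℕ) (hY : Y ≤ n) (m : Fin k) : Fin n :=
  ⟨leadPos T Y m, h.leadPos_lt m.2 hY⟩

/-- The rows `a` and `b` move at time `y` with the same label. -/
def SameMove (T : ℕ → ℕ → ℕ) (k y : ℕ) (a b : Fin k) : Prop :=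
  ∃ r, MovesWith T y r a ∧ MovesWith T y r b

theorem MovesWith.diag_le (h : IsPattern n k T) {y r m : ℕ} (hk : m < k) (hr : MovesWith T y r m) :
    T m m ≤ y := (h.diag_le hr.1 hk).trans hr.2.1

theorem MovesWith.leadPos_succ (h : IsPattern n k T) {y r m : ℕ} (hk : m < k)
    (hr : MovesWith T y r m) : leadPos T (y + 1) m = moveCount T m y := by
  have := hr.diag_le h hk
  rw [leadPos, if_neg (by omega), h.moveCount_succ_of_moves hk hr, Nat.add_sub_cancel]

theorem Labelled.movesWith {y r m : ℕ} (hl : Labelled T (y + 1) r m) (hy : T m m ≤ y) :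
    MovesWith T y r m := by
  obtain ⟨h1, h2, h3⟩ := hl
  refine ⟨h1, ?_, by omega⟩
  rcases h2 with h2 | rfl
  · omega
  · exact hy

/-- A moving row that is not the last one in its chain passes its label on. -/
theorem MovesWith.eq_of_lt (h : IsPattern n k T) {y r a b : ℕ} (hb : b < k) (hab : a < b)
    (ha : MovesWith T y r a) (hr : MovesWith T y r b) : T r (a + 1) = y ∧ T r b = y := by
  have h1 := h.mono (show r ≤ a + 1 by have := ha.1; omega) (show a + 1 ≤ b by omega) hb.le
  have := ha.2.2
  have := hr.2.1
  omega

/-- The first row of a chain carries its label also after the move. -/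
theorem MovesWith.labelled (h : IsPattern n k T) {y r a : ℕ} (ha : a < k) (hr : MovesWith T y r a)
    (hst : ∀ b < a, ¬ MovesWith T y r b) : Labelled T y r a := by
  refine ⟨hr.1, ?_, hr.2.2⟩
  rcases hr.1.lt_or_eq with hlt | heq
  · left
    by_contra hcon
    obtain ⟨a, rfl⟩ : ∃ a', a = a' + 1 := ⟨a - 1, by omega⟩
    have h1 := h.weak r a (by omega) (by omega)
    have := hr.2.1
    exact hst a (by omega) ⟨by omega, by omega, by omega⟩
  · right; exact heq

theorem Labelled.unique_of_moves (h : IsPattern n k T) {y r r' a : ℕ} (ha : a < k)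
    (hr : MovesWith T y r a) (hl : Labelled T (y + 1) r' a) : r' = r :=
  (hl.movesWith (hr.diag_le h ha)).unique h ha hr

theorem MovesWith.exists_last (h : IsPattern n k T) {y r a : ℕ} (ha : a < k)
    (hr : MovesWith T y r a) (hy : y < T r k) :
    ∃ b, a ≤ b ∧ b < k ∧ MovesWith T y r b ∧ y < T r (b + 1) := by
  by_contra! hcon
  have key : ∀ b, a ≤ b → b < k → MovesWith T y r b := by
    intro b hb
    induction b, hb using Nat.le_induction with
    | base => exact fun _ => hr
    | succ q hq ih =>
      intro hqk
      have h1 := ih (by omega)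
      have h2 := hcon q hq (by omega) h1
      have h3 := h1.2.2
      have h4 := h.weak r (q + 1) (by have := hr.1; omega) hqk
      exact ⟨by have := hr.1; omega, by omega, by omega⟩
  obtain ⟨k, rfl⟩ : ∃ k', k = k' + 1 := ⟨k - 1, by omega⟩
  have := hcon k (by omega) (by omega) (key k (by omega) (by omega))
  omega

theorem IsPattern.isStep (h : IsPattern n k T) {y : ℕ} (hy : y < n) :
    IsStep (⟨y, hy⟩ : Fin n) (h.lead (y + 1) hy) (SameMove T k y) (SupAt T n k (y + 1))
      (NZAt T n k (y + 1)) (SupAt T n k y) (NZAt T n k y) where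
  symm := fun a b ⟨r, h1, h2⟩ => ⟨r, h2, h1⟩
  trans := by
    rintro a b c ⟨r, h1, h2⟩ ⟨r', h3, h4⟩
    obtain rfl := h2.unique h b.2 h3
    exact ⟨r, h1, h4⟩
  mono := by
    rintro a b ⟨r, h1, h2⟩ hab
    have := h1.diag_le h a.2
    have hlt := h.moveCount_lt (Y := y + 1) hab b.2 (by omega)
    rw [h.moveCount_succ_of_moves a.2 h1, h.moveCount_succ_of_moves b.2 h2] at hlt
    rw [Fin.lt_def]
    change leadPos T (y + 1) a < leadPos T (y + 1) b
    rw [h1.leadPos_succ h a.2, h2.leadPos_succ h b.2]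
    omega
  le := by
    rintro a ⟨r, h1, -⟩
    rw [Fin.le_def]
    change leadPos T (y + 1) a ≤ y
    rw [h1.leadPos_succ h a.2]
    exact h.moveCount_le a.2 y
  bound := by
    rintro a x ⟨r, h1, -⟩ hs hx
    rw [Fin.le_def] at hx ⊢
    change x.val ≤ leadPos T (y + 1) a
    rw [h1.leadPos_succ h a.2]
    rcases hs with hs | ⟨r', -, hs, -⟩
    · rw [h.moveCount_succ_of_moves a.2 h1] at hs
      omega
    · simp only at hx
      omega
  fix_y := by
    intro a ha hs
    have hn : ∀ r, ¬ MovesWith T y r a := fun r hr => ha ⟨r, hr, hr⟩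
    rcases hs with hs | ⟨r', -, hs, -⟩
    · rw [h.moveCount_succ_of_not a.2 hn] at hs
      have := h.moveCount_le a.2 y
      simp only at hs
      omega
    · simp only at hs
      omega
  fix_sup := by
    intro a x ha hs
    have hn : ∀ r, ¬ MovesWith T y r a := fun r hr => ha ⟨r, hr, hr⟩
    rcases hs with hs | ⟨r', h1, h2, h3, h4⟩
    · left
      rwa [h.moveCount_succ_of_not a.2 hn] at hs
    · right
      refine ⟨r', ⟨h1.1, ?_, ?_⟩, by omega, h3, h4⟩
      · right
        rcases h1.2.1 with h5 | h5
        · exact absurd ⟨h1.1, by omega, by have := h1.2.2; omega⟩ (hn r')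
        · exact h5
      · have := h1.2.2
        omega
  fix_nz := by
    intro a x ha hs
    have hn : ∀ r, ¬ MovesWith T y r a := fun r hr => ha ⟨r, hr, hr⟩
    have hd := h.weak a a le_rfl a.2
    have hna : ¬ T a a ≤ y ∨ T a (a + 1) < y := by
      by_contra! hcon
      exact hn a ⟨le_rfl, hcon.1, hcon.2⟩
    rcases hs with hs | ⟨r', h1, h2⟩
    · left
      rw [hs, leadPos, leadPos, h.moveCount_succ_of_not a.2 hn]
      split_ifs <;> omega
    · right
      have hra : r' = a := by
        rcases h1.2.1 with h5 | h5
        · exact absurd ⟨h1.1, h5.le, h1.2.2⟩ (hn r')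
        · exact h5
      subst hra
      have := h1.2.2
      exact ⟨a, ⟨le_rfl, Or.inr rfl, by omega⟩, h2⟩
  mv_sup := by
    rintro a x ⟨r, h1, -⟩ hx
    left
    rw [Fin.lt_def] at hx
    change x.val < leadPos T (y + 1) a at hx
    rwa [h1.leadPos_succ h a.2] at hx
  st_y := by
    rintro a ⟨r, h1, -⟩ hst
    right
    refine ⟨r, h1.labelled h a.2 fun b hb hr => hst ⟨b, by omega⟩ hb ⟨r, hr, h1⟩, le_rfl, ?_, ?_⟩
    · exact (h.mono le_rfl h1.1 a.2.le).trans h1.2.1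
    · exact h1.2.2.trans (h.mono (by have := h1.1; omega) a.2 le_rfl)
  st_sup := by
    rintro a b x ⟨r, h1, h2⟩ hst hyx hs
    rw [Fin.lt_def] at hyx
    simp only at hyx
    rcases hs with hs | ⟨r', h3, h4, h5, h6⟩
    · have := h.moveCount_le b.2 (y + 1)
      omega
    · obtain rfl := h3.unique_of_moves h b.2 h2
      right
      exact ⟨r', h1.labelled h a.2 fun b hb hr => hst ⟨b, by omega⟩ hb ⟨r', hr, h1⟩,
        hyx.le, h5, h6⟩
  ns_sup := by
    rintro a b x ⟨r, h2, h1⟩ hba hyx hs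
    rw [Fin.lt_def] at hyx
    simp only at hyx
    rcases hs with hs | ⟨r', h3, h4, h5, h6⟩
    · have := h.moveCount_le b.2 (y + 1)
      omega
    · obtain rfl := h3.unique_of_moves h b.2 h2
      have := (h2.eq_of_lt h a.2 hba h1).1
      have := h3.2.2
      omega
  st_nz := by
    rintro a x ⟨r, h1, -⟩ hst hs
    have hl := h1.labelled h a.2 fun b hb hr => hst ⟨b, by omega⟩ hb ⟨r, hr, h1⟩
    have hd := h1.diag_le h a.2
    rcases hs with hs | ⟨r', h2, h3⟩
    · rw [leadPos] at hs
      split_ifs at hs with hc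
      · left
        ext
        simp only
        omega
      · right; left
        change x.val + 1 = leadPos T (y + 1) a
        rw [h1.leadPos_succ h a.2]
        have := h.moveCount_pos a.2 (not_le.1 hc)
        omega
    · have hrr : r' = r := by
        refine MovesWith.unique h a.2 ⟨h2.1, ?_, h2.2.2⟩ h1
        rcases h2.2.1 with h5 | rfl
        · exact h5.le
        · exact hd
      subst hrr
      have hle : y ≤ T r' k := h1.2.2.trans (h.mono (by have := h1.1; omega) a.2 le_rfl)
      rcases hle.lt_or_eq with hlt | heq
      · right; right
        refine ⟨by rw [Fin.lt_def]; simp only; omega, ?_⟩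
        obtain ⟨b, hab, hb, h4, h5⟩ := h1.exists_last h a.2 hlt
        have hlb : Labelled T (y + 1) r' b := ⟨h4.1, Or.inl (by have := h4.2.1; omega), h5⟩
        refine ⟨⟨b, hb⟩, ⟨r', h1, h4⟩, Or.inr ⟨r', hlb, h3⟩, ?_⟩
        rintro b' ⟨r'', h6, h7⟩ hs
        obtain rfl := h6.unique h a.2 h1
        have hl' : y < T r'' (b' + 1) := by
          rcases hs with hs | ⟨q, h8, -⟩
          · have := h.moveCount_le b'.2 y
            have := h7.diag_le h b'.2
            rw [h.moveCount_succ_of_moves b'.2 h7] at hs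
            omega
          · obtain rfl := h8.unique_of_moves h b'.2 h7
            exact h8.2.2
        ext
        simp only
        rcases lt_trichotomy b'.val b with hlt' | heq' | hlt'
        · have := (h7.eq_of_lt h hb hlt' h4).1
          omega
        · exact heq'
        · have := (h4.eq_of_lt h b'.2 hlt' h7).1
          omega
      · left
        ext
        simp only
        omega
  ns_nz := by
    rintro a b x ⟨r, h2, h1⟩ hba hs
    have hT := (h2.eq_of_lt h a.2 hba h1).2
    have hd : T a a < y := by
      have hra : r < a := lt_of_le_of_lt h2.1 hba
      have h3 := h.strict_lt hra le_rfl a.2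
      have h4 := h.weak a a le_rfl a.2
      omega
    rcases hs with hs | ⟨r', h3, h4⟩
    · rw [leadPos, if_neg (by omega)] at hs
      change x.val + 1 = leadPos T (y + 1) a
      rw [h1.leadPos_succ h a.2]
      have := h.moveCount_pos a.2 hd
      omega
    · exfalso
      have hrr : r' = r := by
        refine MovesWith.unique h a.2 ⟨h3.1, ?_, h3.2.2⟩ h1
        rcases h3.2.1 with h5 | rfl
        · exact h5.le
        · exact hd.le
      subst hrr
      rcases h3.2.1 with h5 | h5
      · omega
      · have := h2.1
        rw [Fin.lt_def] at hba
        omega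

end PatternStep

section PatternRank

variable {n k : ℕ} {T T' : ℕ → ℕ → ℕ}

/-- The rank of the coordinates at time `Y`. -/
def coordRank (n Y : ℕ) (x : Fin n) : ℕ := if x.val < Y then n - Y + x.val else n - 1 - x.val

theorem coordRank_injective {Y : ℕ} (hY : Y ≤ n) : Function.Injective (coordRank n Y) := by
  intro a b h
  have := a.2
  have := b.2
  ext
  simp only [coordRank] at h
  split_ifs at h <;> omega

theorem SupAt.coordRank_le (h : IsPattern n k T) {Y : ℕ} (hY : Y ≤ n) {m : Fin k} {x : Fin n}
    (hx : SupAt T n k Y m x) : coordRank n Y x ≤ coordRank n Y (h.lead Y hY m) := by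
  have h0 := h.moveCount_le m.2 Y
  have hl : (h.lead Y hY m : ℕ) = leadPos T Y m := rfl
  simp only [coordRank, hl]
  by_cases hm : Y ≤ T m m
  · rw [leadPos, if_pos hm, if_neg (not_lt.2 hm)]
    rcases hx with hx | ⟨r, hl, h1, h2, -⟩
    · rw [h.moveCount_eq_zero m.2 hm] at hx
      omega
    · have hr : r = m := by
        rcases hl.2.1 with h3 | h3
        · have := h.diag_le hl.1 m.2
          omega
        · exact h3
      subst hr
      rw [if_neg (not_lt.2 h1)]
      omega
  · have h1 := h.moveCount_pos m.2 (not_le.1 hm)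
    rw [leadPos, if_neg hm, if_pos (show moveCount T m Y - 1 < Y by omega)]
    rcases hx with hx | ⟨r, hl, h1, h2, -⟩
    · rw [if_pos (by omega)]; omega
    · rw [if_neg (not_lt.2 h1)]; omega

variable {ι : Type*} {Y : ℕ} {G G' : ι → Matrix (Fin n) (Fin n) ℝ} {P P' : ι → Fin k → Fin n}
  {u u' : Matrix (Fin k) (Fin n) ℝ} {A A' : ι → Matrix (Fin k) (Fin k) ℝ}

theorem IsState.eq_zero_of_rank_lt (h : IsPattern n k T) (hY : Y ≤ n)
    (hs : IsState (SupAt T n k Y) (NZAt T n k Y) G P u A) (m : Fin k) (r : Fin n)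
    (hr : coordRank n Y (h.lead Y hY m) < coordRank n Y r) : u m r = 0 :=
  hs.sup m r fun hsup => absurd (hsup.coordRank_le h hY) (not_le.2 hr)

theorem IsState.lead_ne_zero (h : IsPattern n k T) (hY : Y ≤ n)
    (hs : IsState (SupAt T n k Y) (NZAt T n k Y) G P u A) (m : Fin k) :
    u m (h.lead Y hY m) ≠ 0 := hs.nz m _ (Or.inl rfl)

theorem IsPattern.lead_injective (h : IsPattern n k T) (hY : Y ≤ n) :
    Function.Injective (h.lead Y hY) := by
  intro a b hab
  exact Fin.ext (h.leadPos_injective a.2 b.2 (Fin.ext_iff.1 hab))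

theorem IsState.linearIndependent (h : IsPattern n k T) (hY : Y ≤ n)
    (hs : IsState (SupAt T n k Y) (NZAt T n k Y) G P u A) : LinearIndependent ℝ u.row :=
  linearIndependent_of_leading (rk := coordRank n Y) (π := h.lead Y hY)
    ((coordRank_injective hY).comp (h.lead_injective hY))
    (hs.eq_zero_of_rank_lt h hY) (hs.lead_ne_zero h hY)

theorem IsState.range_lead_eq (h : IsPattern n k T) (h' : IsPattern n k T') (hY : Y ≤ n)
    (hs : IsState (SupAt T n k Y) (NZAt T n k Y) G P u A)
    (hs' : IsState (SupAt T' n k Y) (NZAt T' n k Y) G' P' u' A') (hu : rowSp u = rowSp u') :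
    Set.range (h.lead Y hY) = Set.range (h'.lead Y hY) :=
  (range_leading_subset (coordRank_injective hY) (h'.lead_injective hY)
    (hs.eq_zero_of_rank_lt h hY) (hs.lead_ne_zero h hY) (hs'.eq_zero_of_rank_lt h' hY)
    (hs'.lead_ne_zero h' hY) hu.le).antisymm
  (range_leading_subset (coordRank_injective hY) (h.lead_injective hY)
    (hs'.eq_zero_of_rank_lt h' hY) (hs'.lead_ne_zero h' hY) (hs.eq_zero_of_rank_lt h hY)
    (hs.lead_ne_zero h hY) hu.ge)

theorem IsPattern.leadPos_eq (h : IsPattern n k T) (h' : IsPattern n k T')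
    (hd : ∀ m < k, T m m = T' m m) (hY : Y ≤ n)
    (hr : Set.range (h.lead Y hY) = Set.range (h'.lead Y hY)) {m : ℕ} (hm : m < k) :
    leadPos T Y m = leadPos T' Y m := by
  induction m using Nat.strong_induction_on with
  | _ m ih =>
    wlog hlt : leadPos T Y m < leadPos T' Y m generalizing T T'
    · rcases lt_trichotomy (leadPos T Y m) (leadPos T' Y m) with h1 | h1 | h1
      · exact absurd h1 hlt
      · exact h1
      · exact (this h' h (fun q hq => (hd q hq).symm) hr.symm
          (fun q hq hqk => (ih q hq hqk).symm) h1).symm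
    exfalso
    obtain ⟨m', he⟩ : h.lead Y hY ⟨m, hm⟩ ∈ Set.range (h'.lead Y hY) := hr ▸ ⟨_, rfl⟩
    have he : leadPos T' Y m' = leadPos T Y m := Fin.ext_iff.1 he
    have hmm : ¬ Y ≤ T m m := by
      intro hc
      simp only [leadPos, ← hd m hm, if_pos hc] at hlt
      omega
    by_cases hS : Y ≤ T m' m'
    · have h1 : leadPos T Y m' = leadPos T' Y m' := by
        simp only [leadPos, ← hd m' m'.2, if_pos hS]
      have h2 := h.leadPos_injective m'.2 hm (h1.trans he)
      rw [h2] at hS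
      exact hmm hS
    rcases lt_trichotomy (m' : ℕ) m with h1 | h1 | h1
    · have h2 := h.leadPos_injective m'.2 hm ((ih m' h1 m'.2).trans he)
      omega
    · rw [h1] at he; omega
    · have h2 := h'.moveCount_lt (Y := Y) h1 m'.2 (by rw [← hd m hm]; omega)
      simp only [leadPos, ← hd m hm, ← hd m' m'.2, if_neg hmm, if_neg hS] at he hlt
      omega

theorem IsPattern.moveCount_eq (h : IsPattern n k T) (h' : IsPattern n k T')
    (hd : ∀ m < k, T m m = T' m m) (hY : Y ≤ n)
    (hr : Set.range (h.lead Y hY) = Set.range (h'.lead Y hY)) {m : ℕ} (hm : m < k) :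
    moveCount T m Y = moveCount T' m Y := by
  have h1 := h.leadPos_eq h' hd hY hr hm
  by_cases hc : Y ≤ T m m
  · rw [h.moveCount_eq_zero hm hc, h'.moveCount_eq_zero hm (hd m hm ▸ hc)]
  · have h2 := h.moveCount_pos hm (not_le.1 hc)
    have h3 := h'.moveCount_pos hm (hd m hm ▸ not_le.1 hc)
    simp only [leadPos, ← hd m hm, if_neg hc] at h1
    omega

theorem IsPattern.exists_movesWith_iff (h : IsPattern n k T) {m y : ℕ} (hm : m < k) :
    (∃ r, MovesWith T y r m) ↔ moveCount T m (y + 1) = moveCount T m y + 1 := by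
  refine ⟨fun ⟨r, hr⟩ => h.moveCount_succ_of_moves hm hr, fun he => ?_⟩
  by_contra hc
  rw [h.moveCount_succ_of_not hm (not_exists.1 hc)] at he
  omega

/-- A pattern is determined by its diagonal and by the numbers of moves. -/
theorem IsPattern.eq_of_moveCount_eq (h : IsPattern n k T) (h' : IsPattern n k T')
    (hd : ∀ m < k, T m m = T' m m)
    (hc : ∀ m < k, ∀ Y ≤ n, moveCount T m Y = moveCount T' m Y) {r m : ℕ} (hr : r ≤ m)
    (hrk : r < k) (hm : m ≤ k) : T r m = T' r m := by
  induction m generalizing r with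
  | zero =>
    obtain rfl : r = 0 := by omega
    exact hd 0 hrk
  | succ m ih =>
    rcases Nat.lt_or_ge m r with h1 | h1
    · obtain rfl : r = m + 1 := by omega
      exact hd _ hrk
    have key : ∀ (S S' : ℕ → ℕ → ℕ), IsPattern n k S → IsPattern n k S' →
        (∀ m < k, ∀ Y ≤ n, moveCount S m Y = moveCount S' m Y) →
        (∀ q, q ≤ m → q < k → S q m = S' q m) → S r (m + 1) ≤ S' r (m + 1) := by
      intro S S' hS hS' hcc hq
      have hlt := hS.lt r (m + 1) hrk hr hm
      obtain ⟨r', h2, h3, h4⟩ : ∃ r', MovesWith S' (S r (m + 1)) r' m := by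
        rw [hS'.exists_movesWith_iff (by omega), ← hcc m (by omega) _ (by omega),
          ← hcc m (by omega) _ (by omega), ← hS.exists_movesWith_iff (by omega)]
        exact ⟨r, h1, hS.weak r m h1 (by omega), le_rfl⟩
      rcases lt_trichotomy r r' with h5 | rfl | h5
      · have h6 := hS'.strict_lt h5 h2 (by omega)
        have h7 := hS.weak r m h1 (by omega)
        rw [hq r h1 hrk] at h7
        omega
      · exact h4
      · have h6 := hS.strict_lt h5 h1 (by omega)
        rw [hq r' h2 (by omega)] at h6
        omega
    exact (key T T' h h' hc fun q h1 h2 => ih h1 h2 (by omega)).antisymm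
      (key T' T h' h (fun m hm Y hY => (hc m hm Y hY).symm)
        fun q h1 h2 => (ih h1 h2 (by omega)).symm)

end PatternRank

section Deformation

variable {n k : ℕ} {ι Ω : Type*}

/-- States at time `n` over one and the same adapted basis can be deformed simultaneously, to
states at time `0` over a common basis, keeping apart those with different spaces and those with
different patterns of leading coordinates. -/
theorem exists_deformation [Fintype ι] [Finite Ω] {H : ι → Matrix (Fin n) (Fin n) ℝ}
    {T : Ω → ℕ → ℕ → ℕ} (hT : ∀ ω, IsPattern n k (T ω)) {P : Ω → ι → Fin k → Fin n}
    {D₀ : Matrix (Fin n) (Fin n) ℝ} (hD₀ : IsUnit D₀) {u₀ : Ω → Matrix (Fin k) (Fin n) ℝ}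
    {A₀ : Ω → ι → Matrix (Fin k) (Fin k) ℝ}
    (h₀ : ∀ ω, IsState (SupAt (T ω) n k n) (NZAt (T ω) n k n) (fun l => D₀⁻¹ * H l) (P ω) (u₀ ω)
      (A₀ ω)) {Y : ℕ} (hYn : Y ≤ n) :
    ∃ D : Matrix (Fin n) (Fin n) ℝ, IsUnit D ∧ ∃ (v : Ω → Matrix (Fin k) (Fin n) ℝ)
      (A : Ω → ι → Matrix (Fin k) (Fin k) ℝ),
      (∀ ω, IsState (SupAt (T ω) n k Y) (NZAt (T ω) n k Y) (fun l => D⁻¹ * H l) (P ω) (v ω)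
        (A ω)) ∧
      ∀ ω ω', (rowSp (u₀ ω) ≠ rowSp (u₀ ω') ∨ ∃ (Z : ℕ) (hZ : Z ≤ n), Y ≤ Z ∧
        Set.range ((hT ω).lead Z hZ) ≠ Set.range ((hT ω').lead Z hZ)) →
        rowSp (v ω) ≠ rowSp (v ω') := by
  induction hYn using Nat.decreasingInduction with
  | self =>
    refine ⟨D₀, hD₀, u₀, A₀, h₀, ?_⟩
    rintro ω ω' (h | ⟨Z, hZ, hYZ, hne⟩)
    · exact h
    · obtain rfl : n = Z := by omega
      exact fun he => hne ((h₀ ω).range_lead_eq (hT ω) (hT ω') le_rfl (h₀ ω') he)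
  | of_succ y hy ih =>
    obtain ⟨D, hD, v, A, hv, hsep⟩ := ih
    have hlead : ∀ ω m, v ω m ((hT ω).lead (y + 1) hy m) ≠ 0 :=
      fun ω m => (hv ω).lead_ne_zero (hT ω) hy m
    let c : Ω → Fin k → ℝ := fun ω m => v ω m ((hT ω).lead (y + 1) hy m)
    let w : Ω → Matrix (Fin k) (Fin n) ℝ := fun ω => Matrix.diagonal (fun m => (c ω m)⁻¹) * v ω
    have hw : ∀ ω, IsState (SupAt (T ω) n k (y + 1)) (NZAt (T ω) n k (y + 1))
        (fun l => D⁻¹ * H l) (P ω) (w ω) (fun l => A ω l * Matrix.diagonal (c ω)) :=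
      fun ω => (hv ω).rescale (hlead ω)
    have hwv : ∀ ω, rowSp (w ω) = rowSp (v ω) := fun ω =>
      rowSp_mul (isUnit_diagonal fun m => inv_ne_zero (hlead ω m)) _
    have hw1 : ∀ ω m, w ω m ((hT ω).lead (y + 1) hy m) = 1 := by
      intro ω m
      simp only [w, Matrix.diagonal_mul]
      exact inv_mul_cancel₀ (hlead ω m)
    obtain ⟨U, hU, hUsep⟩ := exists_separating_nhds w
      fun ω => (hw ω).linearIndependent (hT ω) hy
    have hev := Filter.eventually_all.2 fun ω =>
      ((hT ω).isStep (Nat.lt_of_succ_le hy)).deform (hw ω) (hw1 ω) (hU ω)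
    obtain ⟨t, ht, ht0⟩ := (hev.and eventually_mem_nhdsWithin).exists
    choose w' hw'U v' A' hv' hvw using ht
    have hsh : IsUnit (shearMat (⟨y, Nat.lt_of_succ_le hy⟩ : Fin n) t) :=
      isUnit_shearMat _ (ne_of_gt ht0)
    have hst : ∀ ω, IsState (SupAt (T ω) n k y) (NZAt (T ω) n k y)
        (fun l => (D * shearMat (⟨y, Nat.lt_of_succ_le hy⟩ : Fin n) t)⁻¹ * H l) (P ω) (v' ω)
        (A' ω) := by
      intro ω
      simpa only [Matrix.mul_inv_rev, Matrix.mul_assoc] using hv' ω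
    refine ⟨_, hD.mul hsh, v', A', hst, ?_⟩
    have hkey : ∀ ω ω', rowSp (v ω) ≠ rowSp (v ω') → rowSp (v' ω) ≠ rowSp (v' ω') := by
      intro ω ω' hne he
      rw [hvw, hvw] at he
      exact hUsep ω ω' (by rwa [hwv, hwv]) _ (hw'U ω) _ (hw'U ω') ((rowSp_mul_right_inj hsh).1 he)
    rintro ω ω' (h | ⟨Z, hZ, hYZ, hne⟩)
    · exact hkey ω ω' (hsep ω ω' (Or.inl h))
    · rcases hYZ.lt_or_eq with hlt | rfl
      · exact hkey ω ω' (hsep ω ω' (Or.inr ⟨Z, hZ, hlt, hne⟩))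
      · exact fun he => hne ((hst ω).range_lead_eq (hT ω) (hT ω') hZ (hst ω') he)

end Deformation

section LRArray

/-- Littlewood–Richardson arrays: `a i j` is the number of entries `j` in the row `i` of a
Littlewood–Richardson skew tableau of shape `ν/λ` and content `μ`. -/
structure IsLRArray (k : ℕ) (lam mu nu : ℕ → ℕ) (a : ℕ → ℕ → ℕ) : Prop where
  zero : ∀ i j, k ≤ i → a i j = 0
  row : ∀ i < k, lam i + ∑ j ∈ Finset.range k, a i j = nu i
  content : ∀ j, ∑ i ∈ Finset.range k, a i j = mu j
  column : ∀ i j, i + 1 < k → lam (i + 1) + ∑ q ∈ Finset.range (j + 1), a (i + 1) q ≤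
    lam i + ∑ q ∈ Finset.range j, a i q
  lattice : ∀ i j, i < k → ∑ p ∈ Finset.range (i + 1), a p (j + 1) ≤ ∑ p ∈ Finset.range i, a p j

variable {n k : ℕ} {lam mu nu : ℕ → ℕ} {a a' : ℕ → ℕ → ℕ}

theorem IsLRArray.eq_zero (h : IsLRArray k lam mu nu a) {i j : ℕ} (hij : i < j) : a i j = 0 := by
  rcases le_or_gt k i with hi | hi
  · exact h.zero i j hi
  induction i using Nat.strong_induction_on generalizing j with
  | _ i ih =>
    obtain ⟨j, rfl⟩ : ∃ j', j = j' + 1 := ⟨j - 1, by omega⟩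
    have h1 := h.lattice i j hi
    have h2 : ∑ p ∈ Finset.range i, a p j = 0 := by
      refine Finset.sum_eq_zero fun p hp => ?_
      rw [Finset.mem_range] at hp
      exact ih p hp (by omega) (by omega)
    rw [h2, Finset.sum_range_succ] at h1
    omega

theorem IsLRArray.sum_le (h : IsLRArray k lam mu nu a) {i j : ℕ} (hi : i ≤ k) :
    ∑ p ∈ Finset.range i, a p j ≤ mu j := by
  rw [← h.content j]
  exact Finset.sum_le_sum_of_subset (Finset.range_mono hi)

theorem IsLRArray.first_column_le (h : IsLRArray k lam mu nu a) {i : ℕ} (hi : i < k) :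
    lam i + ∑ p ∈ Finset.range (i + 1), a p 0 ≤ nu 0 := by
  induction i with
  | zero =>
    have h1 := h.row 0 hi
    have h2 : a 0 0 ≤ ∑ j ∈ Finset.range k, a 0 j :=
      Finset.single_le_sum (f := fun j => a 0 j) (fun _ _ => Nat.zero_le _) (by simpa using hi)
    simp only [zero_add, Finset.sum_range_one]
    omega
  | succ i ih =>
    have h1 := h.column i 0 hi
    have h2 := ih (by omega)
    rw [Finset.sum_range_succ]
    simp only [zero_add, Finset.sum_range_one, Finset.range_zero, Finset.sum_empty] at h1
    omega

/-- The pattern associated with a Littlewood–Richardson array. -/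
def lrPattern (n k : ℕ) (lam : ℕ → ℕ) (a : ℕ → ℕ → ℕ) (r m : ℕ) : ℕ :=
  if m ≤ r then k - 1 - r + lam r else n - 1 - r - ∑ i ∈ Finset.range m, a i (m - 1 - r)

theorem lrPattern_self (r : ℕ) : lrPattern n k lam a r r = k - 1 - r + lam r := if_pos le_rfl

theorem IsLRArray.pattern_cast (hkn : k ≤ n) (hmu : ∀ i, mu i ≤ n - k)
    (h : IsLRArray k lam mu nu a) {r m : ℕ} (hr : r < m) (hm : m ≤ k) :
    (lrPattern n k lam a r m : ℤ) = n - 1 - r - ∑ i ∈ Finset.range m, (a i (m - 1 - r) : ℤ) := by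
  have h1 := h.sum_le (j := m - 1 - r) hm
  have h2 := hmu (m - 1 - r)
  rw [lrPattern, if_neg (not_le.2 hr)]
  rw [← Nat.cast_sum]
  omega

theorem lrPattern_self_cast {r : ℕ} (hr : r < k) :
    (lrPattern n k lam a r r : ℤ) = k - 1 - r + lam r := by
  rw [lrPattern_self]
  omega

theorem IsLRArray.isPattern (hkn : k ≤ n) (hlam : IsRectPartition n k lam)
    (hmu : ∀ i, mu i ≤ n - k) (hnu : nu 0 ≤ n - k) (h : IsLRArray k lam mu nu a) :
    IsPattern n k (lrPattern n k lam a) where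
  weak r m hr hm := by
    zify
    rw [h.pattern_cast hkn hmu (show r < m + 1 by omega) hm]
    rcases hr.lt_or_eq with hlt | rfl
    · rw [h.pattern_cast hkn hmu hlt hm.le]
      have h1 := h.lattice m (m - 1 - r) hm
      rw [show m - 1 - r + 1 = m + 1 - 1 - r by omega] at h1
      zify at h1
      linarith
    · rw [lrPattern_self_cast hm]
      have h1 := h.first_column_le hm
      rw [show r + 1 - 1 - r = 0 by omega, ← Nat.cast_sum]
      omega
  strict r m hr hm hrk := by
    zify
    rcases hr.lt_or_eq with hlt | rfl
    · rw [h.pattern_cast hkn hmu (show r + 1 < m + 1 by omega) hm, h.pattern_cast hkn hmu hlt hm.le,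
        show m + 1 - 1 - (r + 1) = m - 1 - r by omega, Finset.sum_range_succ]
      push_cast
      have : (0 : ℤ) ≤ a m (m - 1 - r) := Nat.cast_nonneg _
      linarith
    · rw [lrPattern_self_cast hrk, lrPattern_self_cast hm]
      have := hlam.1 (Nat.le_succ r)
      rw [Nat.succ_eq_add_one] at this
      push_cast
      omega
  lt r m hrk hr hm := by
    rcases hr.lt_or_eq with hlt | rfl
    · rw [lrPattern, if_neg (not_le.2 hlt)]
      omega
    · rw [lrPattern_self]
      have := hlam.2.1 r
      omega
  sum_le r m hr hm := by
    have h1 := h.column m (m - r) hm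
    rw [Finset.sum_Ico_succ_top hr, Finset.sum_Ico_succ_top hr, lrPattern_self_cast hm,
      lrPattern_self_cast (show m < k by omega),
      h.pattern_cast hkn hmu (show m < m + 1 by omega) (by omega),
      h.pattern_cast hkn hmu (show m + 1 < m + 2 by omega) (by omega),
      show m + 1 - 1 - m = 0 by omega, show m + 2 - 1 - (m + 1) = 0 by omega,
      Finset.sum_range_succ _ (m + 1)]
    have key : ∑ q ∈ Finset.Ico r m, ((lrPattern n k lam a (q + 1) (m + 2) : ℤ) +
          lrPattern n k lam a q m) - ∑ q ∈ Finset.Ico r m,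
          ((lrPattern n k lam a (q + 1) (m + 1) : ℤ) + lrPattern n k lam a q (m + 1)) =
        ∑ j ∈ Finset.range (m - r), ((a m j : ℤ) - a (m + 1) (j + 1)) := by
      rw [← Finset.sum_sub_distrib, ← Finset.sum_range_reflect,
        Finset.sum_Ico_eq_sum_range]
      refine Finset.sum_congr rfl fun q hq => ?_
      rw [Finset.mem_range] at hq
      rw [h.pattern_cast hkn hmu (show r + q + 1 < m + 2 by omega) (by omega),
        h.pattern_cast hkn hmu (show r + q < m by omega) (by omega),
        h.pattern_cast hkn hmu (show r + q + 1 < m + 1 by omega) (by omega),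
        h.pattern_cast hkn hmu (show r + q < m + 1 by omega) (by omega),
        show m + 2 - 1 - (r + q + 1) = m - r - 1 - q + 1 by omega,
        show m - 1 - (r + q) = m - r - 1 - q by omega,
        show m + 1 - 1 - (r + q + 1) = m - r - 1 - q by omega,
        show m + 1 - 1 - (r + q) = m - r - 1 - q + 1 by omega,
        Finset.sum_range_succ _ (m + 1), Finset.sum_range_succ (fun i => (a i (m - r - 1 - q) : ℤ))]
      push_cast
      ring
    rw [Finset.sum_range_succ' _ (m - r)] at h1
    rw [Finset.sum_sub_distrib] at key
    zify at h1
    push_cast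
    linarith

theorem IsLRArray.moveCount_eq (hkn : k ≤ n) (hlam : IsRectPartition n k lam)
    (hmu : ∀ i, mu i ≤ n - k) (hnu : ∀ i, nu i ≤ n - k) (h : IsLRArray k lam mu nu a) {m : ℕ}
    (hm : m < k) : moveCount (lrPattern n k lam a) m n = n - k + m - nu m + 1 := by
  have hp := h.isPattern hkn hlam hmu (hnu 0)
  have e1 : (moveCount (lrPattern n k lam a) m n : ℤ) = ∑ r ∈ Finset.range (m + 1),
      ((lrPattern n k lam a r (m + 1) : ℤ) + 1 - lrPattern n k lam a r m) := by
    rw [moveCount, Nat.cast_sum]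
    refine Finset.sum_congr rfl fun r hr => ?_
    rw [Finset.mem_range] at hr
    have h1 := hp.weak r m (by omega) hm
    have h2 := hp.lt r (m + 1) (by omega) (by omega) hm
    omega
  have e2 : ∑ r ∈ Finset.range m,
      ((lrPattern n k lam a r (m + 1) : ℤ) + 1 - lrPattern n k lam a r m) =
      ∑ j ∈ Finset.range m, (1 + ∑ i ∈ Finset.range m, (a i j : ℤ) -
        ∑ i ∈ Finset.range (m + 1), (a i (j + 1) : ℤ)) := by
    rw [← Finset.sum_range_reflect]
    refine Finset.sum_congr rfl fun r hr => ?_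
    rw [Finset.mem_range] at hr
    rw [h.pattern_cast hkn hmu (show m - 1 - r < m + 1 by omega) hm,
      h.pattern_cast hkn hmu (show m - 1 - r < m by omega) hm.le,
      show m + 1 - 1 - (m - 1 - r) = r + 1 by omega, show m - 1 - (m - 1 - r) = r by omega]
    ring
  have e3 : ∑ j ∈ Finset.range (m + 1), ∑ i ∈ Finset.range (m + 1), (a i j : ℤ) =
      ∑ j ∈ Finset.range m, ∑ i ∈ Finset.range m, (a i j : ℤ) + (nu m - lam m) := by
    have h0 : ∑ i ∈ Finset.range m, (a i m : ℤ) = 0 :=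
      Finset.sum_eq_zero fun i hi => by rw [h.eq_zero (Finset.mem_range.1 hi)]; rfl
    have h1 : ∑ j ∈ Finset.range (m + 1), (a m j : ℤ) = nu m - lam m := by
      have h2 := h.row m hm
      rw [← Finset.sum_range_add_sum_Ico _ (show m + 1 ≤ k from hm),
        Finset.sum_eq_zero (s := Finset.Ico (m + 1) k)
          (fun j hj => h.eq_zero (Finset.mem_Ico.1 hj).1)] at h2
      rw [← Nat.cast_sum]
      omega
    simp only [Finset.sum_range_succ _ m] at h1 ⊢
    rw [Finset.sum_add_distrib, h0]
    linarith
  have e4 := hnu m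
  rw [Finset.sum_range_succ' _ m] at e3
  zify [show nu m ≤ n - k + m by omega, hkn]
  rw [e1, Finset.sum_range_succ, e2, lrPattern_self_cast hm,
    h.pattern_cast hkn hmu (show m < m + 1 by omega) hm, show m + 1 - 1 - m = 0 by omega]
  simp only [Finset.sum_sub_distrib, Finset.sum_add_distrib, Finset.sum_const, Finset.card_range,
    nsmul_eq_mul, mul_one]
  linarith

/-- A Littlewood–Richardson array is determined by its pattern. -/
theorem IsLRArray.eq_of_pattern {mu' nu' : ℕ → ℕ} (hkn : k ≤ n) (hmu : ∀ i, mu i ≤ n - k)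
    (hmu' : ∀ i, mu' i ≤ n - k) (h : IsLRArray k lam mu nu a)
    (h' : IsLRArray k lam mu' nu' a') (he : ∀ r m, r ≤ m → r < k → m ≤ k →
      lrPattern n k lam a r m = lrPattern n k lam a' r m) : a = a' := by
  have hY : ∀ i j, i ≤ k → ∑ p ∈ Finset.range i, a p j = ∑ p ∈ Finset.range i, a' p j := by
    intro i j hi
    rcases lt_or_ge j i with hj | hj
    · have h1 := he (i - 1 - j) i (by omega) (by omega) hi
      zify at h1
      rw [h.pattern_cast hkn hmu (show i - 1 - j < i by omega) hi,
        h'.pattern_cast hkn hmu' (show i - 1 - j < i by omega) hi,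
        show i - 1 - (i - 1 - j) = j by omega] at h1
      zify
      linarith
    · rw [Finset.sum_eq_zero, Finset.sum_eq_zero]
      · intro p hp
        exact h'.eq_zero (lt_of_lt_of_le (Finset.mem_range.1 hp) hj)
      · intro p hp
        exact h.eq_zero (lt_of_lt_of_le (Finset.mem_range.1 hp) hj)
  ext i j
  rcases lt_or_ge i k with hi | hi
  · have h1 := hY (i + 1) j hi
    rw [Finset.sum_range_succ, Finset.sum_range_succ, hY i j hi.le] at h1
    exact Nat.add_left_cancel h1
  · rw [h.zero i j hi, h'.zero i j hi]

end LRArray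

section Cluster

variable {n k : ℕ} {ι : Type*}

/-- Partitions contained in the `k × (n - k)` rectangle. -/
abbrev RectPart (n k : ℕ) : Type := {f : ℕ → ℕ // IsRectPartition n k f}

instance : Finite (RectPart n k) := by
  refine Finite.of_injective (β := Fin k → Fin (n - k + 1))
    (fun f i => ⟨f.1 i, Nat.lt_succ_of_le (f.2.2.1 i)⟩) fun f g h =>
      Subtype.ext (funext fun i => ?_)
  rcases lt_or_ge i k with hi | hi
  · exact Fin.ext_iff.1 (congrFun h ⟨i, hi⟩)
  · rw [f.2.2.2 i hi, g.2.2.2 i hi]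

noncomputable instance : Fintype (RectPart n k) := Fintype.ofFinite _

theorem IsLRArray.finite {lam mu nu : ℕ → ℕ} : Finite {a // IsLRArray k lam mu nu a} := by
  refine Finite.of_injective
    (β := ∀ (i j : Fin k), Fin (nu i + 1))
    (fun a i j => ⟨a.1 i j, Nat.lt_succ_of_le ?_⟩) fun a b h =>
      Subtype.ext (funext fun i => funext fun j => ?_)
  · rw [← a.2.row i i.2]
    exact (Finset.single_le_sum (f := fun j => a.1 i j) (fun _ _ => Nat.zero_le _)
      (Finset.mem_range.2 j.2)).trans (Nat.le_add_left _ _)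
  · rcases lt_or_ge i k with hi | hi
    · rcases lt_or_ge j k with hj | hj
      · exact Fin.ext_iff.1 (congrFun (congrFun h ⟨i, hi⟩) ⟨j, hj⟩)
      · rw [a.2.eq_zero (by omega), b.2.eq_zero (by omega)]
    · rw [a.2.zero i j hi, b.2.zero i j hi]

/-- The Littlewood–Richardson coefficient. -/
noncomputable def lrCount (k : ℕ) (lam mu nu : ℕ → ℕ) : ℕ := Nat.card {a // IsLRArray k lam mu nu a}

/-- The generic positions in which a `k`-space of type `lam` meets a flag. -/
def pivotPos (hkn : k ≤ n) (lam : ℕ → ℕ) (j : Fin k) : Fin n :=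
  ⟨n - k + j - lam j, by omega⟩

theorem pivotPos_injective (hkn : k ≤ n) (lam : RectPart n k) :
    Function.Injective (pivotPos hkn lam) := by
  intro i j h
  have h : n - k + i - lam.1 i = n - k + j - lam.1 j := Fin.ext_iff.1 h
  have h1 := lam.2.2.1 i
  have h2 := lam.2.2.1 j
  rcases lt_trichotomy (i : ℕ) j with hij | hij | hij
  · have := lam.2.1 hij.le
    omega
  · exact Fin.ext hij
  · have := lam.2.1 hij.le
    omega

/-- A solution of a Schubert problem with a distinguished flag, in a basis adapted to that flag. -/
theorem IsSol.isState {H : Option ι → Matrix (Fin n) (Fin n) ℝ} {P : Option ι → Fin k → Fin n}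
    {x : Matrix (Fin k) (Fin n) ℝ} {A : Option ι → Matrix (Fin k) (Fin k) ℝ} (h : IsSol H P x A)
    (hH : IsUnit (H none)) (hA : IsUnit (A none)) {Sup NZ : Fin k → Fin n → Prop}
    (hSup : ∀ m r, ¬ Sup m r → P none m < r) (hNZ : ∀ m r, NZ m r → r = P none m) :
    IsState Sup NZ (fun l => (H none)⁻¹ * H (some l)) (fun l => P (some l))
      (A none * x * H none) (fun l => A (some l) * (A none)⁻¹) := by
  have eH : H none * (H none)⁻¹ = 1 :=
    Matrix.mul_nonsing_inv _ ((Matrix.isUnit_iff_isUnit_det _).1 hH)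
  have eA : (A none)⁻¹ * A none = 1 :=
    Matrix.nonsing_inv_mul _ ((Matrix.isUnit_iff_isUnit_det _).1 hA)
  have kH : ∀ (B : Matrix (Fin k) (Fin n) ℝ) l,
      B * H none * ((H none)⁻¹ * H (some l)) = B * H (some l) := by
    intro B l
    rw [Matrix.mul_assoc, ← Matrix.mul_assoc (H none), eH, Matrix.one_mul]
  have key : ∀ l, A (some l) * (A none)⁻¹ * (A none * x * H none) * ((H none)⁻¹ * H (some l)) =
      A (some l) * x * H (some l) := by
    intro l
    rw [← Matrix.mul_assoc _ (A none * x) (H none), kH, Matrix.mul_assoc (A (some l)),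
      ← Matrix.mul_assoc (A none)⁻¹, eA, Matrix.one_mul]
  refine ⟨fun m r hr => h.zero none m r (hSup m r hr), fun m r hr => ?_, fun l j r hr => ?_,
    fun l j => ?_, fun c0 c => ?_⟩
  · rw [hNZ m r hr]
    exact h.piv none m
  · rw [key]; exact h.zero (some l) j r hr
  · rw [key]; exact h.piv (some l) j
  · obtain ⟨x', A', hx'⟩ := h.reg fun o => o.elim c0 c
    refine ⟨A' none * x * H none + A none * x' * H none,
      fun l => (A' (some l) - A (some l) * (A none)⁻¹ * A' none) * (A none)⁻¹,
      fun m r hr => hx' none m r (hSup m r hr), fun l j r hr => ?_⟩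
    rw [← show _ = c l j r from hx' (some l) j r hr]
    simp only [rightMul_apply]
    refine congrFun (congrFun ?_ j) r
    have e1 : (A' (some l) - A (some l) * (A none)⁻¹ * A' none) * (A none)⁻¹ *
        (A none * x * H none * ((H none)⁻¹ * H (some l))) =
        A' (some l) * x * H (some l) - A (some l) * (A none)⁻¹ * A' none * x * H (some l) := by
      rw [kH, Matrix.mul_assoc _ (A none)⁻¹, Matrix.mul_assoc (A none),
        ← Matrix.mul_assoc (A none)⁻¹, eA, Matrix.one_mul, Matrix.sub_mul]
      simp only [Matrix.mul_assoc]
    have e2 : A (some l) * (A none)⁻¹ * ((A' none * x * H none + A none * x' * H none) *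
        ((H none)⁻¹ * H (some l))) = A (some l) * (A none)⁻¹ * A' none * x * H (some l) +
        A (some l) * x' * H (some l) := by
      rw [← Matrix.add_mul, kH, Matrix.add_mul, Matrix.mul_add]
      congr 1
      · simp only [Matrix.mul_assoc]
      · rw [Matrix.mul_assoc, ← Matrix.mul_assoc (A none)⁻¹, ← Matrix.mul_assoc (A none)⁻¹, eA,
          Matrix.one_mul, Matrix.mul_assoc]
    rw [e1, e2]
    abel

/-- The matrix reversing the order of the coordinates. -/
def revMat (n : ℕ) : Matrix (Fin n) (Fin n) ℝ := (1 : Matrix (Fin n) (Fin n) ℝ).submatrix id Fin.rev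

theorem mul_revMat (B : Matrix (Fin k) (Fin n) ℝ) (j : Fin k) (r : Fin n) :
    (B * revMat n) j r = B j r.rev := by
  simp [revMat, Matrix.mul_apply, Matrix.one_apply]

theorem revMat_mul (B : Matrix (Fin k) (Fin n) ℝ) (j : Fin k) (r : Fin n) :
    (revMat k * B) j r = B j.rev r := by
  have : ∀ i : Fin k, (j = i.rev) = (i = j.rev) := fun i =>
    propext (eq_comm.trans Fin.rev_eq_iff)
  simp [revMat, Matrix.mul_apply, Matrix.one_apply, this]

theorem isUnit_revMat : IsUnit (revMat n) := by
  have : revMat n * revMat n = 1 := by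
    ext i j
    rw [mul_revMat, revMat, Matrix.submatrix_apply, Fin.rev_rev]
    rfl
  exact IsUnit.of_mul_eq_one _ this

/-- A frame of a solution whose entries are supported between two positions in each row meets both
the flag of the basis and the opposite flag properly. -/
theorem IsState.isSol {H : ι → Matrix (Fin n) (Fin n) ℝ} {P : ι → Fin k → Fin n}
    {D : Matrix (Fin n) (Fin n) ℝ} (hD : IsUnit D) {v : Matrix (Fin k) (Fin n) ℝ}
    {A : ι → Matrix (Fin k) (Fin k) ℝ} {a b : Fin k → Fin n} (hab : ∀ m, a m ≤ b m)
    {Sup NZ : Fin k → Fin n → Prop}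
    (h : IsState Sup NZ (fun l => D⁻¹ * H l) P v A) (hSup : ∀ m x, Sup m x ↔ a m ≤ x ∧ x ≤ b m)
    (hNZa : ∀ m, NZ m (a m)) (hNZb : ∀ m, NZ m (b m)) :
    IsSol (fun o : Option (Option ι) => o.elim (D * revMat n) fun o' => o'.elim D H)
      (fun o => o.elim (fun m => (a m).rev) fun o' => o'.elim (fun m => b m.rev) P) (v * D⁻¹)
      (fun o => o.elim 1 fun o' => o'.elim (revMat k) A) := by
  have eD : D⁻¹ * D = 1 := Matrix.nonsing_inv_mul _ ((Matrix.isUnit_iff_isUnit_det _).1 hD)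
  have kD : ∀ C : Matrix (Fin k) (Fin n) ℝ, ∀ F : Matrix (Fin k) (Fin k) ℝ,
      F * (C * D⁻¹) * D = F * C := by
    intro C F
    rw [Matrix.mul_assoc, Matrix.mul_assoc, eD, Matrix.mul_one]
  have kM : ∀ C : Matrix (Fin k) (Fin n) ℝ, ∀ F : Matrix (Fin k) (Fin k) ℝ,
      F * (C * D⁻¹) * (D * revMat n) = F * C * revMat n := by
    intro C F
    rw [← Matrix.mul_assoc, kD]
  have kl : ∀ C : Matrix (Fin k) (Fin n) ℝ, ∀ (F : Matrix (Fin k) (Fin k) ℝ) l,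
      F * (C * D⁻¹) * H l = F * C * (D⁻¹ * H l) := by
    intro C F l
    simp only [Matrix.mul_assoc]
  refine ⟨?_, ?_, fun c => ?_⟩
  · rintro (_ | _ | l) j r hr
    · simp only [Option.elim] at hr ⊢
      rw [kM, Matrix.one_mul, mul_revMat]
      refine h.sup _ _ fun hs => ?_
      have := ((hSup _ _).1 hs).1
      rw [← Fin.rev_le_rev, Fin.rev_rev] at this
      exact absurd hr (not_lt.2 this)
    · simp only [Option.elim] at hr ⊢
      rw [kD, revMat_mul]
      exact h.sup _ _ fun hs => absurd hr (not_lt.2 ((hSup _ _).1 hs).2)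
    · simp only [Option.elim] at hr ⊢
      rw [kl]
      exact h.zero l j r hr
  · rintro (_ | _ | l) j
    · simp only [Option.elim]
      rw [kM, Matrix.one_mul, mul_revMat, Fin.rev_rev]
      exact h.nz _ _ (hNZa j)
    · simp only [Option.elim]
      rw [kD, revMat_mul]
      exact h.nz _ _ (hNZb _)
    · simp only [Option.elim]
      rw [kl]
      exact h.piv l j
  · obtain ⟨w, B, hw, hB⟩ := h.reg
      (Matrix.of fun m r => if b m < r then c (some none) m.rev r else c none m r.rev)
      (fun l => c (some (some l)))
    refine ⟨w * D⁻¹, fun o => o.elim 0 fun o' => o'.elim 0 B, ?_⟩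
    rintro (_ | _ | l) j r hr
    · simp only [Option.elim] at hr ⊢
      have hr' : r.rev < a j := by rwa [← Fin.rev_lt_rev, Fin.rev_rev]
      rw [kM, kM, Matrix.one_mul, Matrix.zero_mul, Matrix.zero_mul, zero_add, mul_revMat,
        hw _ _ fun hs => absurd hr' (not_lt.2 ((hSup _ _).1 hs).1), Matrix.of_apply,
        if_neg (not_lt.2 (hr'.le.trans (hab j))), Fin.rev_rev]
    · simp only [Option.elim] at hr ⊢
      rw [kD, kD, Matrix.zero_mul, zero_add, revMat_mul,
        hw _ _ fun hs => absurd hr (not_lt.2 ((hSup _ _).1 hs).2), Matrix.of_apply, if_pos hr,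
        Fin.rev_rev]
    · simp only [Option.elim] at hr ⊢
      have h1 := hB l j r hr
      rw [rightMul_apply, rightMul_apply, ← Matrix.mul_assoc (B l), ← Matrix.mul_assoc (A l)] at h1
      rw [kl, kl, h1]

end Cluster

section Achievable

variable {n k : ℕ} {ι : Type*}

/-- Some configuration of flags has, for all types `κ` at the same time, at least `q κ` transverse
solutions of the Schubert problem given by `κ`. -/
def Ach (hkn : k ≤ n) (ι : Type*) (q : (ι → RectPart n k) → ℕ) : Prop :=
  ∃ H : ι → Matrix (Fin n) (Fin n) ℝ, (∀ l, IsUnit (H l)) ∧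
    ∀ κ, (q κ : ℕ∞) ≤ (Sol H fun l => pivotPos hkn (κ l)).encard

theorem natCast_card_le_encard {α β : Type*} [Finite β] {s : Set α} (f : β → α)
    (hf : Function.Injective f) (hs : ∀ b, f b ∈ s) : ((Nat.card β : ℕ) : ℕ∞) ≤ s.encard :=
  (natCast_le_encard_iff s _).2
    ⟨f ∘ (Finite.equivFin β).symm, hf.comp (Finite.equivFin β).symm.injective, fun _ => hs _⟩

theorem supAt_zero {T : ℕ → ℕ → ℕ} {m : Fin k} {x : Fin n} :
    SupAt T n k 0 m x ↔ T m m ≤ x.val ∧ x.val ≤ T m k := by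
  simp only [SupAt, moveCount_zero, Nat.not_lt_zero, false_or, Labelled, Nat.zero_le, and_true,
    true_and]
  refine ⟨fun ⟨r, h1, h2⟩ => ?_, fun h1 => ⟨m, ⟨le_rfl, rfl⟩, h1⟩⟩
  rw [← h1.2]
  exact h2

theorem supAt_top {T : ℕ → ℕ → ℕ} {m : Fin k} {x : Fin n}
    (hx : ¬ SupAt T n k n m x) : moveCount T m n ≤ x.val :=
  not_lt.1 fun hc => hx (Or.inl hc)

theorem nzAt_top {T : ℕ → ℕ → ℕ} {m : Fin k} {x : Fin n} (h : IsPattern n k T)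
    (hx : NZAt T n k n m x) : x.val = moveCount T m n - 1 := by
  rcases hx with hx | ⟨r, ⟨h1, -, h2⟩, -⟩
  · rwa [leadPos, if_neg (not_le.2 (h.lt m m m.2 le_rfl m.2.le))] at hx
  · exact absurd h2 (not_le.2 (h.lt r (m + 1) (by omega) (by omega) m.2))

theorem Ach.cluster [Finite ι] {hkn : k ≤ n} {q : (Option ι → RectPart n k) → ℕ}
    (h : Ach hkn (Option ι) q) :
    Ach hkn (Option (Option ι)) fun κ => ∑ ν : RectPart n k,
      lrCount k (κ none) (κ (some none)) ν * q fun o => o.elim ν fun l => κ (some (some l)) := by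
  have := Fintype.ofFinite ι
  obtain ⟨H, hH, hq⟩ := h
  choose V hVinj hV using fun κ => (natCast_le_encard_iff _ _).1 (hq κ)
  choose x A hsol hrow using hV
  have hfin : ∀ lam mu nu : ℕ → ℕ, Finite {a // IsLRArray k lam mu nu a} := fun _ _ _ =>
    IsLRArray.finite
  let ext : RectPart n k → (ι → RectPart n k) → Option ι → RectPart n k := fun ν κ o => o.elim ν κ
  let Br : RectPart n k × RectPart n k × (ι → RectPart n k) → Type := fun p =>
    (ν : RectPart n k) × {a // IsLRArray k p.1 p.2.1 ν a} × Fin (q (ext ν p.2.2))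
  let T : (p : _) × Br p → ℕ → ℕ → ℕ := fun ω => lrPattern n k ω.1.1 ω.2.2.1.1
  have hT : ∀ ω, IsPattern n k (T ω) := fun ω =>
    ω.2.2.1.2.isPattern hkn ω.1.1.2 ω.1.2.1.2.2.1 (ω.2.1.2.2.1 0)
  have hmc : ∀ (ω) (m : Fin k), moveCount (T ω) m n = n - k + m - ω.2.1.1 m + 1 := fun ω m =>
    ω.2.2.1.2.moveCount_eq hkn ω.1.1.2 ω.1.2.1.2.2.1 ω.2.1.2.2.1 m.2
  have hunit : ∀ κ i, IsUnit (A κ i none) := fun κ i =>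
    (hsol κ i).isUnit none (pivotPos_injective hkn (κ none))
  have hst : ∀ ω : (p : _) × Br p, IsState (SupAt (T ω) n k n) (NZAt (T ω) n k n)
      (fun l => (H none)⁻¹ * H (some l)) (fun l => pivotPos hkn (ω.1.2.2 l))
      (A _ ω.2.2.2 none * x _ ω.2.2.2 * H none)
      (fun l => A _ ω.2.2.2 (some l) * (A _ ω.2.2.2 none)⁻¹) := by
    intro ω
    refine (hsol _ ω.2.2.2).isState (hH none) (hunit _ _) (fun m r hr => ?_) fun m r hr => ?_
    · have h1 := supAt_top hr
      rw [hmc] at h1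
      rw [Fin.lt_def]
      exact h1
    · have h1 := nzAt_top (hT ω) hr
      rw [hmc, Nat.add_sub_cancel] at h1
      exact Fin.ext h1
  obtain ⟨D, hD, v, B, hv, hsep⟩ := exists_deformation hT (hH none) hst (Nat.zero_le n)
  refine ⟨fun o => o.elim (D * revMat n) fun o' => o'.elim D fun l => H (some l), ?_, fun κ => ?_⟩
  · rintro (_ | _ | l)
    exacts [hD.mul isUnit_revMat, hD, hH _]
  let p : RectPart n k × RectPart n k × (ι → RectPart n k) :=
    (κ none, κ (some none), fun l => κ (some (some l)))
  have hcard : Nat.card (Br p) = ∑ ν : RectPart n k,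
      lrCount k (κ none) (κ (some none)) ν * q fun o => o.elim ν fun l => κ (some (some l)) := by
    simp only [Br, Nat.card_sigma, Nat.card_prod, Nat.card_fin]
    rfl
  refine (congrArg (fun q : ℕ => (q : ℕ∞)) hcard).symm.le.trans ?_
  have hD' : IsUnit D⁻¹ := by rwa [Matrix.isUnit_nonsing_inv_iff]
  refine natCast_card_le_encard (fun b => rowSp (v ⟨p, b⟩ * D⁻¹)) (fun b b' hbb => ?_) fun b => ?_
  · by_contra hne
    refine hsep ⟨p, b⟩ ⟨p, b'⟩ ?_ ((rowSp_mul_right_inj hD').1 hbb)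
    by_contra! hcon
    obtain ⟨hrow0, hrange⟩ := hcon
    have hdiag : ∀ m < k, T ⟨p, b⟩ m m = T ⟨p, b'⟩ m m := fun m _ => by
      simp only [T, lrPattern_self]
    have hTT : ∀ r m, r ≤ m → r < k → m ≤ k → T ⟨p, b⟩ r m = T ⟨p, b'⟩ r m := fun r m h1 h2 h3 =>
      (hT ⟨p, b⟩).eq_of_moveCount_eq (hT ⟨p, b'⟩) hdiag (fun m hm Y hY =>
        (hT ⟨p, b⟩).moveCount_eq (hT ⟨p, b'⟩) hdiag hY (hrange Y hY (Nat.zero_le _)) hm) h1 h2 h3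
    obtain ⟨ν, ⟨a, ha⟩, i⟩ := b
    obtain ⟨ν', ⟨a', ha'⟩, i'⟩ := b'
    obtain rfl : a = a' :=
      ha.eq_of_pattern hkn (κ (some none)).2.2.1 (κ (some none)).2.2.1 ha' hTT
    obtain rfl : ν = ν' := by
      refine Subtype.ext (funext fun i => ?_)
      rcases lt_or_ge i k with hi | hi
      · rw [← ha.row i hi, ← ha'.row i hi]
      · rw [ν.2.2.2 i hi, ν'.2.2.2 i hi]
    refine hne ?_
    rw [rowSp_mul_right_inj (hH none), rowSp_mul (hunit _ _), rowSp_mul (hunit _ _), hrow, hrow]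
      at hrow0
    have hi : i = i' := hVinj _ hrow0
    rw [hi]
  · have hle : ∀ m : Fin k, T ⟨p, b⟩ m m ≤ T ⟨p, b⟩ m k := fun m =>
      (hT _).mono le_rfl m.2.le le_rfl
    let aa : Fin k → Fin n := fun m => ⟨T ⟨p, b⟩ m m, (hT _).lt _ _ m.2 le_rfl m.2.le⟩
    let bb : Fin k → Fin n := fun m => ⟨T ⟨p, b⟩ m k, (hT _).lt _ _ m.2 m.2.le le_rfl⟩
    have hs := (hv ⟨p, b⟩).isSol (a := aa) (b := bb) hD hle (fun m x => supAt_zero)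
      (fun m => Or.inl (by rw [leadPos, if_pos (Nat.zero_le _)]))
      (fun m => Or.inr ⟨m, ⟨le_rfl, Or.inr rfl, Nat.zero_le _⟩, rfl⟩)
    refine ⟨_, fun o => o.elim 1 fun o' => o'.elim (revMat k) (B ⟨p, b⟩), ?_, rfl⟩
    convert hs using 1
    funext o
    rcases o with _ | _ | l
    · funext m
      refine Fin.ext ?_
      simp only [pivotPos, Option.elim, Fin.val_rev, aa, T, lrPattern_self]
      have h1 := (κ none).2.2.1 m
      have h2 := m.2
      change n - k + m - (κ none).1 m = n - (k - 1 - m + (κ none).1 m + 1)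
      omega
    · funext m
      refine Fin.ext ?_
      have h1 := (κ (some none)).2.2.1 m
      have h2 := m.2
      have h3 : ((m.rev : Fin k) : ℕ) = k - (m + 1) := Fin.val_rev m
      have h4 := b.2.1.2.content (k - 1 - m.rev)
      simp only [pivotPos, Option.elim, bb, T, lrPattern]
      rw [if_neg (by omega), h4, h3]
      change n - k + m - (κ (some none)).1 m =
        n - 1 - (k - (m + 1)) - (κ (some none)).1 (k - 1 - (k - (m + 1)))
      rw [show k - 1 - (k - ((m : ℕ) + 1)) = m by omega]
      omega
    · rfl

end Achievable

section Iterated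

variable {n k : ℕ}

theorem Ach.transport {hkn : k ≤ n} {ι ι' : Type*} {q : (ι → RectPart n k) → ℕ}
    {q' : (ι' → RectPart n k) → ℕ} (h : Ach hkn ι q) {g : ι' → ι} (hg : Function.Injective g)
    (hq : ∀ κ', ∃ κ, (fun l => κ (g l)) = κ' ∧ q' κ' ≤ q κ) : Ach hkn ι' q' := by
  obtain ⟨H, hH, h⟩ := h
  refine ⟨fun l => H (g l), fun l => hH _, fun κ' => ?_⟩
  obtain ⟨κ, rfl, hle⟩ := hq κ'
  exact (Nat.cast_le.2 hle).trans ((h κ).trans (Set.encard_le_encard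
    (Sol_comp_subset hg H fun l => pivotPos hkn (κ l))))

/-- The number of chains of Littlewood–Richardson arrays from the first partition to the full
rectangle, with the other partitions as contents. -/
noncomputable def chainCount (n k : ℕ) : (p : ℕ) → (Fin (p + 1) → RectPart n k) → ℕ
  | 0, κ => if (κ 0).1 = rectFull n k then 1 else 0
  | p + 1, κ => ∑ ν : RectPart n k, lrCount k (κ 0) (κ 1) ν *
      chainCount n k p (Fin.cons ν fun i : Fin p => κ i.succ.succ)

/-- Clustering, for a flag with any index. -/
theorem Ach.split {ι : Type*} [Finite ι] {hkn : k ≤ n} {q : (ι → RectPart n k) → ℕ}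
    (h : Ach hkn ι q) (i : ι) :
    Ach hkn (Option ι) fun κ => ∑ ν : RectPart n k, lrCount k (κ (some i)) (κ none) ν *
      q (Function.update (fun l => κ (some l)) i ν) := by
  have e1 : Ach hkn (Option {l // l ≠ i}) fun κ => q fun l => if h : l = i then κ none else
      κ (some ⟨l, h⟩) := by
    refine h.transport (g := fun o => o.elim i Subtype.val) ?_ fun κ => ⟨_, funext ?_, le_rfl⟩
    · rintro (_ | ⟨l, hl⟩) (_ | ⟨l', hl'⟩) hll
      · rfl
      · exact absurd hll.symm hl'
      · exact absurd hll hl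
      · simpa using hll
    · rintro (_ | ⟨l, hl⟩)
      · simp
      · simp [hl]
  refine e1.cluster.transport
    (g := fun o => o.elim (some none) fun l => if h : l = i then none else some (some ⟨l, h⟩)) ?_
    fun κ => ⟨fun o => o.elim (κ (some i)) fun o' => o'.elim (κ none) fun l => κ (some l),
      funext ?_, ?_⟩
  · rintro (_ | l) (_ | l') hll
    · rfl
    · exfalso
      by_cases h : l' = i <;> simp [h] at hll
    · exfalso
      by_cases h : l = i <;> simp [h] at hll
    · by_cases h : l = i <;> by_cases h' : l' = i <;> simp [h, h'] at hll ⊢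
      exact hll
  · rintro (_ | l)
    · simp
    · by_cases h : l = i <;> simp [h]
  · refine Finset.sum_le_sum fun ν _ => Nat.mul_le_mul le_rfl (le_of_eq (congrArg q (funext ?_)))
    intro l
    by_cases h : l = i
    · subst h; simp
    · simp [h]

theorem Ach.base (hkn : k ≤ n) : Ach hkn (Fin 1) (chainCount n k 0) := by
  refine ⟨fun _ => 1, fun _ => isUnit_one, fun κ => ?_⟩
  rw [chainCount]
  split_ifs with h
  · rw [Nat.cast_one, Set.one_le_encard_iff_nonempty]
    have hp : ∀ j : Fin k, (pivotPos hkn (κ 0) j : ℕ) = j := fun j => by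
      simp only [pivotPos, h, rectFull, if_pos j.2]
      omega
    have hl : ∀ l : Fin 1, l = 0 := fun l => Subsingleton.elim _ _
    refine ⟨_, Matrix.of fun j r => if (r : ℕ) = j then 1 else 0, 1, ⟨fun l j r hr => ?_,
      fun l j => ?_, fun c => ⟨c 0, 0, fun l j r _ => ?_⟩⟩, rfl⟩
    · rw [hl l, Fin.lt_def, hp] at hr
      simp [hr.ne']
    · rw [hl l]
      simp [hp]
    · rw [hl l]
      simp
  · simp

theorem Ach.of_chainCount (hkn : k ≤ n) (p : ℕ) : Ach hkn (Fin (p + 1)) (chainCount n k p) := by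
  induction p with
  | zero => exact Ach.base hkn
  | succ p ih =>
    refine (ih.split 0).transport
      (g := Fin.cons (some 0) (Fin.cons none fun l : Fin p => some l.succ)) ?_
      fun κ => ⟨fun o => o.elim (κ 1) (Fin.cons (κ 0) fun l => κ l.succ.succ), funext ?_, ?_⟩
    · rw [Fin.cons_injective_iff, Fin.cons_injective_iff]
      refine ⟨?_, ?_, fun a b h => by simpa using h⟩
      · rintro ⟨l, hl⟩
        induction l using Fin.cases with
        | zero => simp at hl
        | succ l => simp [Fin.succ_ne_zero] at hl
      · rintro ⟨l, hl⟩
        simp at hl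
    · intro l
      induction l using Fin.cases with
      | zero => simp
      | succ l =>
        induction l using Fin.cases with
        | zero => simp
        | succ l => simp
    · rw [chainCount]
      refine Finset.sum_le_sum fun ν _ => le_of_eq ?_
      refine congrArg _ (congrArg _ (funext fun l => ?_))
      induction l using Fin.cases with
      | zero => simp
      | succ l => simp

end Iterated

section Insertion

/-- The path along which the row index `r` is inserted into the array `a`. -/
structure IsInsertionPath (k : ℕ) (a : ℕ → ℕ → ℕ) (R : ℕ → ℕ) : Prop where
  le : ∀ j, R j ≤ k
  mono : ∀ j, R j ≤ R (j + 1)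
  lt : ∀ j, R j < k → R j < R (j + 1)
  pos : ∀ j, R (j + 1) < k → 0 < a (R (j + 1)) j
  gap : ∀ i j, R j < i → i < R (j + 1) → a i j = 0

theorem exists_isInsertionPath {k r : ℕ} (hr : r < k) (a : ℕ → ℕ → ℕ) :
    ∃ R, R 0 = r ∧ IsInsertionPath k a R := by
  let S : ℕ → ℕ → Set ℕ := fun b j => {i | i = k ∨ i < k ∧ b < i ∧ 0 < a i j}
  have hk : ∀ b j, k ∈ S b j := fun _ _ => Or.inl rfl
  let R : ℕ → ℕ := fun j => Nat.rec r (fun j b => sInf (S b j)) j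
  have hmem : ∀ j, R (j + 1) ∈ S (R j) j := fun j => Nat.sInf_mem ⟨k, hk _ _⟩
  have hle : ∀ j, R j ≤ k := by
    rintro (_ | j)
    · exact hr.le
    · exact Nat.sInf_le (hk _ _)
  refine ⟨R, rfl, hle, fun j => ?_, fun j hj => ?_, fun j hj => ?_, fun i j h1 h2 => ?_⟩
  · rcases hmem j with h | h
    · exact (hle j).trans h.ge
    · exact h.2.1.le
  · rcases hmem j with h | h
    · rwa [h]
    · exact h.2.1
  · rcases hmem j with h | h
    · exact absurd h hj.ne
    · exact h.2.2
  · by_contra h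
    exact absurd (Nat.sInf_le (show i ∈ S (R j) j from
      Or.inr ⟨h2.trans_le (hle (j + 1)), h1, Nat.pos_of_ne_zero h⟩)) (not_le.2 h2)

/-- The array after the insertion along the path `R`. -/
def insertArray (k : ℕ) (a : ℕ → ℕ → ℕ) (R : ℕ → ℕ) (i j : ℕ) : ℕ :=
  if i < k then a i j + (if i = R j then 1 else 0) - (if i = R (j + 1) then 1 else 0) else 0

namespace IsInsertionPath

variable {k : ℕ} {a : ℕ → ℕ → ℕ} {R : ℕ → ℕ}

theorem insertArray_add (h : IsInsertionPath k a R) {i : ℕ} (hi : i < k) (j : ℕ) :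
    insertArray k a R i j + (if i = R (j + 1) then 1 else 0) =
      a i j + if i = R j then 1 else 0 := by
  rw [insertArray, if_pos hi]
  by_cases h1 : i = R (j + 1)
  · have := h.pos j (h1 ▸ hi)
    rw [← h1] at this
    rw [if_pos h1]
    omega
  · rw [if_neg h1]
    omega

theorem row_sum (h : IsInsertionPath k a R) {i : ℕ} (hi : i < k) (j : ℕ) :
    ∑ q ∈ Finset.range j, insertArray k a R i q + (if i = R j then 1 else 0) =
      ∑ q ∈ Finset.range j, a i q + if i = R 0 then 1 else 0 := by
  induction j with
  | zero => simp
  | succ j ih =>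
    have := h.insertArray_add hi j
    rw [Finset.sum_range_succ, Finset.sum_range_succ]
    omega

theorem column_sum (h : IsInsertionPath k a R) {i : ℕ} (hi : i ≤ k) (j : ℕ) :
    ∑ p ∈ Finset.range i, insertArray k a R p j + (if R (j + 1) < i then 1 else 0) =
      ∑ p ∈ Finset.range i, a p j + if R j < i then 1 else 0 := by
  induction i with
  | zero => simp
  | succ i ih =>
    have h1 := h.insertArray_add (show i < k by omega) j
    have h2 := ih (by omega)
    rw [Finset.sum_range_succ, Finset.sum_range_succ]
    have h3 : ∀ b,
        (if b < i + 1 then 1 else 0) = (if b < i then 1 else 0) + if i = b then 1 else 0 :=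
      fun b => by split_ifs <;> omega
    rw [h3, h3]
    omega

theorem add_le (h : IsInsertionPath k a R) {j : ℕ} (hj : R j < k) : R 0 + j ≤ R j := by
  induction j with
  | zero => simp
  | succ j ih =>
    have h1 := (h.mono j).trans_lt hj
    have h2 := ih h1
    have h3 := h.lt j h1
    omega

theorem monotone (h : IsInsertionPath k a R) : Monotone R := monotone_nat_of_le_succ h.mono

theorem exists_last (h : IsInsertionPath k a R) (h0 : R 0 < k) :
    ∃ q, R q < k ∧ R (q + 1) = k := by
  by_contra! hcon
  have : ∀ j, R j < k := fun j => by
    induction j with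
    | zero => exact h0
    | succ j ih => exact (h.le _).lt_of_ne (hcon j ih)
  have h1 := h.add_le (this k)
  have h2 := this k
  omega

theorem isLRArray (h : IsInsertionPath k a R) {lam kap nu : ℕ → ℕ} (hlam : Antitone lam) {q : ℕ}
    (hq : R q < k) (hq' : R (q + 1) = k) (ha : IsLRArray k (lam + Pi.single (R 0) 1) kap nu a) :
    IsLRArray k lam (kap + Pi.single q 1) nu (insertArray k a R) := by
  have hlast : ∀ j, R j < k ↔ j ≤ q := fun j =>
    ⟨fun hj => by by_contra! hc; have := h.monotone (show q + 1 ≤ j from hc); omega,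
      fun hj => (h.monotone hj).trans_lt hq⟩
  have hsing : ∀ i, (lam + Pi.single (R 0) 1 : ℕ → ℕ) i =
      lam i + if i = R 0 then 1 else 0 := fun i => by
    rw [Pi.add_apply, Pi.single_apply]
  refine ⟨fun i j hi => if_neg (not_lt.2 hi), fun i hi => ?_, fun j => ?_, fun i j hi => ?_,
    fun i j hi => ?_⟩
  · have h1 := h.row_sum hi k
    have h2 := ha.row i hi
    rw [hsing] at h2
    have h3 : R k = k := by
      refine (h.le k).antisymm (not_lt.1 fun hc => ?_)
      have := h.add_le hc
      omega
    rw [if_neg (by omega)] at h1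
    omega
  · have h1 := h.column_sum le_rfl j
    have h2 := ha.content j
    simp only [hlast] at h1
    rw [Pi.add_apply, Pi.single_apply]
    split_ifs at h1 ⊢ <;> omega
  · have h1 := h.row_sum hi (j + 1)
    have h2 := h.row_sum (show i < k by omega) j
    have h3 := ha.column i j hi
    rw [hsing, hsing] at h3
    by_cases e1 : i = R j
    · by_cases e2 : i + 1 = R (j + 1)
      · rw [if_pos e2] at h1
        rw [if_pos e1] at h2
        omega
      · have h4 : a (i + 1) j = 0 := h.gap _ _ (by omega) (by
          have := h.lt j (by omega)
          omega)
        rw [if_neg e2, Finset.sum_range_succ (a (i + 1)), h4] at h1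
        rw [if_pos e1] at h2
        rcases j with _ | j
        · have : lam (i + 1) ≤ lam i := hlam (Nat.le_succ i)
          simp only [Finset.range_zero, Finset.sum_empty] at h1 h2 ⊢
          split_ifs at h1 h2 <;> omega
        · have h5 := ha.column i j hi
          have h6 := h.pos j (by omega)
          rw [← e1] at h6
          rw [hsing, hsing] at h5
          rw [Finset.sum_range_succ (a i)] at h2
          omega
    · rw [if_neg e1] at h2
      split_ifs at h1 h2 h3 <;> omega
  · have h1 := h.column_sum (show i + 1 ≤ k from hi) (j + 1)
    have h2 := h.column_sum hi.le j
    have h3 := ha.lattice i j hi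
    have h4 := h.mono j
    have h5 := h.mono (j + 1)
    by_cases e : R (j + 1) < i ∧ i < R (j + 1 + 1)
    · have h6 : ∑ i' ∈ Finset.range (i + 1), a i' (j + 1) =
          ∑ i' ∈ Finset.range (R (j + 1) + 1), a i' (j + 1) := by
        refine (Finset.sum_subset (Finset.range_mono (by omega)) fun i' h1 h2 => ?_).symm
        simp only [Finset.mem_range, not_lt] at h1 h2
        exact h.gap _ _ (by omega) (by omega)
      have h7 : ∑ i' ∈ Finset.range (R (j + 1) + 1), a i' j ≤ ∑ i' ∈ Finset.range i, a i' j :=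
        Finset.sum_le_sum_of_subset (Finset.range_mono (by omega))
      have h8 := ha.lattice (R (j + 1)) j (by omega)
      have h9 := h.pos j (by omega)
      rw [Finset.sum_range_succ] at h7
      split_ifs at h1 h2 <;> omega
    · have h6 := h.lt j
      have h7 := h.lt (j + 1)
      split_ifs at h1 h2 <;> omega

theorem pos_insertArray (h : IsInsertionPath k a R) {j : ℕ} (hj : R j < k) :
    0 < insertArray k a R (R j) j := by
  have h1 := h.insertArray_add hj j
  have h2 := h.lt j hj
  rw [if_neg h2.ne, if_pos rfl] at h1
  omega

theorem insertArray_eq_zero (h : IsInsertionPath k a R) {i j : ℕ} (h1 : R j < i)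
    (h2 : i < R (j + 1)) : insertArray k a R i j = 0 := by
  have h3 := h.insertArray_add (h2.trans_le (h.le _)) j
  rw [if_neg h2.ne, if_neg h1.ne', h.gap i j h1 h2] at h3
  exact h3

/-- The insertion path can be recovered from the resulting array and its last column. -/
theorem path_eq {a' : ℕ → ℕ → ℕ} {R' : ℕ → ℕ} (h : IsInsertionPath k a R)
    (h' : IsInsertionPath k a' R') (he : insertArray k a R = insertArray k a' R') {q : ℕ}
    (hq : R q < k) (hq' : R (q + 1) = k) (hs : R' q < k) (hs' : R' (q + 1) = k) : R = R' := by
  have hstep : ∀ j, R j < k → R' j < k → R (j + 1) = R' (j + 1) → R j = R' j := by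
    intro j h1 h2 h3
    have p1 := h.pos_insertArray h1
    have p2 := h'.pos_insertArray h2
    rcases lt_trichotomy (R j) (R' j) with h4 | h4 | h4
    · rw [← he, h.insertArray_eq_zero h4 (h3 ▸ h'.lt j h2)] at p2
      exact absurd p2 (lt_irrefl _)
    · exact h4
    · rw [he, h'.insertArray_eq_zero h4 (h3 ▸ h.lt j h1)] at p1
      exact absurd p1 (lt_irrefl _)
  funext j
  rcases le_or_gt j q with hj | hj
  · obtain ⟨d, rfl⟩ := Nat.exists_eq_add_of_le hj
    have : ∀ e ≤ d, R (j + (d - e)) = R' (j + (d - e)) := fun e => by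
      induction e with
      | zero => exact fun _ => hstep _ hq hs (hq'.trans hs'.symm)
      | succ e ih =>
        intro he
        refine hstep _ ((h.monotone (by omega)).trans_lt hq)
          ((h'.monotone (by omega)).trans_lt hs) ?_
        rw [show j + (d - (e + 1)) + 1 = j + (d - e) by omega]
        exact ih (by omega)
    simpa using this d le_rfl
  · have h1 := h.monotone (Nat.succ_le_of_lt hj)
    have h2 := h'.monotone (Nat.succ_le_of_lt hj)
    have h3 := h.le j
    have h4 := h'.le j
    simp only [Nat.succ_eq_add_one] at h1 h2
    omega

theorem array_eq {a' : ℕ → ℕ → ℕ} (h : IsInsertionPath k a R) (h' : IsInsertionPath k a' R)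
    (ha : ∀ i j, k ≤ i → a i j = 0) (ha' : ∀ i j, k ≤ i → a' i j = 0)
    (he : insertArray k a R = insertArray k a' R) : a = a' := by
  funext i j
  rcases lt_or_ge i k with hi | hi
  · have h1 := h.insertArray_add hi j
    have h2 := h'.insertArray_add hi j
    rw [he] at h1
    omega
  · rw [ha i j hi, ha' i j hi]

end IsInsertionPath
end Insertion

section StandardTableaux

variable {n k : ℕ}

/-- The partition `mu` is obtained from `lam` by adding a box. -/
def AddBox (lam mu : ℕ → ℕ) : Prop := ∃ i, mu = lam + Pi.single i 1

theorem isRectPartition_zero : IsRectPartition n k 0 :=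
  ⟨fun _ _ _ => le_rfl, fun _ => Nat.zero_le _, fun _ _ => rfl⟩

theorem isRectPartition_box (hk : 0 < k) (hn : k < n) :
    IsRectPartition n k (Pi.single 0 1) := by
  refine ⟨antitone_nat_of_succ_le fun j => ?_, fun i => ?_, fun i hi => ?_⟩
  · rw [Pi.single_eq_of_ne (Nat.succ_ne_zero j)]
    exact Nat.zero_le _
  · rw [Pi.single_apply]
    split_ifs <;> omega
  · rw [Pi.single_eq_of_ne (by omega)]

theorem isRectPartition_rectFull : IsRectPartition n k (rectFull n k) := by
  refine ⟨antitone_nat_of_succ_le fun j => ?_, fun i => ?_, fun i hi => if_neg (not_lt.2 hi)⟩ <;>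
  · simp only [rectFull]
    split_ifs <;> omega

theorem AddBox.index_lt {lam mu : ℕ → ℕ} (hmu : IsRectPartition n k mu) {i : ℕ}
    (h : mu = lam + Pi.single i 1) : i < k ∧ k < n := by
  have h1 : mu i = lam i + 1 := by simp [h]
  have h2 := hmu.2.1 i
  refine ⟨not_le.1 fun hc => ?_, by omega⟩
  rw [hmu.2.2 i hc] at h1
  omega

/-- The number of chains of partitions from the empty one, each obtained from the previous one by
adding a box. -/
noncomputable def sytCount (n k : ℕ) : ℕ → RectPart n k → ℕ
  | 0, ν => if ν.1 = 0 then 1 else 0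
  | d + 1, ν => ∑ lam : RectPart n k, if AddBox lam ν then sytCount n k d lam else 0

theorem RectPart.exists_add_single (ν : RectPart n k) {i : ℕ} (hi : ν.1 (i + 1) < ν.1 i) :
    ∃ lam : RectPart n k, ν.1 = lam.1 + Pi.single i 1 := by
  have hadd : ν.1 = Function.update ν.1 i (ν.1 i - 1) + Pi.single i 1 := by
    funext j
    rw [Pi.add_apply, Function.update_apply, Pi.single_apply]
    split_ifs with h2
    · rw [h2]; omega
    · rfl
  refine ⟨⟨Function.update ν.1 i (ν.1 i - 1), antitone_nat_of_succ_le fun j => ?_, fun j => ?_,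
    fun j hj => ?_⟩, hadd⟩
  · have h1 := ν.2.1 (Nat.le_succ j)
    rw [Function.update_apply, Function.update_apply]
    simp only [Nat.succ_eq_add_one] at h1
    split_ifs with h2 h3 h3
    · omega
    · rw [← h2]; omega
    · subst h3; omega
    · exact h1
  · have h1 := ν.2.2.1 j
    rw [Function.update_apply]
    split_ifs with h2
    · rw [← h2]; omega
    · exact h1
  · rw [Function.update_of_ne, ν.2.2.2 j hj]
    rintro rfl
    rw [ν.2.2.2 j hj] at hi
    omega

theorem sytCount_pos {d : ℕ} {ν : RectPart n k} (hd : ∑ i ∈ Finset.range k, ν.1 i = d) :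
    0 < sytCount n k d ν := by
  induction d generalizing ν with
  | zero =>
    rw [sytCount, if_pos]
    · exact Nat.one_pos
    · funext i
      rcases lt_or_ge i k with hi | hi
      · exact Finset.sum_eq_zero_iff.1 hd i (Finset.mem_range.2 hi)
      · exact ν.2.2.2 i hi
  | succ d ih =>
    have hex : ∃ i, i < k ∧ ν.1 (i + 1) < ν.1 i := by
      by_contra! hcon
      have h0 : ∀ j ≤ k, ν.1 (k - j) = 0 := fun j => by
        induction j with
        | zero => exact fun _ => ν.2.2.2 _ le_rfl
        | succ j ihj =>
          intro hj
          have h1 := hcon (k - (j + 1)) (by omega)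
          rw [show k - (j + 1) + 1 = k - j by omega, ihj (by omega)] at h1
          omega
      rw [Finset.sum_eq_zero fun i hi => ?_] at hd
      · omega
      · rw [Finset.mem_range] at hi
        have := h0 (k - i) (by omega)
        rwa [show k - (k - i) = i by omega] at this
    obtain ⟨i, hi, hlt⟩ := hex
    obtain ⟨lam, hadd⟩ := ν.exists_add_single hlt
    have hsum : ∑ j ∈ Finset.range k, lam.1 j = d := by
      rw [hadd] at hd
      simp only [Pi.add_apply, Finset.sum_add_distrib, Finset.sum_pi_single', Finset.mem_range,
        hi, if_true] at hd
      omega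
    refine (ih (ν := lam) hsum).trans_le ?_
    rw [sytCount]
    refine le_trans ?_ (Finset.single_le_sum (fun _ _ => Nat.zero_le _)
      (Finset.mem_univ lam))
    rw [if_pos ⟨i, hadd⟩]

theorem IsLRArray.isRectPartition (hk : 0 < k) {lam mu nu : ℕ → ℕ} {a : ℕ → ℕ → ℕ}
    (h : IsLRArray k lam mu nu a) (hnu : nu 0 ≤ n - k) : IsRectPartition n k mu := by
  obtain ⟨k, rfl⟩ : ∃ k', k = k' + 1 := ⟨k - 1, by omega⟩
  have hanti : Antitone mu := antitone_nat_of_succ_le fun j => by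
    rw [← h.content j, ← h.content (j + 1)]
    refine (h.lattice k j (Nat.lt_succ_self k)).trans ?_
    rw [Finset.sum_range_succ]
    exact Nat.le_add_right _ _
  refine ⟨hanti, fun i => (hanti (Nat.zero_le i)).trans ?_, fun i hi => ?_⟩
  · have := h.first_column_le (Nat.lt_succ_self k)
    rw [h.content] at this
    omega
  · rw [← h.content i]
    refine Finset.sum_eq_zero fun p hp => h.eq_zero ?_
    rw [Finset.mem_range] at hp
    omega

theorem natCard_and {α : Type*} (P : Prop) (Q : α → Prop) :
    Nat.card {a // P ∧ Q a} = if P then Nat.card {a // Q a} else 0 := by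
  split_ifs with h
  · simp [h]
  · simp [h]

theorem sum_lrCount_addBox_le (lam kap nu : RectPart n k) :
    (∑ lam' : RectPart n k, if AddBox lam lam' then lrCount k lam' kap nu else 0) ≤
      ∑ kap' : RectPart n k, if AddBox kap kap' then lrCount k lam kap' nu else 0 := by
  simp only [lrCount, ← natCard_and]
  have hfin : ∀ (P : Prop) (lam kap nu : RectPart n k),
      Finite {a // P ∧ IsLRArray k lam kap nu a} := fun P lam kap nu => by
    have := IsLRArray.finite (k := k) (lam := lam.1) (mu := kap.1) (nu := nu.1)
    exact Finite.of_injective (β := {a // IsLRArray k lam kap nu a}) (fun a => ⟨a.1, a.2.2⟩)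
      fun a b h => Subtype.ext (Subtype.mk.inj h)
  rw [← Nat.card_sigma, ← Nat.card_sigma]
  have key : ∀ x : (lam' : RectPart n k) × {a // AddBox lam lam' ∧ IsLRArray k lam' kap nu a},
      ∃ (R : ℕ → ℕ) (q : ℕ) (y : (kap' : RectPart n k) ×
        {a // AddBox kap kap' ∧ IsLRArray k lam kap' nu a}),
        IsInsertionPath k x.2.1 R ∧ x.1.1 = lam.1 + Pi.single (R 0) 1 ∧ R q < k ∧ R (q + 1) = k ∧
        y.1.1 = kap.1 + Pi.single q 1 ∧ y.2.1 = insertArray k x.2.1 R := by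
    rintro ⟨lam', a, ⟨r, hr⟩, ha⟩
    have hrk := (AddBox.index_lt lam'.2 hr).1
    obtain ⟨R, rfl, hR⟩ := exists_isInsertionPath hrk a
    obtain ⟨q, hq, hq'⟩ := hR.exists_last hrk
    rw [hr] at ha
    have h := hR.isLRArray lam.2.1 hq hq' ha
    exact ⟨R, q, ⟨⟨_, h.isRectPartition (by omega) (nu.2.2.1 0)⟩, _, ⟨q, rfl⟩, h⟩, hR, hr, hq, hq',
      rfl, rfl⟩
  choose R q y hR hr hq hq' hy hya using key
  refine Nat.card_le_card_of_injective y fun x x' hxx => ?_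
  have h1 : q x = q x' := by
    have h2 := (hy x).symm.trans ((congrArg (fun z => z.1.1) hxx).trans (hy x'))
    by_contra hne
    have h3 := congrFun h2 (q x)
    simp [hne] at h3
  have h2 : insertArray k x.2.1 (R x) = insertArray k x'.2.1 (R x') := by
    rw [← hya, ← hya, hxx]
  have h3 := (hR x).path_eq (hR x') h2 (hq x) (hq' x) (h1 ▸ hq x') (h1 ▸ hq' x')
  have h4 := (hR x).array_eq (h3 ▸ hR x') x.2.2.2.zero x'.2.2.2.zero (by rw [h2, h3])
  obtain ⟨lam1, a1, ha1⟩ := x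
  obtain ⟨lam2, a2, ha2⟩ := x'
  obtain rfl : lam1 = lam2 := Subtype.ext ((hr ⟨lam1, a1, ha1⟩).trans
    ((congrArg (fun R => lam.1 + Pi.single (R 0) 1) h3).trans (hr ⟨lam2, a2, ha2⟩).symm))
  obtain rfl : a1 = a2 := h4
  rfl

theorem one_le_lrCount_zero (nu : RectPart n k) : 1 ≤ lrCount k nu 0 nu := by
  have := IsLRArray.finite (k := k) (lam := nu.1) (mu := 0) (nu := nu.1)
  have : Nonempty {a // IsLRArray k nu.1 0 nu a} := ⟨0, ⟨fun _ _ _ => rfl, fun _ _ => by simp,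
    fun _ => by simp, fun i _ _ => by simpa using nu.2.1 (Nat.le_succ i), fun _ _ _ => by simp⟩⟩
  exact Nat.card_pos

theorem sytCount_add_le (p q : ℕ) (nu : RectPart n k) :
    sytCount n k (p + q) nu ≤ ∑ lam : RectPart n k, ∑ kap : RectPart n k,
      sytCount n k p lam * (sytCount n k q kap * lrCount k lam kap nu) := by
  induction q generalizing p with
  | zero =>
    refine le_trans ?_ (Finset.single_le_sum (fun _ _ => Nat.zero_le _) (Finset.mem_univ nu))
    refine le_trans ?_ (Finset.single_le_sum (fun _ _ => Nat.zero_le _)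
      (Finset.mem_univ (⟨0, isRectPartition_zero⟩ : RectPart n k)))
    rw [sytCount, if_pos rfl, one_mul]
    exact Nat.le_mul_of_pos_right _ (one_le_lrCount_zero nu)
  | succ q ih =>
    rw [← add_assoc, add_right_comm]
    refine (ih (p + 1)).trans ?_
    calc _ = ∑ kap : RectPart n k, ∑ lam : RectPart n k, sytCount n k p lam *
          (sytCount n k q kap * ∑ lam' : RectPart n k,
            if AddBox lam lam' then lrCount k lam' kap nu else 0) := by
          rw [Finset.sum_comm]
          refine Finset.sum_congr rfl fun kap _ => ?_
          simp only [sytCount, Finset.sum_mul, Finset.mul_sum]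
          rw [Finset.sum_comm]
          refine Finset.sum_congr rfl fun lam _ => Finset.sum_congr rfl fun lam' _ => ?_
          split_ifs <;> simp
      _ ≤ ∑ kap : RectPart n k, ∑ lam : RectPart n k, sytCount n k p lam *
          (sytCount n k q kap * ∑ kap' : RectPart n k,
            if AddBox kap kap' then lrCount k lam kap' nu else 0) :=
          Finset.sum_le_sum fun kap _ => Finset.sum_le_sum fun lam _ => Nat.mul_le_mul le_rfl
            (Nat.mul_le_mul le_rfl (sum_lrCount_addBox_le lam kap nu))
      _ = _ := by
          rw [Finset.sum_comm]
          refine Finset.sum_congr rfl fun lam _ => ?_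
          simp only [sytCount, Finset.sum_mul, Finset.mul_sum]
          rw [Finset.sum_comm]
          refine Finset.sum_congr rfl fun kap _ => Finset.sum_congr rfl fun kap' _ => ?_
          split_ifs <;> simp

end StandardTableaux

theorem sum_piFinSucc {α M : Type*} [Fintype α] [AddCommMonoid M] {p : ℕ}
    (f : (Fin (p + 1) → α) → M) :
    ∑ κ, f κ = ∑ a, ∑ κ : Fin p → α, f (Fin.cons a κ) := by
  rw [← Fintype.sum_prod_type' (f := fun a κ => f (Fin.cons a κ))]
  exact (Fintype.sum_equiv (Fin.consEquiv fun _ : Fin (p + 1) => α) _ _ fun _ => rfl).symm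

theorem sytCount_sum_le {n k : ℕ} (p : ℕ) (d : Fin (p + 1) → ℕ) :
    sytCount n k (∑ j, d j) ⟨rectFull n k, isRectPartition_rectFull⟩ ≤
      ∑ κ : Fin (p + 1) → RectPart n k, (∏ j, sytCount n k (d j) (κ j)) * chainCount n k p κ := by
  induction p with
  | zero =>
    refine le_trans ?_ (Finset.single_le_sum (fun _ _ => Nat.zero_le _)
      (Finset.mem_univ fun _ => ⟨rectFull n k, isRectPartition_rectFull⟩))
    simp [chainCount]
  | succ p ih =>
    have h := ih (Fin.cons (d 0 + d 1) fun i => d i.succ.succ)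
    rw [Fin.sum_univ_succ] at h
    simp only [Fin.cons_zero, Fin.cons_succ] at h
    rw [Fin.sum_univ_succ, Fin.sum_univ_succ, ← add_assoc]
    refine h.trans ?_
    rw [sum_piFinSucc, sum_piFinSucc]
    simp only [Fin.prod_univ_succ, Fin.cons_zero, Fin.cons_succ]
    refine (Finset.sum_le_sum fun ν _ => Finset.sum_le_sum fun κ _ => Nat.mul_le_mul
      (Nat.mul_le_mul (sytCount_add_le _ _ ν) le_rfl) le_rfl).trans (le_of_eq ?_)
    simp only [sum_piFinSucc (p := p), chainCount, Fin.cons_zero, Fin.cons_succ, Fin.cons_one,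
      Fin.succ_zero_eq_one, Finset.mul_sum, Finset.sum_mul]
    rw [Finset.sum_congr rfl fun ν _ => Finset.sum_comm, Finset.sum_comm]
    refine Finset.sum_congr rfl fun lam _ => ?_
    rw [Finset.sum_congr rfl fun ν _ => Finset.sum_comm, Finset.sum_comm]
    refine Finset.sum_congr rfl fun kap _ => ?_
    rw [Finset.sum_comm]
    refine Finset.sum_congr rfl fun κ _ => Finset.sum_congr rfl fun ν _ => ?_
    ring

section Words

variable {d k : ℕ}

/-- The operator on functions on words that sums over all ways of replacing one letter `i`
by `i'` in the argument. -/
noncomputable def letterSub (i i' : Fin k) (T : (Fin d → Fin k) → ℝ) (w : Fin d → Fin k) : ℝ :=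
  ∑ j, if w j = i then T (Function.update w j i') else 0

theorem sum_mul_letterSub (i i' : Fin k) (S T : (Fin d → Fin k) → ℝ) :
    ∑ w, S w * letterSub i i' T w = ∑ w, letterSub i' i S w * T w := by
  simp only [letterSub, Finset.mul_sum, Finset.sum_mul]
  rw [Finset.sum_comm, Finset.sum_comm (s := Finset.univ (α := Fin d → Fin k))]
  refine Finset.sum_congr rfl fun j _ => ?_
  simp only [mul_ite, ite_mul, mul_zero, zero_mul, ← Finset.sum_filter]
  refine Finset.sum_nbij' (fun w => Function.update w j i') (fun w => Function.update w j i)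
    ?_ ?_ ?_ ?_ ?_
  · intro w hw
    simp
  · intro w hw
    simp
  · intro w hw
    simp only [Finset.mem_filter, Finset.mem_univ, true_and] at hw
    rw [Function.update_idem, ← hw, Function.update_eq_self]
  · intro w hw
    simp only [Finset.mem_filter, Finset.mem_univ, true_and] at hw
    rw [Function.update_idem, ← hw, Function.update_eq_self]
  · intro w hw
    simp only [Finset.mem_filter, Finset.mem_univ, true_and] at hw
    rw [Function.update_idem, ← hw, Function.update_eq_self]

theorem letterSub_letterSub {i i' : Fin k} (hi : i ≠ i') (T : (Fin d → Fin k) → ℝ)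
    (w : Fin d → Fin k) :
    letterSub i i' (letterSub i' i T) w = Finset.card {j | w j = i} * T w +
      ∑ j, ∑ l, if w j = i ∧ w l = i' then
        T (Function.update (Function.update w j i') l i) else 0 := by
  rw [Finset.card_filter]
  push_cast
  rw [Finset.sum_mul, ← Finset.sum_add_distrib]
  refine Finset.sum_congr rfl fun j _ => ?_
  split_ifs with hj
  · rw [letterSub, ← Finset.add_sum_erase _ _ (Finset.mem_univ j),
      ← Finset.add_sum_erase (a := j) _ _ (Finset.mem_univ j)]
    rw [Function.update_self, if_pos rfl, Function.update_idem, ← hj, Function.update_eq_self,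
      if_neg fun h => hi (hj.symm.trans h.2), zero_add, one_mul]
    refine congrArg _ (Finset.sum_congr rfl fun l hl => ?_)
    rw [Function.update_of_ne (Finset.ne_of_mem_erase hl)]
    simp
  · simp [hj]

theorem letterSub_commutator {i i' : Fin k} (hi : i ≠ i') (T : (Fin d → Fin k) → ℝ)
    (w : Fin d → Fin k) :
    letterSub i i' (letterSub i' i T) w - letterSub i' i (letterSub i i' T) w =
      (Finset.card {j | w j = i} - Finset.card {j | w j = i'} : ℝ) * T w := by
  rw [letterSub_letterSub hi, letterSub_letterSub hi.symm]
  have h : (∑ j, ∑ l, if w j = i' ∧ w l = i then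
        T (Function.update (Function.update w j i) l i') else 0) =
      ∑ j, ∑ l, if w j = i ∧ w l = i' then
        T (Function.update (Function.update w j i') l i) else 0 := by
    rw [Finset.sum_comm]
    refine Finset.sum_congr rfl fun j _ => Finset.sum_congr rfl fun l _ => ?_
    by_cases hjl : w j = i ∧ w l = i'
    · rw [if_pos hjl, if_pos hjl.symm, Function.update_comm]
      rintro rfl
      exact hi (hjl.1.symm.trans hjl.2)
    · rw [if_neg hjl, if_neg fun h => hjl h.symm]
  rw [h]
  ring

theorem eq_zero_of_letterSub_eq_zero {i i' : Fin k} (hi : i ≠ i') {T : (Fin d → Fin k) → ℝ}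
    (hT : ∀ w, letterSub i i' T w = 0)
    (hlt : ∀ w, T w ≠ 0 → Finset.card {j | w j = i} < Finset.card {j | w j = i'}) : T = 0 := by
  have h1 := sum_mul_letterSub i i' T (letterSub i' i T)
  have h2 : ∀ w, letterSub i' i (letterSub i i' T) w = 0 := fun w => by
    rw [funext hT]
    simp [letterSub]
  have h3 : ∀ w, T w * letterSub i i' (letterSub i' i T) w ≤ 0 := fun w => by
    have h4 := letterSub_commutator hi T w
    rw [h2, sub_zero] at h4
    rw [h4]
    rcases eq_or_ne (T w) 0 with h5 | h5
    · simp [h5]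
    · have h6 : (Finset.card {j | w j = i} : ℝ) < Finset.card {j | w j = i'} :=
        Nat.cast_lt.2 (hlt w h5)
      nlinarith [mul_self_nonneg (T w)]
  have h4 : ∑ w, T w * letterSub i i' (letterSub i' i T) w = 0 :=
    le_antisymm (Finset.sum_nonpos fun w _ => h3 w)
      (h1 ▸ Finset.sum_nonneg fun w _ => mul_self_nonneg _)
  rw [Finset.sum_eq_zero_iff_of_nonpos fun w _ => h3 w] at h4
  funext w
  by_contra h5
  have h6 := letterSub_commutator hi T w
  have h7 := h4 w (Finset.mem_univ _)
  rw [h2, sub_zero] at h6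
  rw [h6] at h7
  have h8 : (Finset.card {j | w j = i} : ℝ) < Finset.card {j | w j = i'} :=
    Nat.cast_lt.2 (hlt w h5)
  have h9 : T w ≠ 0 := h5
  rw [mul_left_comm, mul_eq_zero, mul_self_eq_zero] at h7
  rcases h7 with h7 | h7
  · linarith
  · exact h9 h7

theorem letterSub_cons (i i' c : Fin k) (T : (Fin (d + 1) → Fin k) → ℝ) (w : Fin d → Fin k) :
    letterSub i i' T (Fin.cons c w) = (if c = i then T (Fin.cons i' w) else 0) +
      letterSub i i' (fun w => T (Fin.cons c w)) w := by
  rw [letterSub, Fin.sum_univ_succ]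
  simp only [Fin.cons_zero, Fin.cons_succ, Fin.update_cons_zero, ← Fin.cons_update]
  rfl

theorem card_cons_eq (c : Fin k) (w : Fin d → Fin k) (i : Fin k) :
    Finset.card {j | (Fin.cons c w : Fin (d + 1) → Fin k) j = i} =
      (if c = i then 1 else 0) + Finset.card {j | w j = i} := by
  rw [Finset.card_filter, Finset.card_filter, Fin.sum_univ_succ]
  simp only [Fin.cons_zero, Fin.cons_succ]

/-- Highest weight functions of weight `ν` on words of length `d` are determined by their values
on a set of at most `sytCount n k d ν` words. -/
theorem exists_determining_words {n : ℕ} (d : ℕ) (ν : RectPart n k) :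
    ∃ S : Finset (Fin d → Fin k), S.card ≤ sytCount n k d ν ∧ ∀ T : (Fin d → Fin k) → ℝ,
      (∀ w, T w ≠ 0 → ∀ i : Fin k, Finset.card {j | w j = i} = ν.1 i) →
      (∀ i i', i < i' → ∀ w, letterSub i i' T w = 0) → (∀ w ∈ S, T w = 0) → T = 0 := by
  induction d generalizing ν with
  | zero =>
    by_cases h : ν.1 = 0
    · exact ⟨Finset.univ, by simp [sytCount, h], fun T _ _ hT =>
        funext fun w => hT w (Finset.mem_univ w)⟩
    · refine ⟨∅, by simp, fun T hT _ _ => funext fun w => ?_⟩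
      by_contra hw
      refine h (funext fun i => ?_)
      rcases lt_or_ge i k with hi | hi
      · have := hT w hw ⟨i, hi⟩
        simpa using this.symm
      · exact ν.2.2.2 i hi
  | succ d ih =>
    choose S hS hdet using ih
    refine ⟨Finset.univ.biUnion fun lam : RectPart n k =>
      if h : ∃ c : Fin k, ν.1 = lam.1 + Pi.single c.1 1 then
        (S lam).image (Fin.cons (α := fun _ => Fin k) h.choose) else ∅,
      ?_, fun T hcont hT hST => ?_⟩
    · rw [sytCount]
      refine Finset.card_biUnion_le.trans (Finset.sum_le_sum fun lam _ => ?_)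
      split_ifs with h1 h2 h2
      · exact Finset.card_image_le.trans (hS lam)
      · exact absurd ⟨_, h1.choose_spec⟩ h2
      · exact Nat.zero_le _
      · exact Nat.zero_le _
    · have key : ∀ m, ∀ c : Fin k, k ≤ c.1 + m → ∀ w : Fin d → Fin k, T (Fin.cons c w) = 0 := by
        intro m
        induction m with
        | zero => exact fun c hc => absurd c.2 (by omega)
        | succ m ihm =>
          intro c hc
          suffices h : (fun w : Fin d → Fin k => T (Fin.cons c w)) = 0 from
            fun w => congrFun h w
          have hTc : ∀ i i', i < i' → ∀ w, letterSub i i' (fun w => T (Fin.cons c w)) w = 0 := by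
            intro i i' hi w
            have h1 := hT i i' hi (Fin.cons c w)
            rw [letterSub_cons] at h1
            split_ifs at h1 with h2
            · have h3 : i.1 < i'.1 := hi
              have h4 := congrArg Fin.val h2
              rwa [ihm i' (by omega) w, zero_add] at h1
            · rwa [zero_add] at h1
          have hcontc : ∀ w : Fin d → Fin k, T (Fin.cons c w) ≠ 0 → ∀ i : Fin k,
              (if c = i then 1 else 0) + Finset.card {j | w j = i} = ν.1 i := fun w hw i => by
            rw [← card_cons_eq]
            exact hcont _ hw i
          by_cases hlam : ∃ lam : RectPart n k, ν.1 = lam.1 + Pi.single c.1 1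
          · obtain ⟨lam, hlam⟩ := hlam
            refine hdet lam _ (fun w hw i => ?_) hTc fun w hw => hST _ ?_
            · have h1 := hcontc w hw i
              rw [hlam, Pi.add_apply, Pi.single_apply] at h1
              simp only [Fin.ext_iff, eq_comm (a := i.1)] at h1 ⊢
              omega
            · refine Finset.mem_biUnion.2 ⟨lam, Finset.mem_univ _, ?_⟩
              have h1 : ∃ c : Fin k, ν.1 = lam.1 + Pi.single c.1 1 := ⟨c, hlam⟩
              rw [dif_pos h1, show h1.choose = c from ?_]
              · exact Finset.mem_image_of_mem _ hw
              · have h2 := congrFun (add_left_cancel (h1.choose_spec.symm.trans hlam)) c.1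
                rw [Pi.single_eq_same, Pi.single_apply] at h2
                by_contra h3
                rw [if_neg fun h4 => h3 (Fin.ext h4.symm)] at h2
                exact zero_ne_one h2
          · by_cases h0 : ν.1 c = 0
            · funext w
              by_contra hw
              have := hcontc w hw c
              rw [if_pos rfl] at this
              omega
            · have h1 : ν.1 (c + 1) = ν.1 c := by
                by_contra h1
                have h2 := ν.2.1 (Nat.le_succ c.1)
                exact hlam (ν.exists_add_single (lt_of_le_of_ne h2 h1))
              have hck : c.1 + 1 < k := by
                by_contra h2
                exact h0 (h1 ▸ ν.2.2.2 _ (by omega))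
              have hne : c ≠ ⟨c.1 + 1, hck⟩ := fun h => by simp [Fin.ext_iff] at h
              refine eq_zero_of_letterSub_eq_zero hne (hTc c _ (by simp [Fin.lt_def]))
                fun w hw => ?_
              have h2 := hcontc w hw c
              have h3 := hcontc w hw ⟨c.1 + 1, hck⟩
              rw [if_pos rfl] at h2
              rw [if_neg hne] at h3
              simp only at h3
              omega
      funext w
      rw [← Fin.cons_self_tail w]
      exact key k _ (by omega) _

end Words

theorem Matrix.sum_det_updateRow_mul {ι R : Type*} [Fintype ι] [DecidableEq ι] [CommRing R]
    (M N : Matrix ι ι R) :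
    ∑ j, (M.updateRow j ((M * N) j)).det = N.trace * M.det := by
  have h : ∀ j, (M.updateRow j ((M * N) j)).det = (M * N * M.adjugate) j j := fun j => by
    rw [← Matrix.cramer_transpose_apply, Matrix.cramer_eq_adjugate_mulVec,
      ← Matrix.adjugate_transpose, Matrix.mulVec_transpose]
    rfl
  simp only [h]
  change ((M * N) * M.adjugate).trace = _
  rw [Matrix.mul_assoc, Matrix.trace_mul_comm, Matrix.mul_assoc, Matrix.adjugate_mul,
    Matrix.mul_smul, Matrix.mul_one, Matrix.trace_smul, smul_eq_mul, mul_comm]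

section WordDet

variable {D k : ℕ} {C : Type*}

/-- The matrix whose `j`-th row is the vector `η j`, placed in the block `w j`. -/
noncomputable def wordMatrix (e : Fin D ≃ Fin k × C) (η : Fin D → C → ℝ) (w : Fin D → Fin k) :
    Matrix (Fin D) (Fin D) ℝ :=
  Matrix.of fun j p => if w j = (e p).1 then η j (e p).2 else 0

/-- The determinant of `wordMatrix`, as a function on words. -/
noncomputable def wordDet (e : Fin D ≃ Fin k × C) (η : Fin D → C → ℝ) (w : Fin D → Fin k) : ℝ :=
  (wordMatrix e η w).det

theorem letterSub_wordDet [Fintype C] (e : Fin D ≃ Fin k × C) (η : Fin D → C → ℝ) (i i' : Fin k)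
    (w : Fin D → Fin k) :
    letterSub i i' (wordDet e η) w = if i = i' then Fintype.card C * wordDet e η w else 0 := by
  have h := Matrix.sum_det_updateRow_mul (wordMatrix e η w)
    (Matrix.of fun q p : Fin D => if (e q).1 = i ∧ e p = (i', (e q).2) then (1 : ℝ) else 0)
  have hN : ∀ j p, (wordMatrix e η w *
      (Matrix.of fun q p : Fin D => if (e q).1 = i ∧ e p = (i', (e q).2) then (1 : ℝ) else 0)) j p =
      if w j = i ∧ i' = (e p).1 then η j (e p).2 else 0 := fun j p => by
    rw [Matrix.mul_apply]
    simp only [wordMatrix, Matrix.of_apply]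
    rw [Finset.sum_eq_single (e.symm (i, (e p).2))]
    · simp only [Equiv.apply_symm_apply, Prod.ext_iff]
      by_cases h1 : w j = i <;> by_cases h2 : i' = (e p).1 <;> simp [h1, h2, eq_comm]
    · intro q _ hq
      rw [if_neg (c := _ ∧ _), mul_zero]
      rintro ⟨h1, h2⟩
      refine hq ((Equiv.eq_symm_apply e).2 ?_)
      rw [h2, ← h1]
    · exact fun h => absurd (Finset.mem_univ _) h
  have htr : (Matrix.of fun q p : Fin D =>
      if (e q).1 = i ∧ e p = (i', (e q).2) then (1 : ℝ) else 0).trace =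
      if i = i' then (Fintype.card C : ℝ) else 0 := by
    rw [Matrix.trace, ← Equiv.sum_comp e.symm, Fintype.sum_prod_type]
    simp only [Matrix.diag_apply, Matrix.of_apply, Equiv.apply_symm_apply, Prod.mk.injEq, and_true]
    rw [Finset.sum_eq_single i]
    · simp
    · intro b _ hb
      simp [hb]
    · exact fun h => absurd (Finset.mem_univ _) h
  rw [htr, ite_mul, zero_mul] at h
  refine Eq.trans ?_ h
  rw [letterSub]
  refine Finset.sum_congr rfl fun j _ => ?_
  split_ifs with hj
  · rw [wordDet]
    congr 1
    ext l p
    rw [Matrix.updateRow_apply, hN]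
    rcases eq_or_ne l j with rfl | hl
    · simp [wordMatrix, hj]
    · simp [wordMatrix, hl]
  · refine (Matrix.det_eq_zero_of_row_eq_zero j fun p => ?_).symm
    rw [Matrix.updateRow_self, hN, if_neg fun h => hj h.1]

theorem card_eq_of_wordDet_ne_zero [Fintype C] {e : Fin D ≃ Fin k × C} {η : Fin D → C → ℝ}
    {w : Fin D → Fin k} (hw : wordDet e η w ≠ 0) (i : Fin k) :
    Finset.card {j | w j = i} = Fintype.card C := by
  have h := letterSub_wordDet e η i i w
  rw [if_pos rfl, letterSub] at h
  have h1 : ∀ j, (if w j = i then wordDet e η (Function.update w j i) else 0) =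
      if w j = i then wordDet e η w else 0 := fun j => by
    split_ifs with hj
    · rw [← hj, Function.update_eq_self]
    · rfl
  simp only [h1, ← Finset.sum_filter, Finset.sum_const, nsmul_eq_mul] at h
  exact_mod_cast mul_right_cancel₀ hw h

theorem sum_prod_mul_wordDet (e : Fin D ≃ Fin k × C) (η : Fin D → C → ℝ)
    (α : Fin D → Fin k → ℝ) :
    ∑ w : Fin D → Fin k, (∏ j, α j (w j)) * wordDet e η w =
      (Matrix.of fun j p : Fin D => α j (e p).1 * η j (e p).2).det := by
  have h := (Matrix.detRowAlternating (R := ℝ) (n := Fin D)).toMultilinearMap.map_sum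
    (fun j i => α j i • fun p : Fin D => if i = (e p).1 then η j (e p).2 else 0)
  have h1 : (fun j => ∑ i, α j i • fun p : Fin D => if i = (e p).1 then η j (e p).2 else 0) =
      fun j p => α j (e p).1 * η j (e p).2 := by
    funext j p
    simp
  rw [h1] at h
  refine Eq.trans ?_ h.symm
  refine Finset.sum_congr rfl fun w _ => ?_
  rw [MultilinearMap.map_smul_univ]
  rfl

/-- A family of functions `wordDet e (η b)` that is dual to vectors of decomposable functionals has
at most `sytCount n k D ρ` members. -/
theorem card_le_sytCount_of_det [Fintype C] {n : ℕ} {ι : Type*} [Fintype ι] (e : Fin D ≃ Fin k × C)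
    (hC : Fintype.card C = n - k) (η : ι → Fin D → C → ℝ) (α : ι → Fin D → Fin k → ℝ)
    (h0 : ∀ a b, a ≠ b → (Matrix.of fun j p : Fin D => α a j (e p).1 * η b j (e p).2).det = 0)
    (h1 : ∀ a, (Matrix.of fun j p : Fin D => α a j (e p).1 * η a j (e p).2).det ≠ 0) :
    Fintype.card ι ≤ sytCount n k D ⟨rectFull n k, isRectPartition_rectFull⟩ := by
  obtain ⟨S, hS, hdet⟩ := exists_determining_words D
    (⟨rectFull n k, isRectPartition_rectFull⟩ : RectPart n k)
  refine le_trans ?_ hS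
  have hli : LinearIndependent ℝ fun (b : ι) (w : S) => wordDet e (η b) w := by
    rw [Fintype.linearIndependent_iff]
    intro g hg a
    have hT : (fun w => ∑ b, g b * wordDet e (η b) w) = 0 := by
      refine hdet _ (fun w hw i => ?_) (fun i i' hi w => ?_) fun w hw => ?_
      · obtain ⟨b, _, hb⟩ := Finset.exists_ne_zero_of_sum_ne_zero hw
        rw [card_eq_of_wordDet_ne_zero (right_ne_zero_of_mul hb), hC]
        exact (if_pos i.2).symm
      · have h2 : letterSub i i' (fun w => ∑ b, g b * wordDet e (η b) w) w =
            ∑ b, g b * letterSub i i' (wordDet e (η b)) w := by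
          simp only [letterSub, Finset.mul_sum, mul_ite, mul_zero]
          rw [Finset.sum_comm]
          refine Finset.sum_congr rfl fun j _ => ?_
          split_ifs
          · rfl
          · simp
        rw [h2]
        refine Finset.sum_eq_zero fun b _ => ?_
        rw [letterSub_wordDet, if_neg hi.ne, mul_zero]
      · have := congrFun hg ⟨w, hw⟩
        simpa using this
    have h2 : ∑ b, g b * (∑ w : Fin D → Fin k, (∏ j, α a j (w j)) * wordDet e (η b) w) = 0 := by
      simp only [Finset.mul_sum]
      rw [Finset.sum_comm]
      refine Finset.sum_eq_zero fun w _ => ?_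
      have h3 := congrFun hT w
      simp only [Pi.zero_apply] at h3
      simp only [mul_left_comm (g _), ← Finset.mul_sum, h3, mul_zero]
    simp only [sum_prod_mul_wordDet] at h2
    rw [Finset.sum_eq_single a (fun b _ hb => by rw [h0 a b hb.symm, mul_zero])
      fun h => absurd (Finset.mem_univ a) h] at h2
    exact (mul_eq_zero.1 h2).resolve_right (h1 a)
  have h2 := hli.fintype_card_le_finrank
  rwa [finrank_fintype_fun_eq_card, Fintype.card_coe] at h2

end WordDet

section BoxConditions

variable {n k : ℕ}

theorem finrank_range_mulVecLin {x : Matrix (Fin k) (Fin n) ℝ} (hx : finrank ℝ (rowSp x) = k) :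
    finrank ℝ (LinearMap.range x.mulVecLin) = k := by
  rw [rowSp_eq_span, ← Matrix.rank_eq_finrank_span_row, Matrix.rank] at hx
  exact hx

theorem finrank_ker_mulVecLin {x : Matrix (Fin k) (Fin n) ℝ} (hx : finrank ℝ (rowSp x) = k) :
    finrank ℝ (LinearMap.ker x.mulVecLin) = n - k := by
  have h1 := LinearMap.finrank_range_add_finrank_ker x.mulVecLin
  have h2 := finrank_range_mulVecLin hx
  rw [finrank_fin_fun] at h1
  omega

theorem rowSp_eq_of_ker_le {x y : Matrix (Fin k) (Fin n) ℝ} (hx : finrank ℝ (rowSp x) = k)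
    (hy : finrank ℝ (rowSp y) = k) (h : LinearMap.ker y.mulVecLin ≤ LinearMap.ker x.mulVecLin) :
    rowSp x = rowSp y := by
  have hsurj : Function.Surjective y.mulVec := LinearMap.range_eq_top.1
    (Submodule.eq_top_of_finrank_eq ((finrank_range_mulVecLin hy).trans (finrank_fin_fun ℝ).symm))
  obtain ⟨s, hs⟩ := Matrix.mulVec_surjective_iff_exists_right_inverse.1 hsurj
  have hxy : x = x * s * y := by
    refine Matrix.ext_of_mulVec_single fun i => sub_eq_zero.1 ?_
    have h1 : (Pi.single i 1 - (s * y).mulVec (Pi.single i 1) : Fin n → ℝ) ∈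
        LinearMap.ker y.mulVecLin := by
      rw [LinearMap.mem_ker, Matrix.mulVecLin_apply, Matrix.mulVec_sub, Matrix.mulVec_mulVec,
        ← Matrix.mul_assoc, hs, Matrix.one_mul, sub_self]
    have h2 := h h1
    rwa [LinearMap.mem_ker, Matrix.mulVecLin_apply, Matrix.mulVec_sub, Matrix.mulVec_mulVec,
      ← Matrix.mul_assoc] at h2
  refine Submodule.eq_of_le_of_finrank_eq ?_ (hx.trans hy.symm)
  rw [hxy]
  exact rowSp_mul_le _ _

theorem IsSol.exists_kernel_vectors {ι : Type*} {H : ι → Matrix (Fin n) (Fin n) ℝ}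
    {P : ι → Fin k → Fin n} {x : Matrix (Fin k) (Fin n) ℝ} {A : ι → Matrix (Fin k) (Fin k) ℝ}
    (h : IsSol H P x A) (hkn : k ≤ n) (o : Fin k) (hP : ∀ l, (P l o : ℕ) < n - k) :
    ∃ ζ : ι → Fin n → ℝ, (∀ l, x.mulVec (ζ l) = 0) ∧
      (∀ l v, (∀ r : Fin n, n - k ≤ r → Matrix.vecMul v (H l) r = 0) → v ⬝ᵥ ζ l = 0) ∧
      ∀ c : ι → ℝ, ∃ x' : Matrix (Fin k) (Fin n) ℝ, ∀ l, A l o ⬝ᵥ x'.mulVec (ζ l) = c l := by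
  let emb : Fin k → Fin n := fun c => ⟨n - k + c, by omega⟩
  have hemb : Function.Injective emb := fun a b hab => by
    simp only [emb, Fin.mk.injEq] at hab
    omega
  let E : Matrix (Fin n) (Fin k) ℝ := (1 : Matrix (Fin n) (Fin n) ℝ).submatrix id emb
  have hE : ∀ y : Fin n → ℝ, Matrix.vecMul y E = fun c => y (emb c) := fun y => by
    ext c
    simp [E, Matrix.vecMul, dotProduct, Matrix.one_apply]
  have hE' : ∀ (η : Fin k → ℝ) c, E.mulVec η (emb c) = η c := fun η c => by
    simp [E, Matrix.mulVec, dotProduct, Matrix.one_apply, hemb.eq_iff]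
  have hη : ∀ l, ∃ η : Fin k → ℝ, η ≠ 0 ∧ (x * H l * E).mulVec η = 0 := fun l => by
    rw [Matrix.exists_mulVec_eq_zero_iff, ← Matrix.exists_vecMul_eq_zero_iff]
    refine ⟨A l o, fun h0 => h.piv l o ?_, ?_⟩
    · rw [Matrix.mul_assoc, Matrix.mul_apply_eq_vecMul, h0, Matrix.zero_vecMul, Pi.zero_apply]
    · rw [← Matrix.vecMul_vecMul, hE]
      funext c
      rw [← Matrix.mul_apply_eq_vecMul, ← Matrix.mul_assoc]
      refine h.zero l o _ (Fin.lt_def.2 ((hP l).trans_le ?_))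
      exact Nat.le_add_right _ _
  choose η hη0 hη using hη
  refine ⟨fun l => (H l).mulVec (E.mulVec (η l)), fun l => ?_, fun l v hv => ?_, fun c => ?_⟩
  · simp only [Matrix.mulVec_mulVec, ← Matrix.mul_assoc, hη]
  · rw [Matrix.dotProduct_mulVec, Matrix.dotProduct_mulVec, hE]
    refine Finset.sum_eq_zero fun c _ => ?_
    beta_reduce
    rw [hv (emb c) (Nat.le_add_right _ _), zero_mul]
  · obtain ⟨x', A', hx'⟩ := h.reg fun l _ => (c l / (η l ⬝ᵥ η l)) • E.mulVec (η l)
    refine ⟨x', fun l => ?_⟩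
    have h1 : A l o ⬝ᵥ x'.mulVec ((H l).mulVec (E.mulVec (η l))) =
        (A' l * x * H l + A l * x' * H l) o ⬝ᵥ E.mulVec (η l) := by
      have h2 : (A' l * x * H l) o ⬝ᵥ E.mulVec (η l) = 0 := by
        rw [Matrix.mul_assoc, Matrix.mul_apply_eq_vecMul, ← Matrix.dotProduct_mulVec,
          Matrix.mulVec_mulVec, hη, dotProduct_zero]
      rw [show (A' l * x * H l + A l * x' * H l) o =
          (A' l * x * H l) o + (A l * x' * H l) o from rfl,
        add_dotProduct, h2, zero_add, Matrix.mul_assoc,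
        Matrix.mul_apply_eq_vecMul, ← Matrix.dotProduct_mulVec, Matrix.mulVec_mulVec]
    have h2 : η l ⬝ᵥ η l ≠ 0 := fun h => hη0 l (dotProduct_self_eq_zero.1 h)
    rw [h1, Matrix.dotProduct_mulVec, hE]
    have h3 : (fun c => (A' l * x * H l + A l * x' * H l) o (emb c)) =
        (c l / (η l ⬝ᵥ η l)) • η l := by
      funext i
      rw [hx' l o (emb i) (Fin.lt_def.2 ((hP l).trans_le (Nat.le_add_right _ _))), Pi.smul_apply,
        hE', Pi.smul_apply]
    rw [h3, smul_dotProduct, smul_eq_mul, div_mul_cancel₀ _ h2]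

/-- A Schubert problem all of whose conditions are of codimension one has at most as many
transverse solutions as there are standard tableaux of rectangular shape. -/
theorem encard_Sol_box_le (hk : 0 < k) (hkn : k ≤ n)
    (H : Fin (k * (n - k)) → Matrix (Fin n) (Fin n) ℝ) (κ : Fin (k * (n - k)) → RectPart n k)
    (hκ : ∀ l, (κ l).1 = Pi.single 0 1) :
    (Sol H (fun l => pivotPos hkn (κ l)) ∩ {V | finrank ℝ V = k}).encard ≤
      (sytCount n k (k * (n - k)) ⟨rectFull n k, isRectPartition_rectFull⟩ : ℕ∞) := by
  by_contra hlt
  rw [not_le] at hlt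
  have hlt := Order.add_one_le_of_lt hlt
  rw [← Nat.cast_add_one, natCast_le_encard_iff] at hlt
  obtain ⟨V, hV, hVmem⟩ := hlt
  choose x A hxA hxV using fun a => (hVmem a).1
  have hxk : ∀ a, finrank ℝ (rowSp (x a)) = k := fun a => by
    rw [hxV]
    exact (hVmem a).2
  have hP : ∀ l, (pivotPos hkn (κ l) ⟨0, hk⟩ : ℕ) < n - k := fun l => by
    have h1 : 0 < n - k := Nat.pos_of_ne_zero fun h => by
      have := l.2
      simp [h] at this
    simp only [pivotPos, hκ, Pi.single_eq_same]
    omega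
  choose ζ hζx hζ0 hζc using fun a => (hxA a).exists_kernel_vectors hkn ⟨0, hk⟩ hP
  have hker : ∀ a, finrank ℝ (LinearMap.ker (x a).mulVecLin) = n - k := fun a =>
    finrank_ker_mulVecLin (hxk a)
  have Q : ∀ a, (Fin (n - k) → ℝ) ≃ₗ[ℝ] LinearMap.ker (x a).mulVecLin := fun a =>
    LinearEquiv.ofFinrankEq _ _ (by rw [finrank_fin_fun, hker])
  let Qm : ∀ a, Matrix (Fin n) (Fin (n - k)) ℝ := fun a => LinearMap.toMatrix'
    ((LinearMap.ker (x a).mulVecLin).subtype ∘ₗ (Q a).toLinearMap)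
  have hQm : ∀ a v, (Qm a).mulVec v = (Q a v : Fin n → ℝ) := fun a v => by
    rw [LinearMap.toMatrix'_mulVec]
    rfl
  let η : Fin _ → Fin (k * (n - k)) → Fin (n - k) → ℝ := fun a l => (Q a).symm ⟨ζ a l, hζx a l⟩
  have hη : ∀ a l, (Qm a).mulVec (η a l) = ζ a l := fun a l => by
    rw [hQm, LinearEquiv.apply_symm_apply]
  let e : Fin (k * (n - k)) ≃ Fin k × Fin (n - k) := finProdFinEquiv.symm
  have hmul : ∀ (a b) (φ : Matrix (Fin k) (Fin (n - k)) ℝ) l,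
      (Matrix.of fun j p : Fin (k * (n - k)) =>
        A a j ⟨0, hk⟩ (e p).1 * η b j (e p).2).mulVec (fun p => φ (e p).1 (e p).2) l =
      A a l ⟨0, hk⟩ ⬝ᵥ φ.mulVec (η b l) := fun a b φ l => by
    rw [Matrix.mulVec, dotProduct, ← Equiv.sum_comp e.symm, Fintype.sum_prod_type]
    simp only [Equiv.apply_symm_apply, Matrix.of_apply, dotProduct, Matrix.mulVec,
      Finset.mul_sum]
    refine Finset.sum_congr rfl fun i _ => Finset.sum_congr rfl fun c _ => ?_
    ring
  have hcard := card_le_sytCount_of_det (n := n) e (Fintype.card_fin _) η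
    (fun a j => A a j ⟨0, hk⟩) (fun a b hab => ?_) fun a => ?_
  · rw [Fintype.card_fin] at hcard
    omega
  · rw [← Matrix.exists_mulVec_eq_zero_iff]
    refine ⟨fun p => (x a * Qm b) (e p).1 (e p).2, fun h0 => hab (hV ?_), ?_⟩
    · have h1 : x a * Qm b = 0 := by
        ext i c
        have := congrFun h0 (e.symm (i, c))
        simpa using this
      rw [← hxV, ← hxV]
      refine rowSp_eq_of_ker_le (hxk a) (hxk b) fun v hv => ?_
      have h3 : v = (Qm b).mulVec ((Q b).symm ⟨v, hv⟩) := by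
        rw [hQm, LinearEquiv.apply_symm_apply]
      rw [LinearMap.mem_ker, Matrix.mulVecLin_apply, h3, Matrix.mulVec_mulVec, h1,
        Matrix.zero_mulVec]
    · funext l
      rw [hmul, ← Matrix.mulVec_mulVec, hη, Pi.zero_apply, Matrix.dotProduct_mulVec]
      refine hζ0 b l _ fun r hr => ?_
      rw [← Matrix.mul_apply_eq_vecMul, ← Matrix.mul_apply_eq_vecMul]
      exact (hxA a).zero l _ r (Fin.lt_def.2 ((hP l).trans_le hr))
  · rw [← isUnit_iff_ne_zero, ← Matrix.isUnit_iff_isUnit_det,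
      ← Matrix.mulVec_surjective_iff_isUnit]
    intro c
    obtain ⟨x', hx'⟩ := hζc a c
    refine ⟨fun p => (x' * Qm a) (e p).1 (e p).2, funext fun l => ?_⟩
    rw [hmul, ← Matrix.mulVec_mulVec, hη, hx']

end BoxConditions

section Breaking

variable {n k : ℕ}

theorem sytCount_zero_ne_zero {ν : RectPart n k} (h : sytCount n k 0 ν ≠ 0) : ν.1 = 0 := by
  by_contra h1
  exact h (if_neg h1)

theorem sytCount_one_ne_zero {ν : RectPart n k} (h : sytCount n k 1 ν ≠ 0) :
    ν.1 = Pi.single 0 1 := by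
  obtain ⟨lam, _, hlam⟩ := Finset.exists_ne_zero_of_sum_ne_zero h
  split_ifs at hlam with h1
  · obtain ⟨i, hi⟩ := h1
    rw [sytCount_zero_ne_zero hlam, zero_add] at hi
    suffices h0 : i = 0 by rw [hi, h0]
    have h2 := ν.2.1 (Nat.zero_le i)
    by_contra h0
    rw [hi, Pi.single_eq_same, Pi.single_eq_of_ne (Ne.symm h0)] at h2
    exact Nat.not_succ_le_zero 0 h2
  · exact absurd rfl hlam

theorem sytCount_le_one {d : ℕ} (hd : d ≤ 1) (ν : RectPart n k) : sytCount n k d ν ≤ 1 := by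
  interval_cases d
  · rw [sytCount]
    split_ifs <;> omega
  · rw [sytCount]
    refine (Finset.sum_le_sum (g := fun lam : RectPart n k =>
      if lam = ⟨0, isRectPartition_zero⟩ then 1 else 0) fun lam _ => ?_).trans ?_
    · simp only [sytCount, Subtype.ext_iff]
      split_ifs <;> omega
    · simp

theorem one_le_lrCount_box (hk : 0 < k) {lam nu : RectPart n k}
    (h : AddBox lam.1 nu.1) : 1 ≤ lrCount k lam (Pi.single 0 1) nu := by
  have := IsLRArray.finite (k := k) (lam := lam.1) (mu := Pi.single 0 1) (nu := nu.1)
  obtain ⟨i, hi⟩ := h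
  have hik := (AddBox.index_lt nu.2 hi).1
  have hsum : ∀ i' s, ∑ j ∈ Finset.range s, (if i' = i ∧ j = 0 then 1 else 0) =
      if i' = i ∧ 0 < s then 1 else 0 := fun i' s => by
    by_cases h1 : i' = i <;> simp [h1]
  have hsum' : ∀ j s, ∑ i' ∈ Finset.range s, (if i' = i ∧ j = 0 then 1 else 0) =
      if j = 0 ∧ i < s then 1 else 0 := fun j s => by
    by_cases h1 : j = 0 <;> simp [h1]
  have : Nonempty {a // IsLRArray k lam.1 (Pi.single 0 1) nu.1 a} := by
    refine ⟨fun i' j => if i' = i ∧ j = 0 then 1 else 0, ?_, ?_, ?_, ?_, ?_⟩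
    · intro i' j hi'
      exact if_neg fun h => by omega
    · intro i' _
      rw [hsum, hi, Pi.add_apply, Pi.single_apply]
      simp [hk]
    · intro j
      rw [hsum', Pi.single_apply]
      simp [hik]
    · intro i' j hi'
      rw [hsum, hsum]
      have h1 := nu.2.1 (Nat.le_succ i')
      have h2 := lam.2.1 (Nat.le_succ i')
      rw [hi, Pi.add_apply, Pi.add_apply, Pi.single_apply, Pi.single_apply] at h1
      simp only [Nat.succ_eq_add_one] at h1 h2
      split_ifs at h1 ⊢ <;> omega
    · intro i' j hj
      rw [hsum', if_neg (by omega)]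
      exact Nat.zero_le _
  exact Nat.card_pos

theorem Ach.sum_le_of_le_one (hk : 0 < k) {hkn : k ≤ n} {τ : Type*} [Fintype τ] [DecidableEq τ]
    [Nonempty τ]
    {q : (τ → RectPart n k) → ℕ} (h : Ach hkn τ q) {d : τ → ℕ} (hd : ∑ j, d j = k * (n - k))
    (hd1 : ∀ j, d j ≤ 1) :
    ∑ κ : τ → RectPart n k, (∏ j, sytCount n k (d j) (κ j)) * q κ ≤
      sytCount n k (k * (n - k)) ⟨rectFull n k, isRectPartition_rectFull⟩ := by
  have hval : ∀ κ : τ → RectPart n k, ∏ j, sytCount n k (d j) (κ j) ≠ 0 →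
      ∀ j, (κ j).1 = if d j = 1 then Pi.single 0 1 else 0 := fun κ hκ j => by
    have h1 := Finset.prod_ne_zero_iff.1 hκ j (Finset.mem_univ j)
    have h2 := hd1 j
    split_ifs with h3
    · rw [h3] at h1
      exact sytCount_one_ne_zero h1
    · rw [show d j = 0 by omega] at h1
      exact sytCount_zero_ne_zero h1
  by_cases hex : ∃ κ : τ → RectPart n k, ∏ j, sytCount n k (d j) (κ j) ≠ 0
  · obtain ⟨κ, hκ⟩ := hex
    rw [Finset.sum_eq_single κ]
    · refine (Nat.mul_le_mul (Finset.prod_le_one' fun j _ => sytCount_le_one (hd1 j) _)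
        le_rfl).trans ?_
      rw [one_mul]
      have hcard : Fintype.card {j // d j = 1} = k * (n - k) := by
        rw [← hd, Fintype.card_subtype, Finset.card_filter]
        refine Finset.sum_congr rfl fun j _ => ?_
        have := hd1 j
        split_ifs <;> omega
      have hg := Subtype.val_injective.comp (Fintype.equivFinOfCardEq hcard).symm.injective
      obtain ⟨H, hH, hq⟩ := h
      refine Nat.cast_le.1 ((hq κ).trans ((Set.encard_le_encard ?_).trans
        (encard_Sol_box_le hk hkn (fun l => H ((Fintype.equivFinOfCardEq hcard).symm l).1)
          (fun l => κ ((Fintype.equivFinOfCardEq hcard).symm l).1) fun l => ?_)))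
      · refine fun V hV => ⟨Sol_comp_subset hg _ _ hV, ?_⟩
        obtain ⟨x, A, hx, rfl⟩ := hV
        exact finrank_rowSp (hx.linearIndependent (Classical.arbitrary τ) (pivotPos_injective _ _))
      · rw [hval κ hκ, if_pos ((Fintype.equivFinOfCardEq hcard).symm l).2]
    · intro κ' _ hne
      by_contra h0
      refine hne (funext fun j => Subtype.ext ?_)
      rw [hval κ' (left_ne_zero_of_mul h0) j, hval κ hκ j]
    · exact fun h0 => absurd (Finset.mem_univ _) h0
  · push Not at hex
    rw [Finset.sum_eq_zero fun κ _ => by rw [hex, zero_mul]]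
    exact Nat.zero_le _

theorem Ach.sum_le (hk : 0 < k) {hkn : k ≤ n} {τ : Type} [Fintype τ] [DecidableEq τ]
    [Nonempty τ]
    {q : (τ → RectPart n k) → ℕ} (h : Ach hkn τ q) {d : τ → ℕ} (hd : ∑ j, d j = k * (n - k)) :
    ∑ κ : τ → RectPart n k, (∏ j, sytCount n k (d j) (κ j)) * q κ ≤
      sytCount n k (k * (n - k)) ⟨rectFull n k, isRectPartition_rectFull⟩ := by
  obtain ⟨N, hN⟩ : ∃ N, N = ∑ j, (d j - 1) := ⟨_, rfl⟩
  induction N generalizing τ with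
  | zero =>
    refine h.sum_le_of_le_one hk hd fun j => ?_
    have := Finset.sum_eq_zero_iff.1 hN.symm j (Finset.mem_univ j)
    omega
  | succ N ih =>
    obtain ⟨j, hj⟩ : ∃ j, d j - 1 ≠ 0 := by
      by_contra! hcon
      rw [Finset.sum_eq_zero fun j _ => hcon j] at hN
      omega
    have hdj : d j ≤ k * (n - k) := hd ▸ Finset.single_le_sum (fun _ _ => Nat.zero_le _)
      (Finset.mem_univ j)
    have hn : k < n := by
      by_contra hcon
      rw [show n - k = 0 by omega] at hdj
      omega
    have herase : ∀ f : ℕ → ℕ, ∑ l, f (Function.update d j (d j - 1) l) + f (d j) =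
        ∑ l, f (d l) + f (d j - 1) := fun f => by
      rw [← Finset.add_sum_erase _ _ (Finset.mem_univ j),
        ← Finset.add_sum_erase _ (fun l => f (d l)) (Finset.mem_univ j), Function.update_self,
        Finset.sum_congr rfl fun l hl => by
          rw [Function.update_of_ne (Finset.ne_of_mem_erase hl)]]
      ring
    have hsplit : Ach hkn (Option τ) fun κ => ∑ ν : RectPart n k,
        lrCount k (κ (some j)) (κ none) ν * q (Function.update (fun l => κ (some l)) j ν) := by
      convert h.split j
    have key := ih hsplit (d := fun o => o.elim 1 (Function.update d j (d j - 1))) ?_ ?_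
    · refine le_trans ?_ key
      let g : (τ → RectPart n k) → Option τ → RectPart n k :=
        fun κ o => o.elim ⟨Pi.single 0 1, isRectPartition_box hk hn⟩ κ
      have hg : Function.Injective g := fun κ κ' hκ => funext fun l => congrFun hκ (some l)
      have hle : ∀ F : (Option τ → RectPart n k) → ℕ, ∑ κ, F (g κ) ≤ ∑ κ, F κ := fun F => by
        rw [← Finset.sum_image (f := F) hg.injOn]
        exact Finset.sum_le_univ_sum_of_nonneg fun _ => Nat.zero_le _
      refine le_trans ?_ (hle _)
      have hbox : 1 ≤ sytCount n k 1 ⟨Pi.single 0 1, isRectPartition_box hk hn⟩ :=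
        sytCount_pos (by simp [hk])
      simp only [Fintype.prod_option, g, Option.elim_none, Option.elim_some]
      calc _ = ∑ κ : τ → RectPart n k, ∑ lam : RectPart n k, (if AddBox lam (κ j).1 then
            (∏ l, sytCount n k (Function.update d j (d j - 1) l) (Function.update κ j lam l)) *
              q κ else 0) := by
            refine Finset.sum_congr rfl fun κ _ => ?_
            rw [← Finset.mul_prod_erase _ _ (Finset.mem_univ j),
              show d j = d j - 1 + 1 by omega, sytCount, Finset.sum_mul, Finset.sum_mul]
            refine Finset.sum_congr rfl fun lam _ => ?_
            split_ifs
            · rw [← Finset.mul_prod_erase _ _ (Finset.mem_univ j), Function.update_self,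
                Function.update_self, Nat.add_sub_cancel]
              congr 2
              refine Finset.prod_congr rfl fun l hl => ?_
              rw [Function.update_of_ne (Finset.ne_of_mem_erase hl),
                Function.update_of_ne (Finset.ne_of_mem_erase hl)]
            · rw [zero_mul, zero_mul]
        _ = ∑ κ : τ → RectPart n k, ∑ ν : RectPart n k, (if AddBox (κ j).1 ν.1 then
            (∏ l, sytCount n k (Function.update d j (d j - 1) l) (κ l)) *
              q (Function.update κ j ν) else 0) := by
            rw [← Fintype.sum_prod_type', ← Fintype.sum_prod_type']
            let e : (τ → RectPart n k) × RectPart n k → (τ → RectPart n k) × RectPart n k :=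
              fun z => (Function.update z.1 j z.2, z.1 j)
            have he : Function.Involutive e := fun z => by simp [e]
            refine Fintype.sum_equiv he.toPerm _ _ fun z => ?_
            simp [e]
        _ ≤ _ := by
            refine Finset.sum_le_sum fun κ _ => ?_
            rw [Finset.mul_sum]
            refine Finset.sum_le_sum fun ν _ => ?_
            split_ifs with hadd
            · refine Nat.mul_le_mul (Nat.le_mul_of_pos_left _ hbox) (Nat.le_mul_of_pos_left _ ?_)
              exact one_le_lrCount_box hk hadd
            · exact Nat.zero_le _
    · have := herase id
      simp only [Fintype.sum_option, Option.elim_none, Option.elim_some]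
      simp only [id] at this
      omega
    · have := herase fun a => a - 1
      simp only [Fintype.sum_option, Option.elim_none, Option.elim_some]
      omega

end Breaking

theorem not_ach_chainCount_add {n k p : ℕ} (hk : 0 < k) (hkn : k ≤ n)
    {κ₀ : Fin (p + 1) → RectPart n k}
    (hκ₀ : ∑ j, ∑ i ∈ Finset.range k, (κ₀ j).1 i = k * (n - k)) :
    ¬ Ach hkn (Fin (p + 1)) fun κ => chainCount n k p κ + if κ = κ₀ then 1 else 0 := by
  intro h
  have h1 := h.sum_le hk hκ₀
  have h2 := sytCount_sum_le (n := n) (k := k) p fun j => ∑ i ∈ Finset.range k, (κ₀ j).1 i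
  rw [hκ₀] at h2
  simp only [mul_add, Finset.sum_add_distrib, mul_ite, mul_one, mul_zero, Finset.sum_ite_eq',
    Finset.mem_univ, if_true] at h1
  have h3 : 0 < ∏ j, sytCount n k (∑ i ∈ Finset.range k, (κ₀ j).1 i) (κ₀ j) :=
    Finset.prod_pos fun j _ => sytCount_pos rfl
  omega

section SkewTableaux

variable {n k : ℕ} {lam mu nu : ℕ → ℕ}

/-- The filling `T` of `nu / lam` has weakly increasing rows, and `a i j` of the entries in row `i`
are equal to `j + 1`. -/
structure HasRowContent (lam nu : ℕ → ℕ) (T : ℕ × ℕ → ℕ) (a : ℕ → ℕ → ℕ) : Prop where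
  pos_iff : ∀ x, 0 < T x ↔ InSkew lam nu x
  bound : ∀ i j, lam i + ∑ q ∈ Finset.range j, a i q ≤ nu i
  le_iff : ∀ i c j, InSkew lam nu (i, c) →
    (T (i, c) ≤ j ↔ c < lam i + ∑ q ∈ Finset.range j, a i q)

namespace HasRowContent

variable {T T' : ℕ × ℕ → ℕ} {a a' : ℕ → ℕ → ℕ}

theorem eq_succ_iff (h : HasRowContent lam nu T a) {i c j : ℕ} :
    T (i, c) = j + 1 ↔ lam i + ∑ q ∈ Finset.range j, a i q ≤ c ∧
      c < lam i + ∑ q ∈ Finset.range (j + 1), a i q := by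
  constructor
  · intro hT
    have hs := (h.pos_iff (i, c)).1 (by omega)
    rw [← h.le_iff i c (j + 1) hs, ← not_lt, ← h.le_iff i c j hs]
    omega
  · rintro ⟨h1, h2⟩
    have hs : InSkew lam nu (i, c) := ⟨(Nat.le_add_right _ _).trans h1, h2.trans_le (h.bound i _)⟩
    rw [← h.le_iff i c (j + 1) hs] at h2
    rw [← not_lt, ← h.le_iff i c j hs] at h1
    omega

theorem tableau_eq (h : HasRowContent lam nu T a) (h' : HasRowContent lam nu T' a) : T = T' := by
  funext ⟨i, c⟩
  by_cases hs : InSkew lam nu (i, c)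
  · exact le_antisymm ((h.le_iff i c _ hs).2 ((h'.le_iff i c _ hs).1 le_rfl))
      ((h'.le_iff i c _ hs).2 ((h.le_iff i c _ hs).1 le_rfl))
  · have h1 := (h.pos_iff _).not.2 hs
    have h2 := (h'.pos_iff _).not.2 hs
    omega

theorem array_eq (h : HasRowContent lam nu T a) (h' : HasRowContent lam nu T a') : a = a' := by
  funext i j
  have key : ∀ {a}, HasRowContent lam nu T a → a i j = Nat.card {c // T (i, c) = j + 1} := by
    intro a h
    rw [Nat.subtype_card (Finset.Ico (lam i + ∑ q ∈ Finset.range j, a i q)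
      (lam i + ∑ q ∈ Finset.range (j + 1), a i q)) fun c => by
        rw [Finset.mem_Ico, h.eq_succ_iff], Nat.card_Ico, Finset.sum_range_succ]
    omega
  rw [key h, key h']

theorem card_readBefore (h : HasRowContent lam nu T a) (j r c : ℕ) :
    Nat.card {x : ℕ × ℕ // ReadBefore r c x ∧ InSkew lam nu x ∧ T x = j + 1} =
      ∑ i ∈ Finset.range r, a i j + (lam r + ∑ q ∈ Finset.range (j + 1), a r q -
        max c (lam r + ∑ q ∈ Finset.range j, a r q)) := by
  rw [Nat.subtype_card (((Finset.range (r + 1)).sigma fun i => Finset.Ico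
    (if i = r then max c (lam i + ∑ q ∈ Finset.range j, a i q) else
      lam i + ∑ q ∈ Finset.range j, a i q)
    (lam i + ∑ q ∈ Finset.range (j + 1), a i q)).map (Equiv.sigmaEquivProd ℕ ℕ).toEmbedding),
    Finset.card_map, Finset.card_sigma, Finset.sum_range_succ, if_pos rfl, Nat.card_Ico]
  · congr 1
    refine Finset.sum_congr rfl fun i hi => ?_
    rw [if_neg (Finset.mem_range.1 hi).ne, Nat.card_Ico, Finset.sum_range_succ]
    omega
  · rintro ⟨i, c'⟩
    rw [Finset.mem_map_equiv, Finset.mem_sigma]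
    simp only [Equiv.sigmaEquivProd_symm_apply, Finset.mem_range, Finset.mem_Ico, ReadBefore]
    have h1 : InSkew lam nu (i, c') ∧ T (i, c') = j + 1 ↔ T (i, c') = j + 1 :=
      and_iff_right_of_imp fun h2 => (h.pos_iff _).1 (by omega)
    rw [h1, h.eq_succ_iff]
    split_ifs with h2
    · rw [max_le_iff]
      omega
    · omega

end HasRowContent

theorem IsLRArray.exists_hasRowContent (hlam : IsRectPartition n k lam)
    (hnu : IsRectPartition n k nu) {a : ℕ → ℕ → ℕ} (h : IsLRArray k lam mu nu a) :
    ∃ T, HasRowContent lam nu T a := by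
  have hmono : ∀ i, Monotone fun j => lam i + ∑ q ∈ Finset.range j, a i q := fun i j j' hj =>
    Nat.add_le_add_left (Finset.sum_le_sum_of_subset (Finset.range_mono hj)) _
  have hex : ∀ x, InSkew lam nu x → ∃ j, x.2 < lam x.1 + ∑ q ∈ Finset.range j, a x.1 q :=
    fun x hx => ⟨k, by
      have hk : x.1 < k := by
        by_contra hc
        have := hx.2
        rw [hnu.2.2 _ (not_lt.1 hc)] at this
        omega
      rw [h.row _ hk]
      exact hx.2⟩
  have hle : ∀ i c j, InSkew lam nu (i, c) → ((if hx : InSkew lam nu (i, c) then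
      Nat.find (hex (i, c) hx) else 0) ≤ j ↔ c < lam i + ∑ q ∈ Finset.range j, a i q) := by
    intro i c j hs
    rw [dif_pos hs, Nat.find_le_iff]
    exact ⟨fun ⟨m, hm, hc⟩ => hc.trans_le (hmono i hm), fun hc => ⟨j, le_rfl, hc⟩⟩
  refine ⟨fun x => if hx : InSkew lam nu x then Nat.find (hex x hx) else 0,
    fun x => ?_, fun i j => ?_, fun i c j hs => hle i c j hs⟩
  · constructor
    · intro hx
      by_contra hc
      simp [hc] at hx
    · intro hx
      have h1 := (hle x.1 x.2 0 hx).not.2 (by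
        rw [Finset.sum_range_zero, add_zero, not_lt]
        exact hx.1)
      exact not_le.1 h1
  · rcases lt_or_ge i k with hi | hi
    · rw [← h.row i hi]
      refine Nat.add_le_add_left ?_ _
      rcases le_or_gt j k with hj | hj
      · exact Finset.sum_le_sum_of_subset (Finset.range_mono hj)
      · refine (Finset.sum_subset (Finset.range_mono hj.le) fun q _ hq => h.eq_zero ?_).symm.le
        rw [Finset.mem_range] at hq
        omega
    · rw [Finset.sum_eq_zero fun q _ => h.zero i q hi, hlam.2.2 i hi]
      exact Nat.zero_le _

theorem IsLRSkewTableau.exists_hasRowContent (hle : ∀ i, lam i ≤ nu i) {T : ℕ × ℕ → ℕ}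
    (h : IsLRSkewTableau lam mu nu T) : ∃ a, HasRowContent lam nu T a := by
  have hsum : ∀ i j, ∑ q ∈ Finset.range j, ((Finset.range (nu i)).filter
      fun c => T (i, c) = q + 1).card =
      ((Finset.Ico (lam i) (nu i)).filter fun c => T (i, c) ≤ j).card := by
    intro i j
    rw [← Finset.card_biUnion]
    · congr 1
      ext c
      have h1 := h.1 (i, c)
      simp only [InSkew] at h1
      simp only [Finset.mem_biUnion, Finset.mem_filter, Finset.mem_range, Finset.mem_Ico]
      constructor
      · rintro ⟨q, hq, hc, hT⟩
        exact ⟨h1.1 (by omega), by omega⟩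
      · rintro ⟨hc, hT⟩
        have := h1.2 hc
        exact ⟨T (i, c) - 1, by omega, hc.2, by omega⟩
    · intro q _ q' _ hq
      refine Finset.disjoint_left.2 fun c hc hc' => hq ?_
      have h1 := (Finset.mem_filter.1 hc).2
      have h2 := (Finset.mem_filter.1 hc').2
      omega
  refine ⟨fun i q => ((Finset.range (nu i)).filter fun c => T (i, c) = q + 1).card, h.1,
    fun i j => ?_, fun i c j hs => ?_⟩
  · rw [hsum]
    have h1 := Finset.card_filter_le (Finset.Ico (lam i) (nu i)) fun c => T (i, c) ≤ j
    have h2 := hle i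
    rw [Nat.card_Ico] at h1
    omega
  · have h1 : lam i ≤ c := hs.1
    have h2 : c < nu i := hs.2
    rw [hsum]
    constructor
    · intro hT
      have h3 := Finset.card_le_card (s := Finset.Ico (lam i) (c + 1))
        (t := (Finset.Ico (lam i) (nu i)).filter fun c => T (i, c) ≤ j) fun c' hc' => by
          rw [Finset.mem_Ico] at hc'
          rw [Finset.mem_filter, Finset.mem_Ico]
          exact ⟨by omega, (h.2.1 i c' c hc'.1 (by omega) hs.2).trans hT⟩
      rw [Nat.card_Ico] at h3
      omega
    · intro hc
      by_contra hT
      have h3 := Finset.card_le_card (t := Finset.Ico (lam i) c)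
        (s := (Finset.Ico (lam i) (nu i)).filter fun c => T (i, c) ≤ j) fun c' hc' => by
          rw [Finset.mem_filter, Finset.mem_Ico] at hc'
          rw [Finset.mem_Ico]
          refine ⟨hc'.1.1, not_le.1 fun hcc => hT ((h.2.1 i c c' hs.1 hcc hc'.1.2).trans hc'.2)⟩
      rw [Nat.card_Ico] at h3
      omega

theorem HasRowContent.isLRSkewTableau_iff (hlam : IsRectPartition n k lam)
    (hnu : IsRectPartition n k nu) (hmu : ∀ j, k ≤ j → mu j = 0) {T : ℕ × ℕ → ℕ} {a : ℕ → ℕ → ℕ}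
    (h : HasRowContent lam nu T a) : IsLRSkewTableau lam mu nu T ↔ IsLRArray k lam mu nu a := by
  have hzero : ∀ i j, k ≤ i → a i j = 0 := fun i j hi => by
    have := h.bound i (j + 1)
    rw [hnu.2.2 i hi, Finset.sum_range_succ] at this
    omega
  have hmono : ∀ i, Monotone fun j => lam i + ∑ q ∈ Finset.range j, a i q := fun i j j' hj =>
    Nat.add_le_add_left (Finset.sum_le_sum_of_subset (Finset.range_mono hj)) _
  have hcont : ∀ j, Nat.card {x : ℕ × ℕ // InSkew lam nu x ∧ T x = j + 1} =
      ∑ i ∈ Finset.range k, a i j := fun j => by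
    have h1 := h.card_readBefore j k 0
    rw [Finset.sum_range_succ, hzero k j le_rfl, add_zero, Nat.sub_eq_zero_of_le (le_max_right _ _),
      add_zero] at h1
    rw [← h1]
    refine Nat.card_congr (Equiv.subtypeEquivRight fun x => ⟨fun hx => ⟨Or.inl ?_, hx⟩, And.right⟩)
    by_contra hc
    have h2 := hx.1.2
    rw [hnu.2.2 _ (not_lt.1 hc)] at h2
    omega
  constructor
  · intro hT
    have hmuc : ∀ j, ∑ i ∈ Finset.range k, a i j = mu j := fun j => by
      rw [← hcont]
      exact hT.2.2.2.1 (j + 1) (Nat.succ_pos j)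
    refine ⟨hzero, fun i hi => (h.bound i k).antisymm ?_, hmuc, fun i q hi => ?_, fun i j hi => ?_⟩
    · by_contra hlt
      rw [not_le] at hlt
      have hs : InSkew lam nu (i, lam i + ∑ q ∈ Finset.range k, a i q) :=
        ⟨Nat.le_add_right _ _, hlt⟩
      have h1 := (h.le_iff i _ k hs).not.2 (lt_irrefl _)
      obtain ⟨j, hj⟩ : ∃ j, T (i, lam i + ∑ q ∈ Finset.range k, a i q) = j + 1 :=
        ⟨T (i, lam i + ∑ q ∈ Finset.range k, a i q) - 1, by omega⟩
      have h2 := h.eq_succ_iff.1 hj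
      have h3 : a i j = 0 := by
        have h4 := hmuc j
        rw [hmu j (by omega)] at h4
        exact Finset.sum_eq_zero_iff.1 h4 i (Finset.mem_range.2 hi)
      rw [Finset.sum_range_succ, h3] at h2
      omega
    · by_contra hlt
      rw [not_le] at hlt
      have h1 := h.bound (i + 1) (q + 1)
      have h2 : nu (i + 1) ≤ nu i := hnu.1 (Nat.le_succ i)
      have h3 : lam (i + 1) ≤ lam i := hlam.1 (Nat.le_succ i)
      have hs : InSkew lam nu (i, lam i + ∑ p ∈ Finset.range q, a i p) :=
        ⟨Nat.le_add_right _ _, by dsimp only; omega⟩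
      have hs' : InSkew lam nu (i + 1, lam i + ∑ p ∈ Finset.range q, a i p) :=
        ⟨by dsimp only; omega, by dsimp only; omega⟩
      have h4 := hT.2.2.1 i (i + 1) _ (Nat.lt_succ_self i) hs hs'
      have h5 := (h.le_iff (i + 1) _ (q + 1) hs').2 hlt
      have h6 := (h.le_iff i _ q hs).not.2 (lt_irrefl _)
      omega
    · have h1 := hT.2.2.2.2 (j + 1) (Nat.succ_pos j) i (lam i + ∑ q ∈ Finset.range (j + 1), a i q)
      rw [h.card_readBefore, h.card_readBefore, max_self, Finset.sum_range_succ _ (j + 1)] at h1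
      rw [Finset.sum_range_succ]
      omega
  · intro ha
    have hlat : ∀ r j, ∑ p ∈ Finset.range (r + 1), a p (j + 1) ≤ ∑ p ∈ Finset.range r, a p j := by
      intro r j
      induction r with
      | zero =>
        rcases Nat.eq_zero_or_pos k with hk | hk
        · simp [hzero 0 (j + 1) (by omega)]
        · exact ha.lattice 0 j hk
      | succ r ih =>
        rcases lt_or_ge (r + 1) k with hr | hr
        · exact ha.lattice (r + 1) j hr
        · rw [Finset.sum_range_succ, hzero (r + 1) (j + 1) hr, add_zero]
          exact ih.trans (Finset.sum_le_sum_of_subset (Finset.range_mono (Nat.le_succ r)))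
    have hcol : ∀ i d q, i + d + 1 < k → lam (i + d + 1) + ∑ p ∈ Finset.range (q + 1),
        a (i + d + 1) p ≤ lam i + ∑ p ∈ Finset.range q, a i p := by
      intro i d
      induction d with
      | zero => exact fun q hi => ha.column i q hi
      | succ d ih =>
        intro q hi
        refine (ha.column (i + (d + 1)) q hi).trans ((hmono _ (Nat.le_succ q)).trans ?_)
        exact ih q (by omega)
    refine ⟨h.pos_iff, fun i j j' h1 h2 h3 => ?_, fun i i' c hi hs hs' => ?_, fun m hm => ?_,
      fun m hm r c => ?_⟩
    · rw [h.le_iff i j _ ⟨h1, h2.trans_lt h3⟩]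
      exact h2.trans_lt ((h.le_iff i j' _ ⟨h1.trans h2, h3⟩).1 le_rfl)
    · have hik : i' < k := by
        by_contra hc
        have h2 := hs'.2
        rw [hnu.2.2 _ (not_lt.1 hc)] at h2
        omega
      have h1 := (h.pos_iff _).2 hs'
      obtain ⟨q, hq⟩ : ∃ q, T (i', c) = q + 1 := ⟨T (i', c) - 1, by omega⟩
      have h2 := (h.le_iff i' c (q + 1) hs').1 hq.le
      have h3 := hcol i (i' - i - 1) q (by omega)
      rw [show i + (i' - i - 1) + 1 = i' by omega] at h3
      have h4 := (h.le_iff i c q hs).2 (h2.trans_le h3)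
      omega
    · obtain ⟨j, rfl⟩ : ∃ j, m = j + 1 := ⟨m - 1, by omega⟩
      rw [hcont, ha.content, Nat.add_sub_cancel]
    · obtain ⟨j, rfl⟩ : ∃ j, m = j + 1 := ⟨m - 1, by omega⟩
      rw [h.card_readBefore, h.card_readBefore]
      have h1 := hlat r j
      rw [Finset.sum_range_succ] at h1
      rw [Finset.sum_range_succ _ (j + 1)]
      omega

theorem exists_bijective_isLRSkewTableau (hlam : IsRectPartition n k lam)
    (hnu : IsRectPartition n k nu) (hmu : ∀ j, k ≤ j → mu j = 0) :
    ∃ f : {a // IsLRArray k lam mu nu a} →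
      {T // (∀ i, lam i ≤ nu i) ∧ IsLRSkewTableau lam mu nu T}, Function.Bijective f := by
  choose T hT using fun a : {a // IsLRArray k lam mu nu a} => a.2.exists_hasRowContent hlam hnu
  refine ⟨fun a => ⟨T a, fun i => ?_, ((hT a).isLRSkewTableau_iff hlam hnu hmu).2 a.2⟩,
    fun a b hab => ?_, ?_⟩
  · exact (Nat.le_add_right _ _).trans ((hT a).bound i 0)
  · have h1 : T a = T b := congrArg Subtype.val hab
    exact Subtype.ext ((hT a).array_eq (h1 ▸ hT b))
  · rintro ⟨T', hle, hT'⟩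
    obtain ⟨a, ha⟩ := hT'.exists_hasRowContent hle
    exact ⟨⟨a, (ha.isLRSkewTableau_iff hlam hnu hmu).1 hT'⟩, Subtype.ext ((hT _).tableau_eq ha)⟩

theorem natCard_isLRSkewTableau (hlam : IsRectPartition n k lam) (hnu : IsRectPartition n k nu)
    (hmu : ∀ j, k ≤ j → mu j = 0) :
    Nat.card {T // (∀ i, lam i ≤ nu i) ∧ IsLRSkewTableau lam mu nu T} = lrCount k lam mu nu := by
  obtain ⟨f, hf⟩ := exists_bijective_isLRSkewTableau hlam hnu hmu
  exact (Nat.card_eq_of_bijective f hf).symm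

theorem finite_isLRSkewTableau (hlam : IsRectPartition n k lam) (hnu : IsRectPartition n k nu)
    (hmu : ∀ j, k ≤ j → mu j = 0) :
    Finite {T // (∀ i, lam i ≤ nu i) ∧ IsLRSkewTableau lam mu nu T} := by
  obtain ⟨f, hf⟩ := exists_bijective_isLRSkewTableau hlam hnu hmu
  have : Finite {a // IsLRArray k lam mu nu a} := IsLRArray.finite
  exact Finite.of_surjective f hf.2

end SkewTableaux

section LRChains

variable {n k : ℕ}

/-- The chains of tableaux counted by `iteratedLRNumber`. -/
def IsLRChain (n k m : ℕ) (lams : ℕ → ℕ → ℕ) (p : (ℕ → ℕ → ℕ) × (ℕ → ℕ × ℕ → ℕ)) : Prop :=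
  p.1 0 = lams 0 ∧
    (∀ j, m - 1 ≤ j → p.1 j = rectFull n k) ∧
    (∀ j, IsRectPartition n k (p.1 j)) ∧
    p.2 0 = (fun _ => 0) ∧
    (∀ j, m ≤ j → p.2 j = fun _ => 0) ∧
    (∀ j, 1 ≤ j → j ≤ m - 1 →
      (∀ i, p.1 (j - 1) i ≤ p.1 j i) ∧
      IsLRSkewTableau (p.1 (j - 1)) (lams j) (p.1 j) (p.2 j))

/-- Replacing the first two entries of a list of partitions by a single one. -/
def mergeHead (nu : ℕ → ℕ) (lams : ℕ → ℕ → ℕ) : ℕ → ℕ → ℕ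
  | 0 => nu
  | j + 1 => lams (j + 2)

/-- Inserting a value at index one. -/
def consTableau (S : ℕ × ℕ → ℕ) (T : ℕ → ℕ × ℕ → ℕ) : ℕ → ℕ × ℕ → ℕ
  | 0 => fun _ => 0
  | 1 => S
  | j + 2 => T (j + 1)

theorem IsLRChain.cons {p : ℕ} {lams : ℕ → ℕ → ℕ} (h0 : IsRectPartition n k (lams 0))
    {nu : RectPart n k} {S : ℕ × ℕ → ℕ}
    (hS : (∀ i, lams 0 i ≤ nu.1 i) ∧ IsLRSkewTableau (lams 0) (lams 1) nu.1 S)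
    {q : (ℕ → ℕ → ℕ) × (ℕ → ℕ × ℕ → ℕ)} (hq : IsLRChain n k (p + 1) (mergeHead nu.1 lams) q) :
    IsLRChain n k (p + 2) lams
      (fun j => Nat.casesOn j (lams 0) q.1, consTableau S q.2) := by
  obtain ⟨h1, h2, h3, h4, h5, h6⟩ := hq
  refine ⟨rfl, ?_, ?_, rfl, ?_, ?_⟩
  · rintro (_ | j) hj
    · omega
    · exact h2 j (by omega)
  · rintro (_ | j)
    · exact h0
    · exact h3 j
  · rintro (_ | _ | j) hj
    · omega
    · omega
    · exact h5 (j + 1) (by omega)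
  · rintro (_ | _ | j) hj hj'
    · omega
    · have : q.1 0 = nu.1 := h1
      change (∀ i, lams 0 i ≤ q.1 0 i) ∧ IsLRSkewTableau (lams 0) (lams 1) (q.1 0) S
      rw [this]
      exact hS
    · exact h6 (j + 1) (by omega) (by omega)

theorem exists_bijective_isLRChain (p : ℕ) {lams : ℕ → ℕ → ℕ}
    (h0 : IsRectPartition n k (lams 0)) :
    ∃ f : (Σ nu : RectPart n k,
        {S // (∀ i, lams 0 i ≤ nu.1 i) ∧ IsLRSkewTableau (lams 0) (lams 1) nu.1 S} ×
          {q // IsLRChain n k (p + 1) (mergeHead nu.1 lams) q}) →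
      {q // IsLRChain n k (p + 2) lams q}, Function.Bijective f := by
  refine ⟨fun x => ⟨_, IsLRChain.cons h0 x.2.1.2 x.2.2.2⟩, ?_, ?_⟩
  · rintro ⟨nu, ⟨S, hS⟩, ⟨⟨c, T⟩, hq⟩⟩ ⟨nu', ⟨S', hS'⟩, ⟨⟨c', T'⟩, hq'⟩⟩ hab
    have h1 := congrArg Prod.fst (congrArg Subtype.val hab)
    have h2 := congrArg Prod.snd (congrArg Subtype.val hab)
    have hc : c = c' := funext fun j => congrFun h1 (j + 1)
    have hS : S = S' := congrFun h2 1
    have hT : T = T' := by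
      funext j
      rcases j with _ | j
      · exact hq.2.2.2.1.trans hq'.2.2.2.1.symm
      · exact congrFun h2 (j + 2)
    have hnu : nu = nu' := Subtype.ext <| by
      have h3 : c 0 = nu.1 := hq.1
      have h4 : c' 0 = nu'.1 := hq'.1
      rw [← h3, ← h4, hc]
    subst hnu hc hS hT
    rfl
  · rintro ⟨⟨c, T⟩, h1, h2, h3, h4, h5, h6⟩
    dsimp only at h1 h2 h3 h4 h5 h6
    refine ⟨⟨⟨c 1, h3 1⟩, ⟨T 1, ?_⟩, ⟨(fun j => c (j + 1),
      fun j => Nat.casesOn j (fun _ => 0) fun j => T (j + 2)), ?_⟩⟩, ?_⟩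
    · have := h6 1 le_rfl (by omega)
      rw [Nat.sub_self, h1] at this
      exact this
    · refine ⟨rfl, fun j hj => h2 _ (by omega), fun j => h3 _, rfl, ?_, ?_⟩
      · rintro (_ | j) hj
        · omega
        · exact h5 _ (by omega)
      · rintro (_ | j) hj hj'
        · omega
        · exact h6 (j + 2) (by omega) (by omega)
    · refine Subtype.ext (Prod.ext (funext ?_) (funext ?_))
      · rintro (_ | j)
        · exact h1.symm
        · rfl
      · rintro (_ | _ | j)
        · exact h4.symm
        · rfl
        · rfl

theorem natCard_isLRChain_one {lams : ℕ → ℕ → ℕ} (h0 : IsRectPartition n k (lams 0)) :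
    Finite {q // IsLRChain n k 1 lams q} ∧
      Nat.card {q // IsLRChain n k 1 lams q} = if lams 0 = rectFull n k then 1 else 0 := by
  have key : ∀ q, IsLRChain n k 1 lams q ↔
      lams 0 = rectFull n k ∧ q = (fun _ => rectFull n k, fun _ _ => 0) := by
    rintro ⟨c, T⟩
    constructor
    · rintro ⟨h1, h2, h3, h4, h5, h6⟩
      refine ⟨h1.symm.trans (h2 0 le_rfl), Prod.ext (funext fun j => h2 j (Nat.zero_le _))
        (funext ?_)⟩
      rintro (_ | j)
      · exact h4
      · exact h5 _ (by omega)
    · rintro ⟨h, h'⟩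
      obtain ⟨rfl, rfl⟩ := Prod.mk.inj h'
      exact ⟨h.symm, fun _ _ => rfl, fun _ => h ▸ h0, rfl, fun _ _ => rfl, fun j _ _ => by omega⟩
  split_ifs with h
  · have : Unique {q // IsLRChain n k 1 lams q} :=
      { default := ⟨_, (key _).2 ⟨h, rfl⟩⟩
        uniq := fun q => Subtype.ext ((key _).1 q.2).2 }
    exact ⟨inferInstance, Nat.card_unique⟩
  · have : IsEmpty {q // IsLRChain n k 1 lams q} := ⟨fun q => h ((key _).1 q.2).1⟩
    exact ⟨inferInstance, Nat.card_of_isEmpty⟩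

theorem natCard_isLRChain (p : ℕ) {lams : ℕ → ℕ → ℕ}
    (h : ∀ j, j < p + 1 → IsRectPartition n k (lams j)) :
    Finite {q // IsLRChain n k (p + 1) lams q} ∧ Nat.card {q // IsLRChain n k (p + 1) lams q} =
      chainCount n k p fun j => ⟨lams j, h j j.2⟩ := by
  induction p generalizing lams with
  | zero => exact natCard_isLRChain_one (h 0 (by omega))
  | succ p ih =>
    obtain ⟨f, hf⟩ := exists_bijective_isLRChain p (h 0 (by omega))
    have h' : ∀ nu : RectPart n k, ∀ j, j < p + 1 →
        IsRectPartition n k (mergeHead nu.1 lams j) := by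
      rintro nu (_ | j) hj
      · exact nu.2
      · exact h _ (by omega)
    have hfin : ∀ nu : RectPart n k, Finite
        ({S // (∀ i, lams 0 i ≤ nu.1 i) ∧ IsLRSkewTableau (lams 0) (lams 1) nu.1 S} ×
          {q // IsLRChain n k (p + 1) (mergeHead nu.1 lams) q}) := fun nu => by
      have := finite_isLRSkewTableau (h 0 (by omega)) nu.2 (h 1 (by omega)).2.2
      have := (ih (h' nu)).1
      infer_instance
    refine ⟨Finite.of_surjective f hf.2, ?_⟩
    rw [← Nat.card_eq_of_bijective f hf, Nat.card_sigma, chainCount]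
    refine Finset.sum_congr rfl fun nu _ => ?_
    rw [Nat.card_prod, natCard_isLRSkewTableau (h 0 (by omega)) nu.2 (h 1 (by omega)).2.2,
      (ih (h' nu)).2]
    congr 2
    funext j
    refine Fin.cases rfl (fun i => rfl) j

theorem iteratedLRNumber_eq_chainCount (p : ℕ) {lams : ℕ → ℕ → ℕ}
    (h : ∀ j, j < p + 1 → IsRectPartition n k (lams j)) :
    iteratedLRNumber n k (p + 1) lams = chainCount n k p fun j => ⟨lams j, h j j.2⟩ :=
  (natCard_isLRChain p h).2

end LRChains

section EchelonForm

variable {k n : ℕ}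

theorem exists_submatrix_isUnit {M : Matrix (Fin k) (Fin n) ℝ} (hM : LinearIndependent ℝ M.row) :
    ∃ I : Fin k → Fin n, IsUnit (M.submatrix id I) := by
  obtain ⟨κ, a, ha, hspan, hli⟩ := exists_linearIndependent' ℝ M.col
  have : Finite κ := Finite.of_injective a ha
  have : Fintype κ := Fintype.ofFinite κ
  have hcard : Fintype.card κ = Fintype.card (Fin k) := by
    have h1 := finrank_span_eq_card hli
    rw [hspan, ← Matrix.rank_eq_finrank_span_cols, hM.rank_matrix] at h1
    exact h1.symm
  let e : Fin k ≃ κ := Fintype.equivOfCardEq hcard.symm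
  refine ⟨a ∘ e, ?_⟩
  rw [← Matrix.linearIndependent_cols_iff_isUnit]
  exact hli.comp e e.injective

/-- Reduced row echelon form, with the leading entry of a row being its last nonzero one. -/
theorem exists_echelon {M : Matrix (Fin k) (Fin n) ℝ} (hM : LinearIndependent ℝ M.row) :
    ∃ (I : Fin k → Fin n) (A : Matrix (Fin k) (Fin k) ℝ), StrictMono I ∧ IsUnit A ∧
      (∀ i j, (A * M) i (I j) = if i = j then 1 else 0) ∧ ∀ j r, I j < r → (A * M) j r = 0 := by
  have hne : (Finset.univ.filter fun I : Fin k → Fin n => IsUnit (M.submatrix id I)).Nonempty := by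
    obtain ⟨I, hI⟩ := exists_submatrix_isUnit hM
    exact ⟨I, by simpa using hI⟩
  obtain ⟨I, hI, hmax⟩ := Finset.exists_max_image _ (fun I => ∑ j, (I j : ℕ)) hne
  simp only [Finset.mem_filter, Finset.mem_univ, true_and] at hI hmax
  set B := M.submatrix id I with hB
  have hBu := (Matrix.isUnit_iff_isUnit_det B).1 hI
  have hone : (B⁻¹ * M).submatrix id I = 1 := by
    rw [← Matrix.nonsing_inv_mul B hBu]
    rfl
  have hone' : ∀ i j, (B⁻¹ * M) i (I j) = if i = j then 1 else 0 := fun i j => by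
    rw [← Matrix.one_apply, ← hone]
    rfl
  have hinj : Function.Injective I := fun i j hij => by
    have h1 := hone' i j
    rw [← hij, hone' i i, if_pos rfl] at h1
    by_contra hne
    rw [if_neg hne] at h1
    exact one_ne_zero h1
  have hzero : ∀ j r, I j < r → (B⁻¹ * M) j r = 0 := by
    intro j r hr
    by_contra h0
    have hu : IsUnit (M.submatrix id (Function.update I j r)) := by
      have h1 : M.submatrix id (Function.update I j r) =
          B * (B⁻¹ * M).submatrix id (Function.update I j r) := by
        have h2 : M = B * (B⁻¹ * M) := by
          rw [← Matrix.mul_assoc, Matrix.mul_nonsing_inv B hBu, Matrix.one_mul]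
        conv_lhs => rw [h2]
        rfl
      have h3 : (B⁻¹ * M).submatrix id (Function.update I j r) =
          (1 : Matrix (Fin k) (Fin k) ℝ).updateCol j fun i => (B⁻¹ * M) i r := by
        ext i j'
        by_cases hj : j' = j
        · subst hj
          simp
        · simp only [Matrix.submatrix_apply, id_eq, Function.update_of_ne hj,
            Matrix.updateCol_ne hj, hone', Matrix.one_apply]
      rw [h1, h3]
      refine hI.mul ?_
      rw [Matrix.isUnit_iff_isUnit_det, isUnit_iff_ne_zero]
      have h4 := Matrix.cramer_apply (1 : Matrix (Fin k) (Fin k) ℝ) (fun i => (B⁻¹ * M) i r) j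
      rw [Matrix.cramer_one] at h4
      rw [← h4]
      exact h0
    have h1 := hmax _ hu
    refine absurd h1 (not_le.2 (Finset.sum_lt_sum (fun i _ => ?_) ⟨j, Finset.mem_univ _, ?_⟩))
    · by_cases hi : i = j
      · subst hi
        simpa using hr.le
      · rw [Function.update_of_ne hi]
    · simpa using hr
  let σ := Tuple.sort I
  refine ⟨I ∘ σ, B⁻¹.submatrix σ id,
    (Tuple.monotone_sort I).strictMono_of_injective (hinj.comp σ.injective), ?_, ?_, ?_⟩
  · exact (Matrix.isUnit_submatrix_equiv σ (Equiv.refl _)).2 (Matrix.isUnit_nonsing_inv_iff.2 hI)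
  · intro i j
    refine (hone' (σ i) (σ j)).trans ?_
    simp [σ.injective.eq_iff]
  · exact fun j r hr => hzero (σ j) r hr

end EchelonForm

section Flags

variable {k n : ℕ}

/-- The step of dimension `c` of the complete flag attached to an invertible matrix. -/
def flagStep (H : Matrix (Fin n) (Fin n) ℝ) (c : ℕ) : Submodule ℝ (Fin n → ℝ) where
  carrier := {w | ∀ r : Fin n, c ≤ (r : ℕ) → Matrix.vecMul w H r = 0}
  add_mem' := fun ha hb r hr => by rw [Matrix.add_vecMul, Pi.add_apply, ha r hr, hb r hr, add_zero]
  zero_mem' := fun r _ => by rw [Matrix.zero_vecMul]; rfl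
  smul_mem' := fun c w hw r hr => by rw [Matrix.smul_vecMul, Pi.smul_apply, hw r hr, smul_zero]

theorem flagStep_mono (H : Matrix (Fin n) (Fin n) ℝ) : Monotone (flagStep H) :=
  fun _ _ h _ hw r hr => hw r (h.trans hr)

theorem flagStep_zero {H : Matrix (Fin n) (Fin n) ℝ} (hH : IsUnit H) : flagStep H 0 = ⊥ := by
  rw [eq_bot_iff]
  intro w hw
  have h1 : Matrix.vecMul w H = 0 := funext fun r => hw r (Nat.zero_le _)
  rw [← Matrix.zero_vecMul H] at h1
  exact Matrix.vecMul_injective_of_isUnit hH h1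

theorem flagStep_self (H : Matrix (Fin n) (Fin n) ℝ) : flagStep H n = ⊤ :=
  eq_top_iff.2 fun _ _ r hr => absurd r.2 (not_lt.2 hr)

theorem finrank_flagStep {H : Matrix (Fin n) (Fin n) ℝ} (hH : IsUnit H) {c : ℕ} (hc : c ≤ n) :
    finrank ℝ (flagStep H c) = c := by
  have hdet := (Matrix.isUnit_iff_isUnit_det H).1 hH
  have hli : LinearIndependent ℝ fun i : Fin c => H⁻¹.row (Fin.castLE hc i) :=
    (Matrix.linearIndependent_rows_iff_isUnit.2 (Matrix.isUnit_nonsing_inv_iff.2 hH)).comp _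
      (Fin.castLE_injective hc)
  have h1 : flagStep H c =
      Submodule.span ℝ (Set.range fun i : Fin c => H⁻¹.row (Fin.castLE hc i)) := by
    refine le_antisymm (fun w hw => ?_) (Submodule.span_le.2 ?_)
    · have h2 : w = ∑ r, Matrix.vecMul w H r • H⁻¹.row r := by
        have h3 : Matrix.vecMul (Matrix.vecMul w H) H⁻¹ = w := by
          rw [Matrix.vecMul_vecMul, Matrix.mul_nonsing_inv H hdet, Matrix.vecMul_one]
        rw [Matrix.vecMul_eq_sum] at h3
        exact h3.symm
      rw [h2]
      refine Submodule.sum_mem _ fun r _ => ?_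
      rcases lt_or_ge (r : ℕ) c with hr | hr
      · exact Submodule.smul_mem _ _ (Submodule.subset_span ⟨⟨r, hr⟩, rfl⟩)
      · rw [hw r hr, zero_smul]
        exact Submodule.zero_mem _
    · rintro _ ⟨i, rfl⟩ r hr
      have h2 : Matrix.vecMul (H⁻¹.row (Fin.castLE hc i)) H r =
        (H⁻¹ * H) (Fin.castLE hc i) r := rfl
      rw [h2, Matrix.nonsing_inv_mul H hdet, Matrix.one_apply_ne]
      rintro rfl
      exact absurd i.2 (not_lt.2 hr)
  rw [h1, finrank_span_eq_card hli, Fintype.card_fin]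

theorem lt_of_le_finrank_inf_flagStep {x : Matrix (Fin k) (Fin n) ℝ}
    {H : Matrix (Fin n) (Fin n) ℝ} {A : Matrix (Fin k) (Fin k) ℝ} (hA : IsUnit A)
    {I : Fin k → Fin n} (hI : StrictMono I)
    (hone : ∀ i j, (A * (x * H)) i (I j) = if i = j then 1 else 0) {i : Fin k} {c : ℕ}
    (hc : (i : ℕ) + 1 ≤ finrank ℝ ↥(rowSp x ⊓ flagStep H c)) : (I i : ℕ) < c := by
  by_contra! hlt
  have hle : rowSp x ⊓ flagStep H c ≤
      Submodule.span ℝ (Set.range fun j : Fin i => (A * x).row (Fin.castLE i.2.le j)) := by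
    rintro w ⟨hw, hw'⟩
    rw [SetLike.mem_coe, ← rowSp_mul hA] at hw
    obtain ⟨a, rfl⟩ := hw
    have ha : ∀ j, i ≤ j → a j = 0 := by
      intro j hj
      have h1 := hw' (I j) (hlt.trans (hI.monotone hj))
      rw [Matrix.vecMulLinear_apply, Matrix.vecMul_vecMul, Matrix.mul_assoc, Matrix.vecMul,
        dotProduct] at h1
      simpa [hone] using h1
    rw [Matrix.vecMulLinear_apply, Matrix.vecMul_eq_sum]
    refine Submodule.sum_mem _ fun j _ => ?_
    rcases lt_or_ge j i with hj | hj
    · exact Submodule.smul_mem _ _ (Submodule.subset_span ⟨⟨j, hj⟩, rfl⟩)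
    · rw [ha j hj, zero_smul]
      exact Submodule.zero_mem _
  have h1 := (Submodule.finrank_mono hle).trans (finrank_range_le_card _)
  rw [Fintype.card_fin] at h1
  omega

end Flags

section Sard

/-- **Sard's theorem** for maps into a space of at least the same dimension. -/
theorem measure_critical_values_eq_zero {P E : Type*} [NormedAddCommGroup P] [NormedSpace ℝ P]
    [FiniteDimensional ℝ P] [NormedAddCommGroup E] [NormedSpace ℝ E] [FiniteDimensional ℝ E]
    [MeasurableSpace E] [BorelSpace E] (μ : MeasureTheory.Measure E) [μ.IsAddHaarMeasure]
    {f : P → E} (hf : Differentiable ℝ f) (h : finrank ℝ P ≤ finrank ℝ E) :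
    μ {e | ∃ p, f p = e ∧ ¬ Function.Surjective (fderiv ℝ f p)} = 0 := by
  obtain ⟨i, hi⟩ := finrank_le_iff_exists_linearMap.1 h
  obtain ⟨L, hL⟩ := i.exists_leftInverse_of_injective (LinearMap.ker_eq_bot.2 hi)
  let L' : E →L[ℝ] P := L.toContinuousLinearMap
  have hLi : ∀ p, L' (i p) = p := fun p => LinearMap.congr_fun hL p
  have h1 := MeasureTheory.addHaar_image_eq_zero_of_det_fderivWithin_eq_zero μ
    (s := {e | ¬ Function.Surjective (fderiv ℝ f (L' e))}) (f := f ∘ L')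
    (f' := fun e => (fderiv ℝ f (L' e)).comp L')
    (fun e _ => ((hf (L' e)).hasFDerivAt.comp e L'.hasFDerivAt).hasFDerivWithinAt) ?_
  · refine MeasureTheory.measure_mono_null ?_ h1
    rintro _ ⟨p, rfl, hp⟩
    refine ⟨i p, ?_, ?_⟩
    · rw [Set.mem_ofPred_eq, hLi]
      exact hp
    · rw [Function.comp_apply, hLi]
  · intro e he
    by_contra hdet
    refine he fun w => ?_
    have hb := LinearMap.isUnit_iff_range_eq_top _ |>.1 ((LinearMap.isUnit_iff_isUnit_det
      (((fderiv ℝ f (L' e)).comp L' : E →L[ℝ] E) : E →ₗ[ℝ] E)).2 (isUnit_iff_ne_zero.2 hdet))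
    obtain ⟨v, hv⟩ := LinearMap.range_eq_top.1 hb w
    exact ⟨L' v, hv⟩

end Sard

section EchelonChart

variable {k n : ℕ} {ι P : Type*} [NormedAddCommGroup P] [NormedSpace ℝ P]

theorem differentiable_entry [FiniteDimensional ℝ P] {a b : Type*} (L : P →ₗ[ℝ] Matrix a b ℝ)
    (i : a) (j : b) :
    Differentiable ℝ fun p => L p i j :=
  ((Matrix.entryLinearMap ℝ ℝ i j ∘ₗ L).toContinuousLinearMap).differentiable

/-- The `k × n` matrix whose columns `I` form the identity matrix, all others being zero. -/
def selMat (I : Fin k → Fin n) : Matrix (Fin k) (Fin n) ℝ :=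
  Matrix.of fun i r => if r = I i then 1 else 0

theorem mul_selMat_transpose {a : Type*} (M : Matrix a (Fin n) ℝ) (I : Fin k → Fin n) :
    M * (selMat I).transpose = M.submatrix id I := by
  ext i j
  simp [Matrix.mul_apply, selMat]

theorem selMat_mul {b : Type*} (M : Matrix (Fin n) b ℝ) (I : Fin k → Fin n) :
    selMat I * M = M.submatrix I id := by
  ext i j
  simp [Matrix.mul_apply, selMat]

theorem selMat_mul_transpose {I : Fin k → Fin n} (hI : Function.Injective I) :
    selMat I * (selMat I).transpose = 1 := by
  ext i j
  rw [mul_selMat_transpose]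
  simp [selMat, Matrix.one_apply, hI.eq_iff, eq_comm]

theorem echelon_mul_transpose_mul {b : Type*} {I : Fin k → Fin n} (hI : Function.Injective I)
    {Y : Matrix (Fin k) (Fin n) ℝ} (hY : ∀ j i, Y j (I i) = 0) (M : Matrix (Fin k) b ℝ) :
    (selMat I + Y) * ((selMat I).transpose * M) = M := by
  have h1 : Y * (selMat I).transpose = 0 := by
    rw [mul_selMat_transpose]
    ext j i
    exact hY j i
  rw [← Matrix.mul_assoc, Matrix.add_mul, h1, selMat_mul_transpose hI, add_zero, Matrix.one_mul]

/-- The flags solving `(selMat I + Y p) * G = A p * (x₀ + X p)` with prescribed rows outside `I`. -/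
def chartMap (x₀ : Matrix (Fin k) (Fin n) ℝ) (X : P →ₗ[ℝ] Matrix (Fin k) (Fin n) ℝ)
    (A : ι → P →ₗ[ℝ] Matrix (Fin k) (Fin k) ℝ) (Y : ι → P →ₗ[ℝ] Matrix (Fin k) (Fin n) ℝ)
    (G : ι → P →ₗ[ℝ] Matrix (Fin n) (Fin n) ℝ) (I : ι → Fin k → Fin n) (p : P) :
    ι → Fin n → Fin n → ℝ := fun l =>
  (G l p + (selMat (I l)).transpose * (A l p * (x₀ + X p) - Y l p * G l p) :
    Matrix (Fin n) (Fin n) ℝ)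

variable {x₀ : Matrix (Fin k) (Fin n) ℝ} {X : P →ₗ[ℝ] Matrix (Fin k) (Fin n) ℝ}
  {A : ι → P →ₗ[ℝ] Matrix (Fin k) (Fin k) ℝ} {Y : ι → P →ₗ[ℝ] Matrix (Fin k) (Fin n) ℝ}
  {G : ι → P →ₗ[ℝ] Matrix (Fin n) (Fin n) ℝ} {I : ι → Fin k → Fin n}

theorem differentiable_chartMap [FiniteDimensional ℝ P] [Fintype ι] :
    Differentiable ℝ (chartMap x₀ X A Y G I) := by
  refine differentiable_pi.2 fun l => differentiable_pi.2 fun r => differentiable_pi.2 fun c => ?_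
  simp only [chartMap, Matrix.add_apply, Matrix.mul_apply, Matrix.sub_apply]
  have h1 := differentiable_entry X
  have h2 := differentiable_entry (A l)
  have h3 := differentiable_entry (Y l)
  have h4 := differentiable_entry (G l)
  fun_prop

theorem echelon_mul_chartMap (hI : ∀ l, Function.Injective (I l))
    (hY : ∀ l p j i, Y l p j (I l i) = 0) (hG : ∀ l p j c, G l p (I l j) c = 0) (p : P) (l : ι) :
    (selMat (I l) + Y l p) * (Matrix.of (chartMap x₀ X A Y G I p l)) = A l p * (x₀ + X p) := by
  have h2 : selMat (I l) * G l p = 0 := by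
    rw [selMat_mul]
    ext j c
    exact hG l p j c
  have h3 : Matrix.of (chartMap x₀ X A Y G I p l) =
    G l p + (selMat (I l)).transpose * (A l p * (x₀ + X p) - Y l p * G l p) := rfl
  rw [h3, Matrix.mul_add, echelon_mul_transpose_mul (hI l) (hY l p), Matrix.add_mul, h2, zero_add,
    add_sub_cancel]

theorem hasDerivAt_entry_line {a b : Type*} (L : P →ₗ[ℝ] Matrix a b ℝ) (p q : P) (i : a) (j : b) :
    HasDerivAt (fun t : ℝ => L (p + t • q) i j) (L q i j) 0 := by
  have h1 : (fun t : ℝ => L (p + t • q) i j) = fun t => L p i j + t * L q i j := by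
    funext t
    rw [map_add, map_smul]
    rfl
  rw [h1]
  simpa using ((hasDerivAt_id (0 : ℝ)).mul_const (L q i j)).const_add (L p i j)

theorem echelon_mul_fderiv_chartMap [FiniteDimensional ℝ P] [Fintype ι]
    (hI : ∀ l, Function.Injective (I l))
    (hY : ∀ l p j i, Y l p j (I l i) = 0) (hG : ∀ l p j c, G l p (I l j) c = 0) (p q : P) (l : ι) :
    Y l q * Matrix.of (chartMap x₀ X A Y G I p l) +
      (selMat (I l) + Y l p) * Matrix.of (fderiv ℝ (chartMap x₀ X A Y G I) p q l) =
    A l q * (x₀ + X p) + A l p * X q := by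
  ext j c
  have hline : HasDerivAt (fun t : ℝ => p + t • q) q 0 := by
    simpa using ((hasDerivAt_id (0 : ℝ)).smul_const q).const_add p
  have hΦ : ∀ r, HasDerivAt (fun t : ℝ => chartMap x₀ X A Y G I (p + t • q) l r c)
      (fderiv ℝ (chartMap x₀ X A Y G I) p q l r c) 0 := by
    intro r
    have h1 : HasFDerivAt (chartMap x₀ X A Y G I) (fderiv ℝ (chartMap x₀ X A Y G I) p)
        (p + (0 : ℝ) • q) := by
      rw [zero_smul, add_zero]
      exact (differentiable_chartMap p).hasFDerivAt
    have h2 := h1.comp_hasDerivAt (0 : ℝ) hline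
    exact hasDerivAt_pi.1 (hasDerivAt_pi.1 (hasDerivAt_pi.1 h2 l) r) c
  have hL := HasDerivAt.fun_sum (u := Finset.univ) fun r _ =>
    ((hasDerivAt_entry_line (Y l) p q j r).const_add (selMat (I l) j r)).mul (hΦ r)
  have hR := HasDerivAt.fun_sum (u := Finset.univ) fun i _ =>
    (hasDerivAt_entry_line (A l) p q j i).mul ((hasDerivAt_entry_line X p q i c).const_add (x₀ i c))
  have heq := fun t : ℝ => congrFun (congrFun (echelon_mul_chartMap (x₀ := x₀) (X := X) (A := A)
    hI hY hG (p + t • q) l) j) c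
  simp only [Matrix.mul_apply, Matrix.add_apply, Matrix.of_apply] at heq
  have hu := hL.unique (hR.congr_of_eventuallyEq (Filter.Eventually.of_forall heq))
  simp only [zero_smul, add_zero] at hu
  simp only [Matrix.mul_apply, Matrix.add_apply, Matrix.of_apply, ← Finset.sum_add_distrib]
  exact hu

theorem exists_variation [FiniteDimensional ℝ P] [Fintype ι] (hI : ∀ l, Function.Injective (I l))
    (hY : ∀ l p j i, Y l p j (I l i) = 0) (hY' : ∀ l p j r, I l j < r → Y l p j r = 0)
    (hG : ∀ l p j c, G l p (I l j) c = 0) {p : P}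
    (hp : Function.Surjective (fderiv ℝ (chartMap x₀ X A Y G I) p))
    {H : ι → Matrix (Fin n) (Fin n) ℝ}
    (hH : ∀ l, Matrix.of (chartMap x₀ X A Y G I p l) * H l = 1)
    (c : ι → Matrix (Fin k) (Fin n) ℝ) :
    ∃ (x' : Matrix (Fin k) (Fin n) ℝ) (A' : ι → Matrix (Fin k) (Fin k) ℝ), ∀ l j r, I l j < r →
      (A' l * (x₀ + X p) * H l + A l p * x' * H l) j r = c l j r := by
  obtain ⟨q, hq⟩ := hp fun l => ((selMat (I l)).transpose *
    (c l * Matrix.of (chartMap x₀ X A Y G I p l)) : Matrix (Fin n) (Fin n) ℝ)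
  refine ⟨X q, fun l => A l q, fun l j r hr => ?_⟩
  have h1 := echelon_mul_fderiv_chartMap (x₀ := x₀) (X := X) (A := A) hI hY hG p q l
  have h2 : Matrix.of (fderiv ℝ (chartMap x₀ X A Y G I) p q l) =
    (selMat (I l)).transpose * (c l * Matrix.of (chartMap x₀ X A Y G I p l)) := by
      rw [hq]; rfl
  rw [h2, echelon_mul_transpose_mul (hI l) (hY l p)] at h1
  change ((A l q * (x₀ + X p) * H l + A l p * X q * H l) : Matrix (Fin k) (Fin n) ℝ) j r = _
  rw [← Matrix.add_mul, ← h1, Matrix.add_mul, Matrix.mul_assoc, Matrix.mul_assoc, hH,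
    Matrix.mul_one, Matrix.mul_one, Matrix.add_apply, hY' l q j r hr, zero_add]

end EchelonChart

section ChartParameters

variable {k n : ℕ} {ι : Type*}

/-- The matrix with given entries at the positions `s` and zero entries elsewhere. -/
noncomputable def padMat {σ a b : Type*} (s : σ → a × b) : (σ → ℝ) →ₗ[ℝ] Matrix a b ℝ :=
  (Matrix.ofLinearEquiv ℝ).toLinearMap ∘ₗ (LinearEquiv.curry ℝ ℝ a b).toLinearMap ∘ₗ
    Function.ExtendByZero.linearMap ℝ s

theorem padMat_apply {σ a b : Type*} (s : σ → a × b) (f : σ → ℝ) (i : a) (j : b) :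
    padMat s f i j = Function.extend s f 0 (i, j) := rfl

theorem padMat_eq_zero {σ a b : Type*} {s : σ → a × b} (f : σ → ℝ) {i : a} {j : b}
    (h : ∀ x, s x ≠ (i, j)) : padMat s f i j = 0 := by
  rw [padMat_apply, Function.extend_apply' _ _ _ fun ⟨x, hx⟩ => h x hx]
  rfl

theorem padMat_restrict {σ a b : Type*} {s : σ → a × b} (hs : Function.Injective s)
    {M : Matrix a b ℝ} (hM : ∀ i j, (∀ x, s x ≠ (i, j)) → M i j = 0) :
    (padMat s fun x => M (s x).1 (s x).2) = M := by
  ext i j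
  by_cases h : ∀ x, s x ≠ (i, j)
  · rw [padMat_eq_zero _ h, hM i j h]
  · push Not at h
    obtain ⟨x, hx⟩ := h
    rw [padMat_apply, ← hx, hs.extend_apply, hx]

/-- The columns outside `I`. -/
abbrev FreeCol (I : Fin k → Fin n) : Type := {r : Fin n // r ∉ Set.range I}

/-- The free entries of an echelon matrix with leading positions `I`. -/
abbrev FreeEntry (I : Fin k → Fin n) : Type :=
  Σ j : Fin k, {r : Fin n // r ∉ Set.range I ∧ r < I j}

/-- Parameters for a frame normalised at the columns `J`, together with flags for which its
echelon form has leading positions `I`. -/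
abbrev ChartParam (J : Fin k → Fin n) (I : ι → Fin k → Fin n) : Type _ :=
  (Fin k × FreeCol J → ℝ) × (∀ l, (Fin k × Fin k → ℝ) × (FreeEntry (I l) → ℝ) ×
    (FreeCol (I l) × Fin n → ℝ))

variable (J : Fin k → Fin n) (I : ι → Fin k → Fin n)

/-- The frame component of a parameter. -/
noncomputable def ChartParam.frame : ChartParam J I →ₗ[ℝ] Matrix (Fin k) (Fin n) ℝ :=
  padMat (fun x : Fin k × FreeCol J => (x.1, x.2.1)) ∘ₗ LinearMap.fst ℝ _ _

/-- The change of basis component of a parameter. -/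
noncomputable def ChartParam.basis (l : ι) : ChartParam J I →ₗ[ℝ] Matrix (Fin k) (Fin k) ℝ :=
  padMat (fun x : Fin k × Fin k => x) ∘ₗ LinearMap.fst ℝ _ _ ∘ₗ LinearMap.proj l ∘ₗ
    LinearMap.snd ℝ _ _

/-- The echelon component of a parameter. -/
noncomputable def ChartParam.echelon (l : ι) : ChartParam J I →ₗ[ℝ] Matrix (Fin k) (Fin n) ℝ :=
  padMat (fun x : FreeEntry (I l) => (x.1, x.2.1)) ∘ₗ LinearMap.fst ℝ _ _ ∘ₗ
    LinearMap.snd ℝ _ _ ∘ₗ LinearMap.proj l ∘ₗ LinearMap.snd ℝ _ _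

/-- The flag component of a parameter. -/
noncomputable def ChartParam.flag (l : ι) : ChartParam J I →ₗ[ℝ] Matrix (Fin n) (Fin n) ℝ :=
  padMat (fun x : FreeCol (I l) × Fin n => (x.1.1, x.2)) ∘ₗ LinearMap.snd ℝ _ _ ∘ₗ
    LinearMap.snd ℝ _ _ ∘ₗ LinearMap.proj l ∘ₗ LinearMap.snd ℝ _ _

theorem ChartParam.echelon_apply_col (l : ι) (p : ChartParam J I) (j i : Fin k) :
    ChartParam.echelon J I l p j (I l i) = 0 :=
  padMat_eq_zero _ fun x hx => x.2.2.1 ⟨i, (Prod.mk.inj hx).2.symm⟩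

theorem ChartParam.echelon_apply_of_lt (l : ι) (p : ChartParam J I) (j : Fin k) (r : Fin n)
    (h : I l j < r) : ChartParam.echelon J I l p j r = 0 := by
  refine padMat_eq_zero _ ?_
  rintro ⟨i, r', h'⟩ hx
  obtain ⟨rfl, rfl⟩ := Prod.mk.inj hx
  exact lt_asymm h h'.2

theorem ChartParam.flag_apply_row (l : ι) (p : ChartParam J I) (j : Fin k) (c : Fin n) :
    ChartParam.flag J I l p (I l j) c = 0 :=
  padMat_eq_zero _ fun x hx => x.1.2 ⟨j, (Prod.mk.inj hx).1.symm⟩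

theorem ChartParam.exists_eq {x : Matrix (Fin k) (Fin n) ℝ}
    (A : ι → Matrix (Fin k) (Fin k) ℝ) {Y : ι → Matrix (Fin k) (Fin n) ℝ}
    {G : ι → Matrix (Fin n) (Fin n) ℝ} (hx : ∀ i j, x i (J j) = 0)
    (hY : ∀ l j i, Y l j (I l i) = 0) (hY' : ∀ l j r, I l j < r → Y l j r = 0)
    (hG : ∀ l j c, G l (I l j) c = 0) :
    ∃ p : ChartParam J I, ChartParam.frame J I p = x ∧ ∀ l, ChartParam.basis J I l p = A l ∧
      ChartParam.echelon J I l p = Y l ∧ ChartParam.flag J I l p = G l := by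
  refine ⟨(fun t => x t.1 t.2.1, fun l => (fun t => A l t.1 t.2, fun t => Y l t.1 t.2.1,
    fun t => G l t.1.1 t.2)), ?_, fun l => ⟨?_, ?_, ?_⟩⟩
  · refine padMat_restrict (s := fun t : Fin k × FreeCol J => (t.1, t.2.1)) ?_ ?_
    · rintro ⟨i, r⟩ ⟨i', r'⟩ h
      obtain ⟨h1, h2⟩ := Prod.mk.inj h
      exact Prod.ext h1 (Subtype.ext h2)
    · intro i r h
      by_cases hr : r ∈ Set.range J
      · obtain ⟨j, rfl⟩ := hr
        exact hx i j
      · exact absurd rfl (h (i, ⟨r, hr⟩))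
  · exact padMat_restrict (s := fun t : Fin k × Fin k => t) (fun _ _ h => h)
      fun i j h => absurd rfl (h (i, j))
  · refine padMat_restrict (s := fun t : FreeEntry (I l) => (t.1, t.2.1)) ?_ ?_
    · rintro ⟨i, r⟩ ⟨i', r'⟩ h
      obtain ⟨h1, h2⟩ := Prod.mk.inj h
      obtain rfl : i = i' := h1
      obtain rfl : r = r' := Subtype.ext h2
      rfl
    · intro i r h
      by_cases hr : r ∈ Set.range (I l)
      · obtain ⟨j, rfl⟩ := hr
        exact hY l i j
      · rcases lt_trichotomy r (I l i) with h1 | h1 | h1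
        · exact absurd rfl (h ⟨i, ⟨r, hr, h1⟩⟩)
        · exact absurd ⟨i, h1.symm⟩ hr
        · exact hY' l i r h1
  · refine padMat_restrict (s := fun t : FreeCol (I l) × Fin n => (t.1.1, t.2)) ?_ ?_
    · rintro ⟨i, r⟩ ⟨i', r'⟩ h
      obtain ⟨h1, h2⟩ := Prod.mk.inj h
      exact Prod.ext (Subtype.ext h1) h2
    · intro r c h
      by_cases hr : r ∈ Set.range (I l)
      · obtain ⟨j, rfl⟩ := hr
        exact hG l j c
      · exact absurd rfl (h (⟨r, hr⟩, c))

theorem card_freeCol {I : Fin k → Fin n} (hI : Function.Injective I) :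
    Fintype.card (FreeCol I) = n - k := by
  have h1 := Fintype.card_subtype_compl fun r => r ∈ Set.range I
  have h2 : Fintype.card {r // r ∈ Set.range I} = k := by
    rw [← Fintype.card_congr (Equiv.ofInjective I hI), Fintype.card_fin]
  rw [Fintype.card_fin, h2] at h1
  rw [← h1]

theorem card_freeEntry_row {I : Fin k → Fin n} (hI : StrictMono I) (j : Fin k) :
    Fintype.card {r : Fin n // r ∉ Set.range I ∧ r < I j} + j ≤ I j := by
  have h1 : (Finset.univ.filter fun r : Fin n => r ∉ Set.range I ∧ r < I j) ∪
      (Finset.Iio j).image I ⊆ Finset.Iio (I j) := by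
    intro r hr
    simp only [Finset.mem_union, Finset.mem_filter, Finset.mem_univ, true_and, Finset.mem_image,
      Finset.mem_Iio] at hr ⊢
    rcases hr with hr | ⟨i, hi, rfl⟩
    · exact hr.2
    · exact hI hi
  have h2 := Finset.card_le_card h1
  rw [Finset.card_union_of_disjoint, Finset.card_image_of_injective _ hI.injective, Fin.card_Iio,
    Fin.card_Iio] at h2
  · rwa [Fintype.card_subtype]
  · rw [Finset.disjoint_left]
    intro r hr hr'
    simp only [Finset.mem_filter, Finset.mem_univ, true_and, Finset.mem_image] at hr hr'
    obtain ⟨i, -, rfl⟩ := hr'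
    exact hr.1 ⟨i, rfl⟩

theorem ChartParam.finrank_eq [Fintype ι] (hJ : Function.Injective J)
    (hI : ∀ l, Function.Injective (I l)) :
    finrank ℝ (ChartParam J I) = k * (n - k) + ∑ l, (k * k + (∑ j,
      Fintype.card {r : Fin n // r ∉ Set.range (I l) ∧ r < I l j} + (n - k) * n)) := by
  have hfun : ∀ (σ : Type) [Fintype σ], finrank ℝ (σ → ℝ) = Fintype.card σ := fun σ _ =>
    Module.finrank_fintype_fun_eq_card ℝ
  rw [Module.finrank_prod, hfun, Module.finrank_pi_fintype ℝ, Fintype.card_prod, card_freeCol hJ,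
    Fintype.card_fin]
  congr 1
  refine Finset.sum_congr rfl fun l _ => ?_
  rw [Module.finrank_prod, Module.finrank_prod, hfun, hfun, hfun, Fintype.card_prod,
    Fintype.card_prod, Fintype.card_fin, Fintype.card_fin, Fintype.card_sigma, card_freeCol (hI l)]

end ChartParameters

section GenericFlags

variable {k n : ℕ} {ι : Type*} [Fintype ι]

theorem pivotPos_val (hkn : k ≤ n) (lam : ℕ → ℕ) (j : Fin k) :
    (pivotPos hkn lam j : ℕ) = n - k + j - lam j := rfl

theorem card_freeEntry_row_add_le (hkn : k ≤ n) (lam : RectPart n k) {I : Fin k → Fin n}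
    (hI : StrictMono I) (hle : ∀ j, I j ≤ pivotPos hkn lam j) (j : Fin k) :
    Fintype.card {r : Fin n // r ∉ Set.range I ∧ r < I j} + lam.1 j ≤ n - k := by
  have h1 := card_freeEntry_row hI j
  have h2 : (I j : ℕ) ≤ n - k + j - lam.1 j := hle j
  have h3 := lam.2.2.1 j
  omega

theorem chartParam_row_add_le (hkn : k ≤ n) (lam : RectPart n k) {I : Fin k → Fin n}
    (hI : StrictMono I) (hle : ∀ j, I j ≤ pivotPos hkn lam j) :
    k * k + (∑ j, Fintype.card {r : Fin n // r ∉ Set.range I ∧ r < I j} + (n - k) * n) +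
      ∑ j : Fin k, lam.1 j ≤ n * n ∧
    (n * n ≤ k * k + (∑ j, Fintype.card {r : Fin n // r ∉ Set.range I ∧ r < I j} + (n - k) * n) +
      ∑ j : Fin k, lam.1 j → I = pivotPos hkn lam) := by
  have h0 : n * n = k * k + (k * (n - k) + (n - k) * n) := by
    obtain ⟨d, rfl⟩ := Nat.exists_eq_add_of_le hkn
    rw [Nat.add_sub_cancel_left]
    ring
  have h1 := fun j (_ : j ∈ Finset.univ) => card_freeEntry_row_add_le hkn lam hI hle j
  have h2 : ∑ _j : Fin k, (n - k) = k * (n - k) := by simp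
  have h3 := Finset.sum_le_sum h1
  rw [h2, Finset.sum_add_distrib] at h3
  refine ⟨by omega, fun h => ?_⟩
  have h4 := (Finset.sum_eq_sum_iff_of_le h1).1 (by rw [h2, Finset.sum_add_distrib]; omega)
  funext j
  have h5 := h4 j (Finset.mem_univ j)
  have h6 := card_freeEntry_row hI j
  have h7 : (I j : ℕ) ≤ n - k + j - lam.1 j := hle j
  have h8 := lam.2.2.1 j
  exact Fin.ext (by rw [pivotPos_val]; omega)

theorem finrank_chartParam_le (hkn : k ≤ n) {κ : ι → RectPart n k}
    (hκ : ∑ l, ∑ j : Fin k, (κ l).1 j = k * (n - k)) {J : Fin k → Fin n}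
    (hJ : Function.Injective J) {I : ι → Fin k → Fin n} (hI : ∀ l, StrictMono (I l))
    (hle : ∀ l j, I l j ≤ pivotPos hkn (κ l).1 j) :
    finrank ℝ (ChartParam J I) ≤ finrank ℝ (ι → Fin n → Fin n → ℝ) ∧
    (finrank ℝ (ι → Fin n → Fin n → ℝ) ≤ finrank ℝ (ChartParam J I) →
      ∀ l, I l = pivotPos hkn (κ l).1) := by
  have hE : finrank ℝ (ι → Fin n → Fin n → ℝ) = ∑ _l : ι, n * n := by
    simp [Module.finrank_pi_fintype]
  have h1 := fun l (_ : l ∈ Finset.univ) => (chartParam_row_add_le hkn (κ l) (hI l) (hle l)).1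
  have h2 := Finset.sum_le_sum h1
  rw [Finset.sum_add_distrib, hκ] at h2
  rw [hE, ChartParam.finrank_eq J I hJ fun l => (hI l).injective]
  refine ⟨by omega, fun h l => ?_⟩
  have h3 := (Finset.sum_eq_sum_iff_of_le h1).1 (by rw [Finset.sum_add_distrib, hκ]; omega)
  exact (chartParam_row_add_le hkn (κ l) (hI l) (hle l)).2 (h3 l (Finset.mem_univ l)).ge

/-- The map sending parameters to flags. -/
noncomputable def flagChart (J : Fin k → Fin n) (I : ι → Fin k → Fin n) :
    ChartParam J I → ι → Fin n → Fin n → ℝ :=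
  chartMap (selMat J) (ChartParam.frame J I) (ChartParam.basis J I) (ChartParam.echelon J I)
    (ChartParam.flag J I) I

theorem ae_surjective_fderiv_flagChart
    (μ : MeasureTheory.Measure (ι → Fin n → Fin n → ℝ)) [μ.IsAddHaarMeasure] (hkn : k ≤ n)
    {κ : ι → RectPart n k}
    (hκ : ∑ l, ∑ j : Fin k, (κ l).1 j = k * (n - k)) :
    ∀ᵐ G ∂μ, ∀ (J : Fin k → Fin n) (I : ι → Fin k → Fin n),
      Function.Injective J → (∀ l, StrictMono (I l)) → (∀ l j, I l j ≤ pivotPos hkn (κ l).1 j) →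
      ∀ p, flagChart J I p = G → Function.Surjective (fderiv ℝ (flagChart J I) p) := by
  refine MeasureTheory.ae_all_iff.2 fun J => MeasureTheory.ae_all_iff.2 fun I => ?_
  by_cases h : Function.Injective J ∧ (∀ l, StrictMono (I l)) ∧
    ∀ l j, I l j ≤ pivotPos hkn (κ l).1 j
  · obtain ⟨hJ, hI, hle⟩ := h
    have h1 := measure_critical_values_eq_zero μ
      (f := flagChart J I) differentiable_chartMap (finrank_chartParam_le hkn hκ hJ hI hle).1
    rw [MeasureTheory.ae_iff]
    refine MeasureTheory.measure_mono_null ?_ h1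
    intro G hG
    by_contra hcon
    refine hG fun _ _ _ p hp => ?_
    by_contra hs
    exact hcon ⟨p, hp, hs⟩
  · exact Filter.Eventually.of_forall fun G hJ hI hle => absurd ⟨hJ, hI, hle⟩ h

theorem mem_Sol_of_surjective_fderiv (hkn : k ≤ n) {κ : ι → RectPart n k}
    (hκ : ∑ l, ∑ j : Fin k, (κ l).1 j = k * (n - k)) {G H : ι → Matrix (Fin n) (Fin n) ℝ}
    (hGH : ∀ l, G l * H l = 1)
    (hG : ∀ (J : Fin k → Fin n) (I : ι → Fin k → Fin n),
      Function.Injective J → (∀ l, StrictMono (I l)) → (∀ l j, I l j ≤ pivotPos hkn (κ l).1 j) →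
      ∀ p, flagChart J I p = G → Function.Surjective (fderiv ℝ (flagChart J I) p))
    {V : Submodule ℝ (Fin n → ℝ)} (hV : finrank ℝ V = k)
    (hVH : ∀ l (i : Fin k), (i : ℕ) + 1 ≤
      finrank ℝ ↥(V ⊓ flagStep (H l) (n - k + (i + 1) - (κ l).1 i))) :
    V ∈ Sol H fun l => pivotPos hkn (κ l).1 := by
  have hHG : ∀ l, H l * G l = 1 := fun l => mul_eq_one_comm.1 (hGH l)
  obtain ⟨x₁, hx₁, rfl⟩ : ∃ x : Matrix (Fin k) (Fin n) ℝ,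
      LinearIndependent ℝ x.row ∧ rowSp x = V := by
    let b := Module.finBasisOfFinrankEq ℝ V hV
    refine ⟨Matrix.of fun i => (b i : Fin n → ℝ), ?_, ?_⟩
    · exact b.linearIndependent.map' V.subtype V.ker_subtype
    · rw [rowSp_eq_span]
      have h1 := congrArg (Submodule.map V.subtype) b.span_eq
      rw [Submodule.map_span, Submodule.map_top, Submodule.range_subtype, ← Set.range_comp] at h1
      exact h1
  obtain ⟨J, hJ⟩ := exists_submatrix_isUnit hx₁
  have hJdet := (Matrix.isUnit_iff_isUnit_det _).1 hJ
  have hJu := Matrix.isUnit_nonsing_inv_iff.2 hJ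
  set x := (x₁.submatrix id J)⁻¹ * x₁ with hxdef
  have hxJ : x.submatrix id J = 1 := by
    rw [← Matrix.nonsing_inv_mul _ hJdet]
    rfl
  have hJinj : Function.Injective J := fun i j hij => by
    have h1 : (1 : Matrix (Fin k) (Fin k) ℝ) i i = (1 : Matrix (Fin k) (Fin k) ℝ) i j := by
      rw [← hxJ, Matrix.submatrix_apply, Matrix.submatrix_apply, hij]
    by_contra hne
    rw [Matrix.one_apply_eq, Matrix.one_apply_ne hne] at h1
    exact one_ne_zero h1
  rw [← rowSp_mul hJu x₁, ← hxdef] at hVH ⊢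
  have hx : LinearIndependent ℝ x.row := by
    rw [← Matrix.vecMul_injective_iff] at hx₁ ⊢
    intro c c' h
    rw [hxdef] at h
    simp only [← Matrix.vecMul_vecMul] at h
    exact Matrix.vecMul_injective_of_isUnit hJu (hx₁ h)
  have hxH : ∀ l, LinearIndependent ℝ (x * H l).row := fun l => by
    rw [← Matrix.vecMul_injective_iff] at hx ⊢
    intro c c' h
    simp only [← Matrix.vecMul_vecMul] at h
    exact hx (Matrix.vecMul_injective_of_isUnit
      (IsUnit.of_mul_eq_one _ (hHG l)) h)
  choose I A hI hA hone hzero using fun l => exists_echelon (hxH l)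
  have hle : ∀ l j, I l j ≤ pivotPos hkn (κ l).1 j := by
    intro l j
    have h1 := lt_of_le_finrank_inf_flagStep (hA l) (hI l) (hone l) (hVH l j)
    have h2 := (κ l).2.2.1 j
    rw [Fin.le_def, pivotPos_val]
    omega
  have hY : ∀ l j i, (A l * (x * H l) - selMat (I l)) j (I l i) = 0 := fun l j i => by
    rw [Matrix.sub_apply, hone]
    simp [selMat, (hI l).injective.eq_iff, eq_comm]
  obtain ⟨p, hpx, hp⟩ := ChartParam.exists_eq J I A (x := x - selMat J)
    (Y := fun l => A l * (x * H l) - selMat (I l))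
    (G := fun l => G l - (selMat (I l)).transpose * (selMat (I l) * G l))
    (fun i j => by
      have h1 : x i (J j) = (1 : Matrix (Fin k) (Fin k) ℝ) i j := by rw [← hxJ]; rfl
      rw [Matrix.sub_apply, h1]
      simp [selMat, Matrix.one_apply, hJinj.eq_iff, eq_comm])
    hY
    (fun l j r hr => by
      rw [Matrix.sub_apply, hzero l j r hr, zero_sub, neg_eq_zero]
      simp [selMat, hr.ne'])
    (fun l j c => by
      have h1 : selMat (I l) * (G l - (selMat (I l)).transpose * (selMat (I l) * G l)) = 0 := by
        rw [Matrix.mul_sub, ← Matrix.mul_assoc, selMat_mul_transpose (hI l).injective,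
          Matrix.one_mul, sub_self]
      rw [selMat_mul] at h1
      exact congrFun (congrFun h1 j) c)
  have hxp : selMat J + ChartParam.frame J I p = x := by rw [hpx, add_sub_cancel]
  have hpG : ∀ l, Matrix.of (flagChart J I p l) = G l := by
    intro l
    obtain ⟨hpA, hpY, hpG⟩ := hp l
    have h1 : Matrix.of (flagChart J I p l) = ChartParam.flag J I l p + (selMat (I l)).transpose *
      (ChartParam.basis J I l p * (selMat J + ChartParam.frame J I p) -
        ChartParam.echelon J I l p * ChartParam.flag J I l p) := rfl
    have h2 : (A l * (x * H l) - selMat (I l)) * (selMat (I l)).transpose = 0 := by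
      rw [mul_selMat_transpose]
      ext j i
      exact hY l j i
    have h3 : A l * (x * H l) * G l = A l * x := by
      rw [Matrix.mul_assoc, Matrix.mul_assoc, hHG, Matrix.mul_one]
    rw [h1, hxp, hpA, hpY, hpG, Matrix.mul_sub (A l * (x * H l) - selMat (I l)),
      ← Matrix.mul_assoc (A l * (x * H l) - selMat (I l)), h2, Matrix.zero_mul, sub_zero,
      Matrix.sub_mul, h3, sub_sub_cancel, sub_add_cancel]
  have hsurj := hG J I hJinj hI hle p (funext hpG)
  have hrank := LinearMap.finrank_le_finrank_of_surjective
    (f := (fderiv ℝ (flagChart J I) p).toLinearMap) hsurj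
  have hIeq := (finrank_chartParam_le hkn hκ hJinj hI hle).2 hrank
  refine ⟨x, A, ⟨fun l j r hr => ?_, fun l j => ?_, fun c => ?_⟩, rfl⟩
  · rw [Matrix.mul_assoc]
    exact hzero l j r (by rwa [hIeq l])
  · rw [Matrix.mul_assoc, ← hIeq l, hone]
    simp
  · obtain ⟨x', A', h⟩ := exists_variation (fun l => (hI l).injective)
      (ChartParam.echelon_apply_col J I) (ChartParam.echelon_apply_of_lt J I)
      (ChartParam.flag_apply_row J I) hsurj (H := H)
      (fun l => by
        rw [← hGH l, ← hpG l]
        rfl) c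
    refine ⟨x', A', fun l j r hr => ?_⟩
    have h1 := h l j r (by rwa [hIeq l])
    rwa [hxp, (hp l).1] at h1

end GenericFlags

section RealEnumerativity

variable {k n : ℕ}

theorem pivotPos_strictMono (hkn : k ≤ n) (lam : RectPart n k) :
    StrictMono (pivotPos hkn lam.1) := by
  intro i j hij
  have h1 := lam.2.1 (Fin.le_def.1 hij.le)
  have h2 := lam.2.2.1 i
  have h3 : (i : ℕ) < j := hij
  rw [Fin.lt_def, pivotPos_val, pivotPos_val]
  omega

theorem mem_Sol_conditions {ι : Type*} [Nonempty ι] (hkn : k ≤ n) {κ : ι → RectPart n k}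
    {H : ι → Matrix (Fin n) (Fin n) ℝ} {V : Submodule ℝ (Fin n → ℝ)}
    (hV : V ∈ Sol H fun l => pivotPos hkn (κ l).1) :
    finrank ℝ V = k ∧ ∀ l (i : Fin k), (i : ℕ) + 1 ≤
      finrank ℝ ↥(V ⊓ flagStep (H l) (n - k + (i + 1) - (κ l).1 i)) := by
  obtain ⟨x, A, h, rfl⟩ := hV
  have hx := h.linearIndependent (Classical.arbitrary ι) (pivotPos_injective hkn _)
  refine ⟨finrank_rowSp hx, fun l i => ?_⟩
  have hA := h.isUnit l (pivotPos_injective hkn _)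
  have hAx : LinearIndependent ℝ (A l * x).row := by
    rw [← Matrix.vecMul_injective_iff] at hx ⊢
    intro c c' hc
    simp only [← Matrix.vecMul_vecMul] at hc
    exact Matrix.vecMul_injective_of_isUnit hA (hx hc)
  have hli := hAx.comp _ (Fin.castLE_injective (Nat.succ_le_of_lt i.2))
  have h1 := finrank_span_eq_card hli
  rw [Fintype.card_fin] at h1
  rw [← Nat.succ_eq_add_one, ← h1]
  refine Submodule.finrank_mono (Submodule.span_le.2 ?_)
  rintro _ ⟨j, rfl⟩
  have hji : Fin.castLE (Nat.succ_le_of_lt i.2) j ≤ i := Nat.lt_succ_iff.1 j.2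
  refine ⟨?_, fun r hr => ?_⟩
  · rw [SetLike.mem_coe, ← rowSp_mul hA, rowSp_eq_span]
    exact Submodule.subset_span ⟨_, rfl⟩
  · have h2 := (pivotPos_strictMono hkn (κ l)).monotone hji
    rw [Fin.le_def, pivotPos_val hkn _ i] at h2
    refine h.zero l (Fin.castLE (Nat.succ_le_of_lt i.2) j) r ?_
    have h3 := (κ l).2.2.1 i
    rw [Fin.lt_def]
    omega

theorem continuousAt_flag_inv {ι : Type*} [Finite ι] {G₀ : ι → Fin n → Fin n → ℝ}
    (hG₀ : ∀ l, IsUnit (Matrix.of (G₀ l))) :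
    ContinuousAt (fun (G : ι → Fin n → Fin n → ℝ) l => (Matrix.of (G l))⁻¹) G₀ := by
  refine continuousAt_pi.2 fun l => ?_
  have hc : Continuous fun G : ι → Fin n → Fin n → ℝ => Matrix.of (G l) := continuous_apply l
  simp only [Matrix.inv_def, Ring.inverse_eq_inv']
  exact (hc.matrix_det.continuousAt.inv₀ (isUnit_iff_ne_zero.1
    ((Matrix.isUnit_iff_isUnit_det _).1 (hG₀ l)))).smul hc.matrix_adjugate.continuousAt

theorem exists_generic_flags (hkn : k ≤ n) {ι : Type*} [Fintype ι] {κ : ι → RectPart n k}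
    (hκ : ∑ l, ∑ j : Fin k, (κ l).1 j = k * (n - k)) {H₀ : ι → Matrix (Fin n) (Fin n) ℝ}
    (hH₀ : ∀ l, IsUnit (H₀ l)) {p : (ι → Matrix (Fin n) (Fin n) ℝ) → Prop}
    (hp : ∀ᶠ H in nhds H₀, p H) :
    ∃ H, p H ∧ (∀ l, IsUnit (H l)) ∧ ∀ V : Submodule ℝ (Fin n → ℝ), finrank ℝ V = k →
      (∀ l (i : Fin k), (i : ℕ) + 1 ≤
        finrank ℝ ↥(V ⊓ flagStep (H l) (n - k + (i + 1) - (κ l).1 i))) →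
      V ∈ Sol H fun l => pivotPos hkn (κ l).1 := by
  have hdense := MeasureTheory.Measure.dense_of_ae
    (ae_surjective_fderiv_flagChart MeasureTheory.Measure.addHaar hkn hκ)
  let G₀ : ι → Fin n → Fin n → ℝ := fun l => ((H₀ l)⁻¹ : Matrix (Fin n) (Fin n) ℝ)
  have hG₀ : ∀ l, IsUnit (Matrix.of (G₀ l)) := fun l => Matrix.isUnit_nonsing_inv_iff.2 (hH₀ l)
  have hinv : (fun l => (Matrix.of (G₀ l))⁻¹) = H₀ := funext fun l =>
    Matrix.nonsing_inv_nonsing_inv _ ((Matrix.isUnit_iff_isUnit_det _).1 (hH₀ l))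
  have h1 : ∀ᶠ G : ι → Fin n → Fin n → ℝ in nhds G₀, p fun l => (Matrix.of (G l))⁻¹ :=
    (continuousAt_flag_inv hG₀).tendsto.eventually (by rwa [hinv])
  have h2 : ∀ᶠ G : ι → Fin n → Fin n → ℝ in nhds G₀, ∀ l, IsUnit (Matrix.of (G l)) := by
    refine Filter.eventually_all.2 fun l => ?_
    have hc : Continuous fun G : ι → Fin n → Fin n → ℝ => Matrix.of (G l) := continuous_apply l
    filter_upwards [hc.matrix_det.continuousAt.eventually_ne (isUnit_iff_ne_zero.1
      ((Matrix.isUnit_iff_isUnit_det _).1 (hG₀ l)))] with G hG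
    exact (Matrix.isUnit_iff_isUnit_det _).2 (isUnit_iff_ne_zero.2 hG)
  obtain ⟨G, hG, hG1, hG2⟩ := hdense.inter_nhds_nonempty (h1.and h2)
  refine ⟨_, hG1, fun l => Matrix.isUnit_nonsing_inv_iff.2 (hG2 l), fun V hV hVH => ?_⟩
  exact mem_Sol_of_surjective_fderiv hkn hκ (G := fun l => Matrix.of (G l))
    (fun l => Matrix.mul_nonsing_inv _ ((Matrix.isUnit_iff_isUnit_det _).1 (hG2 l))) hG hV hVH

theorem exists_flags_encard_eq (hk : 0 < k) (hkn : k ≤ n) {p : ℕ} {κ : Fin (p + 1) → RectPart n k}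
    (hκ : ∑ l, ∑ j ∈ Finset.range k, (κ l).1 j = k * (n - k)) :
    ∃ H : Fin (p + 1) → Matrix (Fin n) (Fin n) ℝ, (∀ l, IsUnit (H l)) ∧
      {V : Submodule ℝ (Fin n → ℝ) | finrank ℝ V = k ∧ ∀ l (i : Fin k), (i : ℕ) + 1 ≤
        finrank ℝ ↥(V ⊓ flagStep (H l) (n - k + (i + 1) - (κ l).1 i))}.encard =
      (chainCount n k p κ : ℕ∞) := by
  obtain ⟨H₀, hH₀, hle₀⟩ := Ach.of_chainCount hkn p
  have hev : ∀ᶠ H in nhds H₀, ∀ κ' : Fin (p + 1) → RectPart n k,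
      (chainCount n k p κ' : ℕ∞) ≤ (Sol H fun l => pivotPos hkn (κ' l).1).encard :=
    Filter.eventually_all.2 fun κ' =>
      eventually_le_encard_Sol (fun l => pivotPos_injective hkn (κ' l)) (hle₀ κ')
  obtain ⟨H, hle, hH, hgen⟩ := exists_generic_flags hkn (κ := κ)
    (by simpa only [Finset.sum_range] using hκ) hH₀ hev
  refine ⟨H, hH, ?_⟩
  have hset : {V : Submodule ℝ (Fin n → ℝ) | finrank ℝ V = k ∧ ∀ l (i : Fin k), (i : ℕ) + 1 ≤
      finrank ℝ ↥(V ⊓ flagStep (H l) (n - k + (i + 1) - (κ l).1 i))} =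
      Sol H fun l => pivotPos hkn (κ l).1 :=
    Set.ext fun V => ⟨fun hV => hgen V hV.1 hV.2, mem_Sol_conditions hkn⟩
  rw [hset]
  refine le_antisymm (not_lt.1 fun hlt => ?_) (hle κ)
  refine not_ach_chainCount_add hk hkn hκ ⟨H, hH, fun κ' => ?_⟩
  by_cases h : κ' = κ
  · simpa [h] using Order.add_one_le_of_lt hlt
  · simpa [h] using hle κ'

end RealEnumerativity

/-- **Schubert problems are enumerative over the real numbers.**  Given partitions
`λ¹, …, λᵐ` in the `k × (n-k)` rectangle with `Σ_j |λʲ| = k(n-k)`, there are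
complete flags `F¹_•, …, Fᵐ_•` of `ℝⁿ` for which the set of `k`-planes
satisfying all the Schubert conditions is finite of cardinality exactly the
iterated Littlewood–Richardson number. -/
theorem schubert_enumerative_real
    (n k m : ℕ) (hk1 : 1 ≤ k) (hkn : k ≤ n) (hm : 1 ≤ m)
    (lams : ℕ → ℕ → ℕ)
    (hpart : ∀ j, j < m → IsRectPartition n k (lams j))
    (hsum : (∑ j ∈ Finset.range m, ∑ i ∈ Finset.range k, lams j i) = k * (n - k)) :
    ∃ F : ℕ → ℕ → Submodule ℝ (Fin n → ℝ),
      (∀ j, j < m → (F j 0 = ⊥ ∧ F j n = ⊤ ∧ Monotone (F j) ∧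
          ∀ d, d ≤ n → finrank ℝ ↥(F j d) = d)) ∧
      {V : Submodule ℝ (Fin n → ℝ) | finrank ℝ ↥V = k ∧
          ∀ j, j < m → ∀ i, i < k →
            i + 1 ≤ finrank ℝ ↥(V ⊓ F j (n - k + (i + 1) - lams j i))}.Finite ∧
      Nat.card {V : Submodule ℝ (Fin n → ℝ) | finrank ℝ ↥V = k ∧
          ∀ j, j < m → ∀ i, i < k →
            i + 1 ≤ finrank ℝ ↥(V ⊓ F j (n - k + (i + 1) - lams j i))} =
        iteratedLRNumber n k m lams := by
  obtain ⟨p, rfl⟩ : ∃ p, m = p + 1 := ⟨m - 1, by omega⟩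
  obtain ⟨H, hH, hcard⟩ := exists_flags_encard_eq (n := n) (k := k) hk1 hkn
    (κ := fun j : Fin (p + 1) => ⟨lams j, hpart j j.2⟩)
    (by rw [← hsum, Finset.sum_range])
  rw [iteratedLRNumber_eq_chainCount p hpart]
  let F : ℕ → ℕ → Submodule ℝ (Fin n → ℝ) := fun j d =>
    if h : j < p + 1 then flagStep (H ⟨j, h⟩) d else ⊥
  have hF : ∀ j (h : j < p + 1), F j = flagStep (H ⟨j, h⟩) := fun j h =>
    funext fun d => dif_pos h
  have hset : {V : Submodule ℝ (Fin n → ℝ) | finrank ℝ ↥V = k ∧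
      ∀ j, j < p + 1 → ∀ i, i < k →
        i + 1 ≤ finrank ℝ ↥(V ⊓ F j (n - k + (i + 1) - lams j i))} =
      {V : Submodule ℝ (Fin n → ℝ) | finrank ℝ V = k ∧
        ∀ (l : Fin (p + 1)) (i : Fin k),
          (i : ℕ) + 1 ≤ finrank ℝ ↥(V ⊓ flagStep (H l) (n - k + (i + 1) - lams l i))} := by
    ext V
    refine and_congr_right fun _ => ⟨fun h l i => ?_, fun h j hj i hi => ?_⟩
    · have h1 := h l l.2 i i.2
      rwa [hF l l.2] at h1
    · rw [hF j hj]
      exact h ⟨j, hj⟩ ⟨i, hi⟩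
  refine ⟨F, fun j hj => ?_, ?_, ?_⟩
  · rw [hF j hj]
    exact ⟨flagStep_zero (hH _), flagStep_self _, flagStep_mono _,
      fun d hd => finrank_flagStep (hH _) hd⟩
  · rw [hset]
    exact Set.finite_of_encard_eq_coe hcard
  · rw [hset, Nat.card_coe_set_eq, Set.ncard_def, hcard, ENat.toNat_natCast]
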